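/- arXiv:0810.1794 — 3 statements merged into one kernel-verified Lean document; each statement's English description precedes it below -/
import Mathlib

section
/- Let 1 ≤ n ≤ 5, let K ⊆ ℝⁿ be a convex body with nonempty interior, and let P be a real polynomial of degree at most n with P(t) = vol(K + tB) for all t ≥ 0. If ρ > 0 and ρB is a Minkowski summand of K, then every complex root z of P satisfies Re z ≤ −ρ; and if c > 0 and K is a Minkowski summand of cB, then every complex root z of P satisfies Re z ≥ −c. (Corollary: in dimensions n ≤ 5 the real parts of the roots of the Steiner polynomial lie between −ρ_max and −ρ_min, unconditionally.) -/
open MeasureTheory Metric Pointwise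

set_option linter.unusedSectionVars false

/-- One-dimensional Brunn–Minkowski inequality for compact sets. -/
theorem IsCompact.volume_add_volume_le_real {A B : Set ℝ} (hA : IsCompact A) (hB : IsCompact B)
    (hA' : A.Nonempty) (hB' : B.Nonempty) : volume A + volume B ≤ volume (A + B) := by
  obtain ⟨a, ha⟩ := hA.exists_isGreatest hA'
  obtain ⟨b, hb⟩ := hB.exists_isLeast hB'
  have h1 : volume A = volume (A + {b}) := by
    rw [Set.add_singleton, Set.image_add_right, measure_preimage_add_right]
  have h2 : volume B = volume ({a} + B) := by
    rw [Set.singleton_add, Set.image_add_left, measure_preimage_add]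
  have h3 : volume ((A + {b}) ∩ ({a} + B)) = 0 := by
    refine measure_mono_null (t := {a + b}) ?_ (by simp)
    rintro x ⟨⟨p, hp, q, hq, rfl⟩, ⟨r, hr, s, hs, h⟩⟩
    simp only [Set.mem_singleton_iff] at hq hr
    subst hq hr
    have := ha.2 hp
    have := hb.2 hs
    simp only [Set.mem_singleton_iff] at *
    linarith
  have h4 := measure_union_add_inter (μ := volume) (A + {b})
    (t := {a} + B) (isCompact_singleton.add hB).measurableSet
  rw [h3, add_zero] at h4
  rw [h1, h2, ← h4]
  exact measure_mono (Set.union_subset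
    (Set.add_subset_add_left (Set.singleton_subset_iff.2 hb.1))
    (Set.add_subset_add_right (Set.singleton_subset_iff.2 ha.1)))

/-- One-dimensional Brunn–Minkowski inequality for midpoints of measurable sets. -/
theorem volume_add_volume_le_two_mul_real {A B C : Set ℝ} (hA : MeasurableSet A)
    (hB : MeasurableSet B) (hA' : A.Nonempty) (hB' : B.Nonempty)
    (h : ∀ x ∈ A, ∀ y ∈ B, (x + y) / 2 ∈ C) : volume A + volume B ≤ 2 * volume C := by
  obtain ⟨a, ha⟩ := hA'
  obtain ⟨b, hb⟩ := hB'
  have key : ∀ K ⊆ A, IsCompact K → ∀ L ⊆ B, IsCompact L →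
      volume K + volume L ≤ 2 * volume C := by
    intro K hKA hK L hLB hL
    have h1 := (hK.union (isCompact_singleton (x := a))).volume_add_volume_le_real
      (hL.union (isCompact_singleton (x := b))) ⟨a, by simp⟩ ⟨b, by simp⟩
    have h2 : (K ∪ {a}) + (L ∪ {b}) ⊆ (2 : ℝ) • C := by
      rintro _ ⟨x, hx, y, hy, rfl⟩
      refine ⟨(x + y) / 2, h x ?_ y ?_, ?_⟩
      · rcases hx with hx | rfl
        exacts [hKA hx, ha]
      · rcases hy with hy | rfl
        exacts [hLB hy, hb]
      · simp only [smul_eq_mul]; ring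
    calc volume K + volume L ≤ volume (K ∪ {a}) + volume (L ∪ {b}) := by
          gcongr <;> exact Set.subset_union_left
      _ ≤ volume ((2 : ℝ) • C) := h1.trans (measure_mono h2)
      _ = 2 * volume C := by
          rw [Measure.addHaar_smul]; simp
  rw [hA.measure_eq_iSup_isCompact, hB.measure_eq_iSup_isCompact]
  simp only [iSup_and']
  exact ENNReal.biSup_add_biSup_le' ⟨∅, by simp⟩ ⟨∅, by simp⟩
    (fun K hK L hL => key K hK.1 hK.2 L hL.1 hL.2)

theorem ENNReal.mul_le_sq_of_add_le_two_mul {a b c : ENNReal} (h : a + b ≤ 2 * c) :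
    a * b ≤ c ^ 2 := by
  by_cases hc : c = ⊤
  · simp [hc]
  have h2 : a + b ≠ ⊤ := ne_top_of_le_ne_top (ENNReal.mul_ne_top (by simp) hc) h
  obtain ⟨ha, hb⟩ := ENNReal.add_ne_top.1 h2
  lift a to NNReal using ha
  lift b to NNReal using hb
  lift c to NNReal using hc
  norm_cast at *
  have h' : (a : ℝ) + b ≤ 2 * c := by exact_mod_cast h
  have : (a : ℝ) * b ≤ c ^ 2 := by
    nlinarith [sq_nonneg ((a : ℝ) - b), a.2, b.2, c.2]
  exact_mod_cast this

theorem lintegral_ofReal_mul_le_sq_of_normalized {f g h : ℝ → ℝ} (hf : Measurable f)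
    (hg : Measurable g) (hh : Measurable h) (f0 : ∀ x, 0 ≤ f x) (g0 : ∀ x, 0 ≤ g x)
    (h0 : ∀ x, 0 ≤ h x) (f1 : ∀ x, f x ≤ 1) (g1 : ∀ x, g x ≤ 1) (fs : ∀ t < 1, ∃ x, t < f x)
    (gs : ∀ t < 1, ∃ x, t < g x) (H : ∀ x y, f x * g y ≤ h ((x + y) / 2) ^ 2) :
    (∫⁻ x, ENNReal.ofReal (f x)) * ∫⁻ x, ENNReal.ofReal (g x) ≤
      (∫⁻ x, ENNReal.ofReal (h x)) ^ 2 := by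
  apply ENNReal.mul_le_sq_of_add_le_two_mul
  have mlt : ∀ {u : ℝ → ℝ}, Measurable u → Measurable fun t : ℝ => volume {a | t < u a} :=
    fun {u} _ => Antitone.measurable fun s t hst =>
      measure_mono fun a (ha : t < u a) => hst.trans_lt ha
  rw [lintegral_eq_lintegral_meas_lt _ (.of_forall f0) hf.aemeasurable,
    lintegral_eq_lintegral_meas_lt _ (.of_forall g0) hg.aemeasurable,
    lintegral_eq_lintegral_meas_lt _ (.of_forall h0) hh.aemeasurable,
    ← lintegral_add_left (mlt hf), ← lintegral_const_mul _ (mlt hh)]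
  refine setLIntegral_mono ((mlt hh).const_mul _) fun t ht => ?_
  by_cases ht1 : t < 1
  · refine volume_add_volume_le_two_mul_real (hf measurableSet_Ioi) (hg measurableSet_Ioi)
      (fs t ht1) (gs t ht1) fun x hx y hy => ?_
    have hx : t < f x := hx
    have hy : t < g y := hy
    have ht : 0 < t := ht
    refine lt_of_pow_lt_pow_left₀ 2 (h0 _) ((?_ : t ^ 2 < _).trans_le (H x y))
    nlinarith
  · have e : ∀ u : ℝ → ℝ, (∀ x, u x ≤ 1) → {a | t < u a} = ∅ := fun u hu =>
      Set.eq_empty_of_forall_notMem fun x (hx : t < u x) => ht1 (hx.trans_le (hu x))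
    simp [e f f1, e g g1]

theorem lintegral_mul_le_sq_of_bounded {f g h : ℝ → ENNReal} (hf : Measurable f)
    (hg : Measurable g) (hh : Measurable h) {k : ENNReal} (hk : k ≠ ⊤) (fk : ∀ x, f x ≤ k)
    (gk : ∀ x, g x ≤ k) (H : ∀ x y, f x * g y ≤ h ((x + y) / 2) ^ 2) :
    (∫⁻ x, f x) * ∫⁻ x, g x ≤ (∫⁻ x, h x) ^ 2 := by
  obtain ⟨A, hA⟩ : ∃ A, A = ⨆ x, f x := ⟨_, rfl⟩
  obtain ⟨B, hB⟩ : ∃ B, B = ⨆ x, g x := ⟨_, rfl⟩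
  have fA : ∀ x, f x ≤ A := fun x => hA ▸ le_iSup f x
  have gB : ∀ x, g x ≤ B := fun x => hB ▸ le_iSup g x
  by_cases hA0 : A = 0
  · have : f = 0 := funext fun x => le_antisymm ((fA x).trans hA0.le) (zero_le)
    simp [this]
  by_cases hB0 : B = 0
  · have : g = 0 := funext fun x => le_antisymm ((gB x).trans hB0.le) (zero_le)
    simp [this]
  have hAt : A ≠ ⊤ := ne_top_of_le_ne_top hk (hA ▸ iSup_le fk)
  have hBt : B ≠ ⊤ := ne_top_of_le_ne_top hk (hB ▸ iSup_le gk)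
  set c : ENNReal := (A * B) ^ (1 / 2 : ℝ) with hc
  have hc2 : c ^ 2 = A * B := by
    rw [hc, ← ENNReal.rpow_natCast, ← ENNReal.rpow_mul]; norm_num
  have hc0 : c ≠ 0 := by
    intro h0; rw [h0] at hc2; simp [hA0, hB0] at hc2
  have hct : c ≠ ⊤ := by
    intro h0; rw [h0] at hc2
    exact (ENNReal.mul_ne_top hAt hBt) (by rw [← hc2]; simp)
  have fA' : ∀ x, f x / A ≤ 1 := fun x => ENNReal.div_le_of_le_mul (by simpa using fA x)
  have gB' : ∀ x, g x / B ≤ 1 := fun x => ENNReal.div_le_of_le_mul (by simpa using gB x)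
  have fin : ∀ {a : ENNReal}, a ≤ 1 → a ≠ ⊤ := fun h => ne_top_of_le_ne_top (by simp) h
  have sup : ∀ (u : ℝ → ENNReal) (C : ENNReal), C ≠ 0 → C ≠ ⊤ → C = ⨆ x, u x →
      (∀ x, u x / C ≤ 1) → ∀ t < (1 : ℝ), ∃ x, t < (u x / C).toReal := by
    intro u C C0 Ct hC hu t ht
    by_contra! hcon
    have : ∀ x, u x ≤ ENNReal.ofReal t * C := fun x => by
      rw [← ENNReal.div_le_iff C0 Ct, ← ENNReal.ofReal_toReal (fin (hu x))]
      exact ENNReal.ofReal_le_ofReal (hcon x)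
    have h2 : C ≤ ENNReal.ofReal t * C := by
      conv_lhs => rw [hC]
      exact iSup_le this
    have h3 : ENNReal.ofReal t * C < 1 * C := by
      refine (ENNReal.mul_lt_mul_iff_left C0 Ct).2 ?_
      simpa using ht
    rw [one_mul] at h3
    exact absurd h2 (not_le.2 h3)
  have key := lintegral_ofReal_mul_le_sq_of_normalized
    (f := fun x => (f x / A).toReal) (g := fun x => (g x / B).toReal)
    (h := fun x => (min (h x / c) 1).toReal) (hf.div_const _).ennreal_toReal
    (hg.div_const _).ennreal_toReal ((hh.div_const _).min measurable_const).ennreal_toReal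
    (fun _ => ENNReal.toReal_nonneg) (fun _ => ENNReal.toReal_nonneg)
    (fun _ => ENNReal.toReal_nonneg)
    (fun x => ENNReal.toReal_le_of_le_ofReal zero_le_one (by simpa using fA' x))
    (fun x => ENNReal.toReal_le_of_le_ofReal zero_le_one (by simpa using gB' x))
    (sup f A hA0 hAt hA fA') (sup g B hB0 hBt hB gB') ?_
  · have e1 : ∀ x, ENNReal.ofReal (f x / A).toReal = f x * A⁻¹ :=
      fun x => ENNReal.ofReal_toReal (fin (fA' x))
    have e2 : ∀ x, ENNReal.ofReal (g x / B).toReal = g x * B⁻¹ :=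
      fun x => ENNReal.ofReal_toReal (fin (gB' x))
    have e3 : ∀ x, ENNReal.ofReal (min (h x / c) 1).toReal ≤ h x * c⁻¹ :=
      fun x => ENNReal.ofReal_toReal_le.trans (min_le_left _ _)
    simp only [e1, e2] at key
    rw [lintegral_mul_const _ hf, lintegral_mul_const _ hg] at key
    replace key := key.trans (pow_le_pow_left' (lintegral_mono e3) 2)
    rw [lintegral_mul_const _ hh] at key
    calc (∫⁻ x, f x) * ∫⁻ x, g x
        = (A * A⁻¹) * (B * B⁻¹) * ((∫⁻ x, f x) * ∫⁻ x, g x) := by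
          rw [ENNReal.mul_inv_cancel hA0 hAt, ENNReal.mul_inv_cancel hB0 hBt]; simp
      _ = c ^ 2 * (((∫⁻ x, f x) * A⁻¹) * ((∫⁻ x, g x) * B⁻¹)) := by rw [hc2]; ring
      _ ≤ c ^ 2 * ((∫⁻ x, h x) * c⁻¹) ^ 2 := by gcongr
      _ = (c * c⁻¹) ^ 2 * (∫⁻ x, h x) ^ 2 := by ring
      _ = (∫⁻ x, h x) ^ 2 := by rw [ENNReal.mul_inv_cancel hc0 hct]; simp
  · intro x y
    rw [← ENNReal.toReal_mul, ← ENNReal.toReal_pow]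
    refine ENNReal.toReal_mono (ENNReal.pow_ne_top (fin (min_le_right _ _))) ?_
    rcases min_choice (h ((x + y) / 2) / c) 1 with e | e <;> rw [e]
    · rw [ENNReal.div_eq_inv_mul, ENNReal.div_eq_inv_mul, ENNReal.div_eq_inv_mul, mul_pow,
        ← ENNReal.inv_pow, hc2, ENNReal.mul_inv (.inl hA0) (.inl hAt), mul_mul_mul_comm]
      gcongr
      exact H x y
    · rw [one_pow]; exact mul_le_one' (fA' x) (gB' y)

/-- One-dimensional Prékopa–Leindler inequality (midpoint form). -/
theorem lintegral_mul_le_sq_real {f g h : ℝ → ENNReal} (hf : Measurable f)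
    (hg : Measurable g) (hh : Measurable h) (H : ∀ x y, f x * g y ≤ h ((x + y) / 2) ^ 2) :
    (∫⁻ x, f x) * ∫⁻ x, g x ≤ (∫⁻ x, h x) ^ 2 := by
  have tr : ∀ u : ℝ → ENNReal, Measurable u →
      ∫⁻ x, u x = ⨆ k : ℕ, ∫⁻ x, min (u x) k := by
    intro u hu
    rw [← lintegral_iSup (fun k => hu.min measurable_const)]
    · congr 1; ext x
      have : (⨆ k : ℕ, min (u x) (k : ENNReal)) = min (u x) (⨆ k : ℕ, (k : ENNReal)) :=
        (inf_iSup_eq _ _).symm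
      rw [this, ENNReal.iSup_natCast]; simp
    · intro i j hij x
      exact min_le_min_left _ (by exact_mod_cast hij)
  rw [tr f hf, tr g hg, ENNReal.iSup_mul]
  refine iSup_le fun i => ?_
  rw [ENNReal.mul_iSup]
  refine iSup_le fun j => ?_
  refine lintegral_mul_le_sq_of_bounded (hf.min measurable_const) (hg.min measurable_const) hh
    (k := max i j) (by simp) (fun x => (min_le_right _ _).trans (le_max_left _ _))
    (fun x => (min_le_right _ _).trans (le_max_right _ _)) fun x y =>
    (mul_le_mul' (min_le_left _ _) (min_le_left _ _)).trans (H x y)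

/-- Prékopa–Leindler inequality on `Fin n → ℝ` (midpoint form). -/
theorem lintegral_mul_le_sq_pi (n : ℕ) {f g h : (Fin n → ℝ) → ENNReal} (hf : Measurable f)
    (hg : Measurable g) (hh : Measurable h)
    (H : ∀ x y, f x * g y ≤ h ((1 / 2 : ℝ) • (x + y)) ^ 2) :
    (∫⁻ x, f x) * ∫⁻ x, g x ≤ (∫⁻ x, h x) ^ 2 := by
  induction n with
  | zero =>
    have hv : (volume : Measure (Fin 0 → ℝ)) Set.univ = 1 := by
      rw [volume_pi, Measure.pi_of_empty, measure_univ]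
    simp only [lintegral_unique, hv, mul_one]
    convert H default default
  | succ n ih =>
    have mp := (volume_preserving_piFinSuccAbove (fun _ : Fin (n + 1) => ℝ) 0).symm
    have e : ∀ u : (Fin (n + 1) → ℝ) → ENNReal, Measurable u → Measurable
        (fun p : ℝ × (Fin n → ℝ) => u ((MeasurableEquiv.piFinSuccAbove _ 0).symm p)) ∧
        ∫⁻ x, u x = ∫⁻ s, ∫⁻ y, u ((MeasurableEquiv.piFinSuccAbove _ 0).symm (s, y)) := by
      intro u hu
      have m := hu.comp (MeasurableEquiv.piFinSuccAbove (fun _ : Fin (n + 1) => ℝ) 0).symm.measurable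
      refine ⟨m, ?_⟩
      rw [← mp.lintegral_comp hu, Measure.volume_eq_prod]
      exact lintegral_prod _ m.aemeasurable
    obtain ⟨mf, ef⟩ := e f hf
    obtain ⟨mg, eg⟩ := e g hg
    obtain ⟨mh, eh⟩ := e h hh
    rw [ef, eg, eh]
    refine lintegral_mul_le_sq_real mf.lintegral_prod_right' mg.lintegral_prod_right'
      mh.lintegral_prod_right' fun s t => ?_
    refine ih (mf.comp measurable_prodMk_left) (mg.comp measurable_prodMk_left)
      (mh.comp measurable_prodMk_left) fun x y => (H _ _).trans_eq ?_
    congr 2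
    ext i
    refine Fin.cases ?_ (fun i => ?_) i
    · simp [MeasurableEquiv.piFinSuccAbove]; ring
    · simp [MeasurableEquiv.piFinSuccAbove]; ring

theorem volume_mul_volume_le_sq {n : ℕ} {A B C : Set (EuclideanSpace ℝ (Fin n))}
    (hA : IsCompact A) (hB : IsCompact B) (hC : IsCompact C)
    (h : ∀ x ∈ A, ∀ y ∈ B, (1 / 2 : ℝ) • (x + y) ∈ C) :
    (volume A).toReal * (volume B).toReal ≤ (volume C).toReal ^ 2 := by
  rw [← ENNReal.toReal_mul, ← ENNReal.toReal_pow]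
  refine ENNReal.toReal_mono (ENNReal.pow_ne_top hC.measure_ne_top) ?_
  have mp := PiLp.volume_preserving_toLp (Fin n)
  have e : ∀ D : Set (EuclideanSpace ℝ (Fin n)), IsCompact D →
      Measurable (fun x : Fin n → ℝ => D.indicator (1 : EuclideanSpace ℝ (Fin n) → ENNReal) (WithLp.toLp 2 x)) ∧
      volume D = ∫⁻ x : Fin n → ℝ, D.indicator 1 (WithLp.toLp 2 x) := by
    intro D hD
    have m : Measurable (D.indicator (1 : EuclideanSpace ℝ (Fin n) → ENNReal)) :=
      measurable_one.indicator hD.measurableSet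
    exact ⟨m.comp mp.measurable, by
      rw [mp.lintegral_comp m, lintegral_indicator_one hD.measurableSet]⟩
  rw [(e A hA).2, (e B hB).2, (e C hC).2]
  refine lintegral_mul_le_sq_pi n (e A hA).1 (e B hB).1 (e C hC).1 fun x y => ?_
  by_cases hx : WithLp.toLp 2 x ∈ A
  · by_cases hy : WithLp.toLp 2 y ∈ B
    · have := h _ hx _ hy
      have h2 : WithLp.toLp 2 ((1 / 2 : ℝ) • (x + y)) ∈ C := by simpa using this
      rw [Set.indicator_of_mem hx, Set.indicator_of_mem hy, Set.indicator_of_mem h2]; simp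
    · simp [hy]
  · simp [hx]

/-- The set `M + ∑ i, [-x i, x i] • u i`. -/
def zonotopeBody {ι E : Type*} [Fintype ι] [AddCommGroup E] [Module ℝ E] (M : Set E)
    (u : ι → E) (x : ι → ℝ) : Set E :=
  {z | ∃ p ∈ M, ∃ s : ι → ℝ, (∀ i, |s i| ≤ x i) ∧ z = p + ∑ i, s i • u i}

section Zonotope
variable {ι : Type*} [Fintype ι] {n : ℕ}

theorem zonotopeBody_eq_image {E : Type*} [AddCommGroup E] [Module ℝ E] (M : Set E)
    (u : ι → E) (x : ι → ℝ) :
    zonotopeBody M u x = (fun q : E × (ι → ℝ) => q.1 + ∑ i, q.2 i • u i) ''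
      (M ×ˢ Set.pi Set.univ fun i => Set.Icc (-x i) (x i)) := by
  ext z
  constructor
  · rintro ⟨p, hp, s, hs, rfl⟩
    exact ⟨(p, s), ⟨hp, fun i _ => abs_le.1 (hs i)⟩, rfl⟩
  · rintro ⟨⟨p, s⟩, ⟨hp, hs⟩, rfl⟩
    exact ⟨p, hp, s, fun i => abs_le.2 (hs i trivial), rfl⟩

theorem IsCompact.zonotopeBody {E : Type*} [NormedAddCommGroup E] [NormedSpace ℝ E]
    {M : Set E} (hM : IsCompact M) (u : ι → E) (x : ι → ℝ) :
    IsCompact (zonotopeBody M u x) := by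
  rw [zonotopeBody_eq_image]
  exact (hM.prod (isCompact_univ_pi fun i => isCompact_Icc)).image (by fun_prop)

theorem Convex.zonotopeBody {E : Type*} [AddCommGroup E] [Module ℝ E]
    {M : Set E} (hM : Convex ℝ M) (u : ι → E) (x : ι → ℝ) :
    Convex ℝ (zonotopeBody M u x) := by
  rintro _ ⟨p, hp, s, hs, rfl⟩ _ ⟨q, hq, t, ht, rfl⟩ a b ha hb hab
  refine ⟨a • p + b • q, hM hp hq ha hb hab, fun i => a * s i + b * t i, fun i => ?_, ?_⟩
  · calc |a * s i + b * t i| ≤ |a * s i| + |b * t i| := abs_add_le _ _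
      _ = a * |s i| + b * |t i| := by rw [abs_mul, abs_mul, abs_of_nonneg ha, abs_of_nonneg hb]
      _ ≤ a * x i + b * x i := by gcongr <;> simp [hs, ht]
      _ = x i := by rw [← add_mul, hab, one_mul]
  · simp only [add_smul, mul_smul, Finset.sum_add_distrib, smul_add, Finset.smul_sum]
    abel

theorem zonotopeBody_mono {E : Type*} [AddCommGroup E] [Module ℝ E] {M M' : Set E}
    (h : M ⊆ M') (u : ι → E) {x y : ι → ℝ} (hxy : x ≤ y) :
    zonotopeBody M u x ⊆ zonotopeBody M' u y := by
  rintro _ ⟨p, hp, s, hs, rfl⟩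
  exact ⟨p, h hp, s, fun i => (hs i).trans (hxy i), rfl⟩

theorem zonotopeBody_zonotopeBody {E : Type*} [AddCommGroup E] [Module ℝ E] {M : Set E}
    (u : ι → E) {x y : ι → ℝ} (hx : 0 ≤ x) (hy : 0 ≤ y) :
    zonotopeBody (zonotopeBody M u x) u y = zonotopeBody M u (x + y) := by
  ext z
  constructor
  · rintro ⟨_, ⟨p, hp, s, hs, rfl⟩, t, ht, rfl⟩
    refine ⟨p, hp, s + t, fun i => (abs_add_le _ _).trans (add_le_add (hs i) (ht i)), ?_⟩
    simp only [Pi.add_apply, add_smul, Finset.sum_add_distrib, add_assoc]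
  · rintro ⟨p, hp, s, hs, rfl⟩
    have hxi : ∀ i, |max (-x i) (min (x i) (s i))| ≤ x i := fun i => by
      have := hx i
      simp only [Pi.zero_apply] at this
      exact abs_le.2 ⟨le_max_left _ _, max_le (by linarith) (min_le_left _ _)⟩
    refine ⟨_, ⟨p, hp, fun i => max (-x i) (min (x i) (s i)), hxi, rfl⟩,
      fun i => s i - max (-x i) (min (x i) (s i)), fun i => ?_, ?_⟩
    · have h1 := hx i
      have h2 := hy i
      have h3 := abs_le.1 (hs i)
      simp only [Pi.zero_apply, Pi.add_apply] at *
      rw [abs_le]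
      rcases max_cases (-x i) (min (x i) (s i)) with h | h <;>
        rcases min_cases (x i) (s i) with h' | h' <;> constructor <;> linarith
    · simp only [sub_smul, Finset.sum_sub_distrib]
      abel

theorem smul_zonotopeBody {E : Type*} [AddCommGroup E] [Module ℝ E] {M : Set E}
    (u : ι → E) (x : ι → ℝ) {a : ℝ} (ha : 0 < a) :
    a • zonotopeBody M u x = zonotopeBody (a • M) u (a • x) := by
  ext z
  constructor
  · rintro ⟨_, ⟨p, hp, s, hs, rfl⟩, rfl⟩
    refine ⟨a • p, ⟨p, hp, rfl⟩, a • s, fun i => ?_, ?_⟩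
    · simp only [Pi.smul_apply, smul_eq_mul, abs_mul, abs_of_pos ha]
      exact mul_le_mul_of_nonneg_left (hs i) ha.le
    · simp [smul_add, Finset.smul_sum, mul_smul]
  · rintro ⟨_, ⟨p, hp, rfl⟩, s, hs, rfl⟩
    refine ⟨_, ⟨p, hp, a⁻¹ • s, fun i => ?_, rfl⟩, ?_⟩
    · have := hs i
      simp only [Pi.smul_apply, smul_eq_mul, abs_mul, abs_of_pos ha, abs_inv] at *
      rwa [inv_mul_le_iff₀ ha]
    · simp [smul_add, Finset.smul_sum, smul_smul, mul_inv_cancel_left₀ ha.ne']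

/-- A monotone additive function on `[0, ∞)` is linear. -/
theorem eq_mul_of_additive_of_monotone {g : ℝ → ℝ}
    (hadd : ∀ x y, 0 ≤ x → 0 ≤ y → g (x + y) = g x + g y)
    (hmono : ∀ x y, 0 ≤ x → x ≤ y → g x ≤ g y) {x : ℝ} (hx : 0 ≤ x) : g x = x * g 1 := by
  have h0 : g 0 = 0 := by have := hadd 0 0 le_rfl le_rfl; simp at this; exact this
  have hmul : ∀ (k : ℕ) (y : ℝ), 0 ≤ y → g (k * y) = k * g y := by
    intro k y hy
    induction k with
    | zero => simp [h0]
    | succ k ih =>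
      push_cast
      rw [add_mul, hadd _ _ (by positivity) (by positivity), ih]; simp; ring
  have h1 : 0 ≤ g 1 := by rw [← h0]; exact hmono _ _ le_rfl zero_le_one
  have key : ∀ k : ℕ, k * |g x - x * g 1| ≤ g 1 := by
    intro k
    have hk : (0 : ℝ) ≤ k * x := by positivity
    have a1 := Nat.floor_le hk
    have a2 := (Nat.lt_floor_add_one (k * x)).le
    set m := ⌊k * x⌋₊
    have b1 := hmono _ _ (by positivity) a1
    have b2 := hmono _ _ hk a2
    have c1 := hmul m 1 zero_le_one
    have c2 := hmul (m + 1) 1 zero_le_one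
    push_cast at c2
    simp only [mul_one] at c1 c2
    rw [c1, hmul k x hx] at b1
    rw [c2, hmul k x hx] at b2
    rw [← abs_of_nonneg (Nat.cast_nonneg (α := ℝ) k), ← abs_mul, abs_le]
    constructor <;> nlinarith
  by_contra hne
  have hpos : 0 < |g x - x * g 1| := abs_pos.2 (sub_ne_zero.2 hne)
  obtain ⟨k, hk⟩ := exists_nat_gt (g 1 / |g x - x * g 1|)
  rw [div_lt_iff₀ hpos] at hk
  linarith [key k]

/-- The volume of `L + [-a, a] • v` is an affine function of `a`. -/
theorem exists_volume_add_segment_eq {L : Set (EuclideanSpace ℝ (Fin n))} (hL : IsCompact L)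
    (hLc : Convex ℝ L) (v : EuclideanSpace ℝ (Fin n)) :
    ∃ c₀ c₁ : ℝ, ∀ a : ℝ, 0 ≤ a →
      (volume {z | ∃ p ∈ L, ∃ s : ℝ, |s| ≤ a ∧ z = p + s • v}).toReal = c₀ + a * c₁ := by
  set A : ℝ → Set (EuclideanSpace ℝ (Fin n)) :=
    fun a => {z | ∃ p ∈ L, ∃ s : ℝ, |s| ≤ a ∧ z = p + s • v} with hA
  have hAc : ∀ a, IsCompact (A a) := fun a => by
    have : A a = (fun q : _ × ℝ => q.1 + q.2 • v) '' (L ×ˢ Set.Icc (-a) a) := by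
      ext z
      constructor
      · rintro ⟨p, hp, s, hs, rfl⟩
        exact ⟨(p, s), ⟨hp, abs_le.1 hs⟩, rfl⟩
      · rintro ⟨⟨p, s⟩, ⟨hp, hs⟩, rfl⟩
        exact ⟨p, hp, s, abs_le.2 hs, rfl⟩
    rw [this]
    exact (hL.prod isCompact_Icc).image (by fun_prop)
  set f : ℝ → ℝ := fun a => (volume (A a)).toReal with hf
  have hA0 : A 0 = L := by
    ext z
    constructor
    · rintro ⟨p, hp, s, hs, rfl⟩
      have : s = 0 := abs_nonpos_iff.1 hs
      simpa [this] using hp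
    · intro hz
      exact ⟨z, hz, 0, by simp, by simp⟩
  have mono : ∀ x y, 0 ≤ x → x ≤ y → f x ≤ f y := fun x y _ hxy => by
    refine ENNReal.toReal_mono (hAc y).measure_ne_top (measure_mono ?_)
    rintro _ ⟨p, hp, s, hs, rfl⟩
    exact ⟨p, hp, s, hs.trans hxy, rfl⟩
  have hfadd : ∀ x y, 0 ≤ x → 0 ≤ y → f (x + y) + f 0 = f x + f y := fun x y hx hy => by
    have t1 : ∀ (w : EuclideanSpace ℝ (Fin n)) (D : Set (EuclideanSpace ℝ (Fin n))), volume (D + {w}) = volume D := by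
      intro w D
      rw [Set.add_singleton, Set.image_add_right, measure_preimage_add_right]
    have e := measure_union_add_inter (μ := volume) (A x + {(-y) • v})
      (t := A y + {x • v}) ((hAc y).add isCompact_singleton).measurableSet
    have hu : (A x + {(-y) • v}) ∪ (A y + {x • v}) = A (x + y) := by
      ext z
      constructor
      · rintro (⟨_, ⟨p, hp, s, hs, rfl⟩, _, rfl, rfl⟩ | ⟨_, ⟨p, hp, s, hs, rfl⟩, _, rfl, rfl⟩)
        · refine ⟨p, hp, s - y, ?_, by simp only; module⟩
          rw [abs_le] at *; constructor <;> linarith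
        · refine ⟨p, hp, s + x, ?_, by simp only; module⟩
          rw [abs_le] at *; constructor <;> linarith
      · rintro ⟨p, hp, s, hs, rfl⟩
        rw [abs_le] at hs
        by_cases h : s ≤ x - y
        · left
          refine ⟨_, ⟨p, hp, s + y, ?_, rfl⟩, _, rfl, by simp only; module⟩
          rw [abs_le]; constructor <;> linarith
        · right
          refine ⟨_, ⟨p, hp, s - x, ?_, rfl⟩, _, rfl, by simp only; module⟩
          rw [abs_le]; constructor <;> linarith
    have hi : (A x + {(-y) • v}) ∩ (A y + {x • v}) = L + {(x - y) • v} := by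
      ext z
      constructor
      · rintro ⟨⟨_, ⟨p, hp, s, hs, rfl⟩, _, rfl, rfl⟩, ⟨_, ⟨q, hq, t, ht, rfl⟩, _, rfl, hz⟩⟩
        simp only at hz ⊢
        rw [abs_le] at hs ht
        refine ⟨p + (s - x) • v, ?_, _, rfl, by simp only; module⟩
        -- the point lies on the segment from `p` to `q`
        have hq' : q = p + (s - y - t - x) • v := by
          have : q = (q + t • v + x • v) - (t + x) • v := by module
          rw [this, hz]; module
        by_cases h0 : x - s = 0
        · have : s - x = 0 := by linarith
          simpa [this] using hp
        · have hpos : 0 < x - s := lt_of_le_of_ne (by linarith) (Ne.symm h0)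
          have hD : 0 < t + x + y - s := by linarith
          have := hLc hp hq (a := (t + y) / (t + x + y - s)) (b := (x - s) / (t + x + y - s))
            (div_nonneg (by linarith) hD.le) (div_nonneg hpos.le hD.le) (by field_simp; ring)
          convert this using 1
          rw [hq', smul_add, smul_smul, ← add_assoc, ← add_smul]
          congr 1
          · rw [show (t + y) / (t + x + y - s) + (x - s) / (t + x + y - s) = 1 by
              field_simp; ring, one_smul]
          · congr 1; field_simp; ring
      · rintro ⟨p, hp, _, rfl, rfl⟩
        exact ⟨⟨_, ⟨p, hp, x, by rw [abs_of_nonneg hx], rfl⟩, _, rfl, by simp only; module⟩,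
          ⟨_, ⟨p, hp, -y, by rw [abs_neg, abs_of_nonneg hy], rfl⟩, _, rfl, by simp only; module⟩⟩
    rw [hu, hi, t1, t1, t1] at e
    simp only [hf]
    rw [hA0, ← ENNReal.toReal_add (hAc _).measure_ne_top hL.measure_ne_top, e,
      ENNReal.toReal_add (hAc _).measure_ne_top (hAc _).measure_ne_top]
  refine ⟨f 0, f 1 - f 0, fun a ha => ?_⟩
  have := eq_mul_of_additive_of_monotone (g := fun x => f x - f 0)
    (fun x y hx hy => by linarith [hfadd x y hx hy])
    (fun x y hx hxy => by linarith [mono x y hx hxy]) ha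
  change f a = _
  linarith

theorem zonotopeBody_update [DecidableEq ι] {E : Type*} [AddCommGroup E] [Module ℝ E] (M : Set E)
    (u : ι → E) (x : ι → ℝ) (i : ι) {a : ℝ} :
    zonotopeBody M u (Function.update x i a) =
      {z | ∃ p ∈ zonotopeBody M u (Function.update x i 0), ∃ s : ℝ, |s| ≤ a ∧
        z = p + s • u i} := by
  ext z
  constructor
  · rintro ⟨p, hp, s, hs, rfl⟩
    refine ⟨_, ⟨p, hp, Function.update s i 0, fun j => ?_, rfl⟩, s i, by simpa using hs i, ?_⟩
    · by_cases hj : j = i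
      · subst hj; simp
      · simpa [hj] using hs j
    · rw [add_assoc, ← Finset.sum_erase_add _ _ (Finset.mem_univ i),
        ← Finset.sum_erase_add _ _ (Finset.mem_univ i)]
      simp only [Function.update_self, zero_smul, add_zero]
      congr 2
      refine Finset.sum_congr rfl fun j hj => ?_
      rw [Function.update_of_ne (Finset.ne_of_mem_erase hj)]
  · rintro ⟨_, ⟨p, hp, s, hs, rfl⟩, t, ht, rfl⟩
    refine ⟨p, hp, Function.update s i t, fun j => ?_, ?_⟩
    · by_cases hj : j = i
      · subst hj; simpa using ht
      · simpa [hj] using hs j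
    · have hsi : s i = 0 := by have := hs i; simpa using this
      rw [add_assoc, ← Finset.sum_erase_add _ _ (Finset.mem_univ i),
        ← Finset.sum_erase_add _ (fun j => Function.update s i t j • u j) (Finset.mem_univ i)]
      simp only [Function.update_self, hsi, zero_smul, add_zero]
      congr 2
      refine Finset.sum_congr rfl fun j hj => ?_
      rw [Function.update_of_ne (Finset.ne_of_mem_erase hj)]

/-- A function on the orthant which is affine in each variable is a multi-affine polynomial. -/
theorem exists_multiaffine_of_affine [DecidableEq ι] (A : Finset ι) :
    ∀ G : (ι → ℝ) → ℝ, (∀ (x : ι → ℝ), 0 ≤ x → ∀ i, ∃ c₀ c₁ : ℝ, ∀ a, 0 ≤ a →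
      G (Function.update x i a) = c₀ + a * c₁) →
    ∃ c : Finset ι → ℝ, ∀ x : ι → ℝ, 0 ≤ x → (∀ i ∉ A, x i = 0) →
      G x = ∑ T ∈ A.powerset, c T * ∏ i ∈ T, x i := by
  induction A using Finset.induction_on with
  | empty =>
    intro G _
    refine ⟨fun _ => G 0, fun x _ hx => ?_⟩
    have : x = 0 := funext fun i => hx i (by simp)
    simp [this]
  | insert j A hj ih =>
    intro G hG
    obtain ⟨c, hc⟩ := ih G hG
    have upd : ∀ (x : ι → ℝ) (i : ι) (a : ℝ), 0 ≤ x → 0 ≤ a → 0 ≤ Function.update x i a := by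
      intro x i a hx ha k
      by_cases h : k = i
      · subst h; simpa using ha
      · simpa [h] using hx k
    obtain ⟨d, hd⟩ := ih (fun y => G (Function.update y j 1)) (fun x hx i => by
      by_cases h : i = j
      · subst h
        exact ⟨G (Function.update x i 1), 0, fun a _ => by simp⟩
      · obtain ⟨c₀, c₁, h'⟩ := hG (Function.update x j 1) (upd x j 1 hx zero_le_one) i
        exact ⟨c₀, c₁, fun a ha => by rw [Function.update_comm h, h' a ha]⟩)
    refine ⟨fun T => if j ∈ T then d (T.erase j) - c (T.erase j) else c T, fun x hx hxA => ?_⟩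
    obtain ⟨c₀, c₁, h'⟩ := hG x hx j
    have h0 := h' 0 le_rfl
    have h1 := h' 1 zero_le_one
    have hxj := h' (x j) (hx j)
    rw [Function.update_eq_self] at hxj
    have e0 := hc (Function.update x j 0) (upd x j 0 hx le_rfl) (fun i hi => by
      by_cases h : i = j
      · subst h; simp
      · simpa [h] using hxA i (by simp [h, hi]))
    have e1 := hd (Function.update x j 0) (upd x j 0 hx le_rfl) (fun i hi => by
      by_cases h : i = j
      · subst h; simp
      · simpa [h] using hxA i (by simp [h, hi]))
    simp only [Function.update_idem] at e1
    have pr : ∀ T ∈ A.powerset, ∏ i ∈ T, Function.update x j 0 i = ∏ i ∈ T, x i := by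
      intro T hT
      refine Finset.prod_congr rfl fun i hi => ?_
      rw [Function.update_of_ne]
      rintro rfl
      exact hj (Finset.mem_powerset.1 hT hi)
    rw [Finset.sum_congr rfl fun T hT => by rw [pr T hT]] at e0 e1
    rw [Finset.sum_powerset_insert hj]
    have s1 : ∑ T ∈ A.powerset, (if j ∈ T then d (T.erase j) - c (T.erase j) else c T) *
        ∏ i ∈ T, x i = ∑ T ∈ A.powerset, c T * ∏ i ∈ T, x i :=
      Finset.sum_congr rfl fun T hT => by
        rw [if_neg fun h => hj (Finset.mem_powerset.1 hT h)]
    have s2 : ∑ T ∈ A.powerset, (if j ∈ insert j T then d ((insert j T).erase j) -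
        c ((insert j T).erase j) else c (insert j T)) * ∏ i ∈ insert j T, x i =
        x j * (∑ T ∈ A.powerset, d T * ∏ i ∈ T, x i - ∑ T ∈ A.powerset, c T * ∏ i ∈ T, x i) := by
      rw [← Finset.sum_sub_distrib, Finset.mul_sum]
      refine Finset.sum_congr rfl fun T hT => ?_
      have hjT : j ∉ T := fun h => hj (Finset.mem_powerset.1 hT h)
      rw [if_pos (Finset.mem_insert_self _ _), Finset.erase_insert hjT, Finset.prod_insert hjT]
      ring
    rw [s1, s2, ← e0, ← e1, hxj, h0, h1]
    ring

theorem exists_volume_zonotopeBody_eq [DecidableEq ι] {M : Set (EuclideanSpace ℝ (Fin n))}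
    (hM : IsCompact M) (hMc : Convex ℝ M) (u : ι → EuclideanSpace ℝ (Fin n)) :
    ∃ c : Finset ι → ℝ, ∀ x : ι → ℝ, 0 ≤ x →
      (volume (zonotopeBody M u x)).toReal = ∑ T, c T * ∏ i ∈ T, x i := by
  obtain ⟨c, hc⟩ := exists_multiaffine_of_affine (ι := ι) Finset.univ
    (fun x => (volume (zonotopeBody M u x)).toReal) (fun x _ i => by
      obtain ⟨c₀, c₁, h⟩ := exists_volume_add_segment_eq
        (hM.zonotopeBody u (Function.update x i 0)) (hMc.zonotopeBody u _) (u i)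
      exact ⟨c₀, c₁, fun a ha => by rw [zonotopeBody_update, h a ha]⟩)
  refine ⟨c, fun x hx => ?_⟩
  have := hc x hx (fun i hi => absurd (Finset.mem_univ i) hi)
  simpa using this

end Zonotope

section ZonotopeCoeff
variable {ι : Type*} [Fintype ι] [DecidableEq ι] {n : ℕ}

theorem prod_ite_mem_eq {T S : Finset ι} (a : ℝ) :
    ∏ i ∈ S, (if i ∈ T then a else 0) = if S ⊆ T then a ^ S.card else 0 := by
  split_ifs with h
  · rw [Finset.prod_congr rfl fun i hi => if_pos (h hi), Finset.prod_const]
  · obtain ⟨i, hi, hiT⟩ := Finset.not_subset.1 h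
    exact Finset.prod_eq_zero hi (if_neg hiT)

open Filter Topology in
theorem tendsto_multiaffine_div (c : Finset ι → ℝ) (T : Finset ι) :
    Tendsto (fun a : ℝ => (∑ S, c S * ∏ i ∈ S, (if i ∈ T then a else 0)) / a ^ T.card) atTop
      (𝓝 (c T)) := by
  simp only [prod_ite_mem_eq, Finset.sum_div]
  have : c T = ∑ S, if S = T then c T else 0 := by simp
  rw [this]
  refine tendsto_finsetSum _ fun S _ => ?_
  split_ifs with h1 h2 h2
  · subst h2
    refine tendsto_const_nhds.congr' ?_
    filter_upwards [eventually_gt_atTop 0] with a ha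
    field_simp
  · have hlt : S.card < T.card := Finset.card_lt_card (lt_of_le_of_ne h1 h2)
    obtain ⟨k, hk⟩ := Nat.exists_eq_add_of_lt hlt
    have : Tendsto (fun a : ℝ => c S * (a ^ (k + 1))⁻¹) atTop (𝓝 (c S * 0)) :=
      (tendsto_inv_atTop_zero.comp (tendsto_pow_atTop (by omega))).const_mul _
    rw [mul_zero] at this
    refine this.congr' ?_
    filter_upwards [eventually_gt_atTop 0] with a ha
    rw [hk]
    field_simp
    ring
  · subst h2; simp at h1
  · simp

theorem interior_zonotopeBody_nonempty {u : ι → EuclideanSpace ℝ (Fin n)} {T : Finset ι}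
    (hT : T.card = n) (hu : LinearIndependent ℝ fun i : T => u i) :
    (interior (zonotopeBody {0} u fun i => if i ∈ T then 1 else 0)).Nonempty := by
  have hcard : Fintype.card T = Module.finrank ℝ (EuclideanSpace ℝ (Fin n)) := by simp [hT]
  by_cases hn : Nonempty T
  · set b := basisOfLinearIndependentOfCardEqFinrank hu hcard with hb
    refine b.parallelepiped.interior_nonempty.mono (interior_mono ?_)
    rintro _ ⟨t, ht, rfl⟩
    refine ⟨0, rfl, fun i => if h : i ∈ T then t ⟨i, h⟩ else 0, fun i => ?_, ?_⟩
    · by_cases h : i ∈ T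
      · simp only [h, dif_pos, if_true]
        rw [abs_of_nonneg (ht.1 _)]; exact ht.2 _
      · simp [h]
    · rw [zero_add]
      have : ∑ i, (if h : i ∈ T then t ⟨i, h⟩ else 0) • u i =
          ∑ i ∈ T, (if h : i ∈ T then t ⟨i, h⟩ else 0) • u i := by
        symm
        refine Finset.sum_subset (Finset.subset_univ _) fun i _ h => by simp [h]
      rw [this, ← Finset.sum_attach]
      simp [hb]
  · have : n = 0 := by
      have := Fintype.card_eq_zero_iff.2 (not_nonempty_iff.1 hn)
      simp at this; rw [← hT, this]; simp
    subst this
    refine ⟨0, ?_⟩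
    have : (zonotopeBody {0} u fun i => if i ∈ T then (1 : ℝ) else 0) = Set.univ := by
      ext z
      simp only [Set.mem_univ, iff_true]
      exact ⟨0, rfl, 0, fun i => by simp; split_ifs <;> norm_num, Subsingleton.elim _ _⟩
    rw [this]; simp

theorem volume_smul_toReal (s : Set (EuclideanSpace ℝ (Fin n))) {a : ℝ} (ha : 0 ≤ a) :
    (volume (a • s)).toReal = a ^ n * (volume s).toReal := by
  rw [Measure.addHaar_smul]
  simp [abs_of_nonneg ha, ha]

theorem ite_smul_one_eq (T : Finset ι) (a : ℝ) :
    (fun i => if i ∈ T then a else 0) = a • fun i => if i ∈ T then (1 : ℝ) else 0 := by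
  ext i; simp

section
variable {M : Set (EuclideanSpace ℝ (Fin n))} {u : ι → EuclideanSpace ℝ (Fin n)}
  {c : Finset ι → ℝ}

open Filter Topology in
theorem zonotope_coeff_nonneg
    (hc : ∀ x : ι → ℝ, 0 ≤ x →
      (volume (zonotopeBody M u x)).toReal = ∑ T, c T * ∏ i ∈ T, x i) (T : Finset ι) :
    0 ≤ c T := by
  refine ge_of_tendsto (tendsto_multiaffine_div c T) ?_
  filter_upwards [eventually_gt_atTop 0] with a ha
  rw [← hc _ (fun i => by simp only [Pi.zero_apply]; split_ifs <;> positivity)]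
  positivity

open Filter Topology in
theorem zonotope_coeff_eq_zero (hM : IsCompact M)
    (hc : ∀ x : ι → ℝ, 0 ≤ x →
      (volume (zonotopeBody M u x)).toReal = ∑ T, c T * ∏ i ∈ T, x i) {T : Finset ι}
    (hT : n < T.card) : c T = 0 := by
  refine le_antisymm ?_ (zonotope_coeff_nonneg hc T)
  obtain ⟨R, hR0, hR⟩ := hM.isBounded.subset_closedBall_lt 0 0
  set V := zonotopeBody (closedBall (0 : EuclideanSpace ℝ (Fin n)) R) u
    fun i => if i ∈ T then 1 else 0
  have hV : IsCompact V := (isCompact_closedBall _ _).zonotopeBody _ _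
  have lim : Tendsto (fun a : ℝ => (volume V).toReal * a⁻¹) atTop (𝓝 ((volume V).toReal * 0)) :=
    tendsto_inv_atTop_zero.const_mul _
  rw [mul_zero] at lim
  refine le_of_tendsto_of_tendsto (tendsto_multiaffine_div c T) lim ?_
  filter_upwards [eventually_ge_atTop 1] with a ha
  have ha0 : 0 < a := by linarith
  rw [← hc _ (fun i => by simp only [Pi.zero_apply]; split_ifs <;> positivity)]
  have h1 : (volume (zonotopeBody M u fun i => if i ∈ T then a else 0)).toReal ≤
      a ^ n * (volume V).toReal := by
    rw [← volume_smul_toReal _ ha0.le, smul_zonotopeBody _ _ ha0, ← ite_smul_one_eq]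
    refine ENNReal.toReal_mono ?_ (measure_mono (zonotopeBody_mono ?_ _ le_rfl))
    · exact (((isCompact_closedBall _ _).smul a).zonotopeBody _ _).measure_ne_top
    · rw [smul_closedBall _ _ hR0.le, smul_zero, Real.norm_of_nonneg ha0.le]
      exact hR.trans (closedBall_subset_closedBall (by nlinarith))
  rw [div_le_iff₀ (by positivity)]
  refine h1.trans ?_
  rw [mul_comm (a ^ n), mul_assoc]
  gcongr
  rw [inv_mul_eq_div, le_div_iff₀ ha0, ← pow_succ]
  exact pow_le_pow_right₀ ha hT

open Filter Topology in
theorem zonotope_coeff_pos_of_card_eq (hM : IsCompact M) (hMn : M.Nonempty)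
    (hc : ∀ x : ι → ℝ, 0 ≤ x →
      (volume (zonotopeBody M u x)).toReal = ∑ T, c T * ∏ i ∈ T, x i) {T : Finset ι}
    (hT : T.card = n) (hu : LinearIndependent ℝ fun i : T => u i) : 0 < c T := by
  obtain ⟨p, hp⟩ := hMn
  set V := zonotopeBody {(0 : EuclideanSpace ℝ (Fin n))} u fun i => if i ∈ T then 1 else 0 with hV
  have hVc : IsCompact V := isCompact_singleton.zonotopeBody _ _
  have hVpos : 0 < (volume V).toReal := ENNReal.toReal_pos
    (Measure.measure_pos_of_nonempty_interior _ (interior_zonotopeBody_nonempty hT hu)).ne'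
    hVc.measure_ne_top
  refine hVpos.trans_le (ge_of_tendsto (tendsto_multiaffine_div c T) ?_)
  filter_upwards [eventually_gt_atTop 0] with a ha
  rw [← hc _ (fun i => by simp only [Pi.zero_apply]; split_ifs <;> positivity),
    le_div_iff₀ (by positivity), hT, mul_comm, ← volume_smul_toReal _ ha.le, hV,
    smul_zonotopeBody _ _ ha, ← ite_smul_one_eq, Set.smul_set_singleton, smul_zero,
    ← measure_preimage_add_right _ (-p)]
  refine ENNReal.toReal_mono (hM.zonotopeBody _ _).measure_ne_top (measure_mono ?_)
  rintro z ⟨q, hq, s, hs, hz⟩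
  refine ⟨p, hp, s, hs, ?_⟩
  rw [Set.mem_singleton_iff.1 hq, zero_add] at hz
  rw [← hz]; simp

open Filter Topology in
theorem zonotope_coeff_pos (hM : IsCompact M) (hMi : (interior M).Nonempty)
    (hc : ∀ x : ι → ℝ, 0 ≤ x →
      (volume (zonotopeBody M u x)).toReal = ∑ T, c T * ∏ i ∈ T, x i)
    (hu : ∀ T : Finset ι, T.card = n → LinearIndependent ℝ fun i : T => u i)
    (hn : n ≤ Fintype.card ι) {T : Finset ι} (hT : T.card ≤ n) : 0 < c T := by
  obtain ⟨T', hTT', hT'⟩ := Finset.exists_superset_card_eq hT hn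
  obtain ⟨p, hp⟩ := hMi
  obtain ⟨r, hr, hball⟩ := Metric.isOpen_iff.1 isOpen_interior p hp
  obtain ⟨d, hd⟩ := exists_volume_zonotopeBody_eq
    (isCompact_singleton (x := (0 : EuclideanSpace ℝ (Fin n)))) (convex_singleton _) u
  have dpos := zonotope_coeff_pos_of_card_eq isCompact_singleton (Set.singleton_nonempty _) hd
    hT' (hu T' hT')
  set D := 1 + ∑ i, ‖u i‖ with hD
  have hDpos : 0 < D := by positivity
  set δ := r / (2 * D) with hδ
  have hδ0 : 0 < δ := by positivity
  refine lt_of_lt_of_le (b := d T' * δ ^ (n - T.card)) (by positivity)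
    (ge_of_tendsto (tendsto_multiaffine_div c T) ?_)
  filter_upwards [eventually_gt_atTop 0] with a ha
  rw [← hc _ (fun i => by simp only [Pi.zero_apply]; split_ifs <;> positivity),
    le_div_iff₀ (by positivity)]
  set y : ι → ℝ := fun i => if i ∈ T then a else if i ∈ T' then δ else 0 with hy
  have hy0 : 0 ≤ y := fun i => by
    simp only [hy, Pi.zero_apply]; split_ifs <;> positivity
  have h1 : d T' * δ ^ (n - T.card) * a ^ T.card ≤
      (volume (zonotopeBody {(0 : EuclideanSpace ℝ (Fin n))} u y)).toReal := by
    rw [hd y hy0]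
    have : d T' * δ ^ (n - T.card) * a ^ T.card = d T' * ∏ i ∈ T', y i := by
      rw [← Finset.prod_sdiff hTT',
        Finset.prod_congr rfl (g := fun _ => δ) fun i hi => by
          simp [hy, Finset.mem_sdiff.1 hi],
        Finset.prod_congr (s₁ := T) rfl (g := fun _ => a) fun i hi => by simp [hy, hi],
        Finset.prod_const, Finset.prod_const, Finset.card_sdiff_of_subset hTT', hT']
      ring
    rw [this]
    refine Finset.single_le_sum (f := fun S => d S * ∏ i ∈ S, y i) (fun S _ => ?_)
      (Finset.mem_univ T')
    exact mul_nonneg (zonotope_coeff_nonneg hd S) (Finset.prod_nonneg fun i _ => hy0 i)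
  refine h1.trans ?_
  rw [← measure_preimage_add_right volume (-p)]
  refine ENNReal.toReal_mono (hM.zonotopeBody _ _).measure_ne_top (measure_mono ?_)
  rintro z ⟨q, hq, s, hs, hz⟩
  rw [Set.mem_singleton_iff.1 hq, zero_add] at hz
  refine ⟨p + ∑ i, (if i ∈ T then 0 else s i) • u i, interior_subset (hball ?_),
    fun i => if i ∈ T then s i else 0, fun i => ?_, ?_⟩
  · rw [mem_ball, dist_eq_norm, add_sub_cancel_left]
    calc ‖∑ i, (if i ∈ T then 0 else s i) • u i‖ ≤ ∑ i, δ * ‖u i‖ := by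
          refine norm_sum_le_of_le _ fun i _ => ?_
          rw [norm_smul]
          gcongr
          have := hs i
          simp only [hy] at this
          split_ifs at this ⊢ <;> simp <;> linarith
      _ = δ * ∑ i, ‖u i‖ := by rw [Finset.mul_sum]
      _ ≤ δ * D := by gcongr; simp [hD]
      _ < r := by rw [hδ]; field_simp; linarith
  · have := hs i
    simp only [hy] at this
    by_cases h : i ∈ T
    · simpa [h] using this
    · simp [h]
  · have : z = p + ∑ i, s i • u i := by rw [← hz]; simp
    rw [this, add_assoc, ← Finset.sum_add_distrib]
    congr 1
    refine Finset.sum_congr rfl fun i _ => ?_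
    by_cases h : i ∈ T <;> simp [h]

end
end ZonotopeCoeff

/-- A bilinear form with at most one positive direction. -/
def IsLorentzian {V : Type*} [AddCommGroup V] [Module ℝ V] (b : V →ₗ[ℝ] V →ₗ[ℝ] ℝ) : Prop :=
  ∃ l : V →ₗ[ℝ] ℝ, ∀ f, l f = 0 → b f f ≤ 0

theorem IsLorentzian.apply_self_nonpos {V : Type*} [AddCommGroup V] [Module ℝ V]
    {b : V →ₗ[ℝ] V →ₗ[ℝ] ℝ} (hb : IsLorentzian b) (symm : ∀ f g, b f g = b g f) {f g h : V}
    (hg : 0 ≤ b g g) (hh : b g h ≠ 0) (hf : b f g = 0) : b f f ≤ 0 := by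
  obtain ⟨l, hl⟩ := hb
  by_cases hlg : l g = 0
  · have hgg : b g g = 0 := le_antisymm (hl g hlg) hg
    have ker : ∀ k, l k = 0 → b g k = 0 := by
      intro k hk
      by_contra hne
      have key : ∀ t : ℝ, 2 * t * b g k + b k k ≤ 0 := by
        intro t
        have := hl (t • g + k) (by simp [hlg, hk])
        simp only [map_add, map_smul, LinearMap.add_apply, LinearMap.smul_apply, smul_eq_mul,
          hgg, symm k g] at this
        linarith
      have := key ((1 - b k k) / (2 * b g k))
      have e : 2 * ((1 - b k k) / (2 * b g k)) * b g k = 1 - b k k := by field_simp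
      rw [e] at this
      linarith
    have hlh : l h ≠ 0 := fun h0 => hh (ker h h0)
    have h1 := ker (f - (l f / l h) • h) (by
      simp only [map_sub, map_smul, smul_eq_mul]; field_simp; ring)
    simp only [map_sub, map_smul, smul_eq_mul, symm g f, hf] at h1
    have : l f / l h = 0 := by
      by_contra hne
      exact mul_ne_zero hne hh (by linarith)
    exact hl f (by simpa [hlh] using this)
  · have := hl (f - (l f / l g) • g) (by
      simp only [map_sub, map_smul, smul_eq_mul]; field_simp; ring)
    simp only [map_sub, map_smul, LinearMap.sub_apply, LinearMap.smul_apply, smul_eq_mul,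
      symm g f, hf] at this
    have h2 : 0 ≤ (l f / l g) * ((l f / l g) * b g g) := by
      rw [← mul_assoc]; exact mul_nonneg (mul_self_nonneg _) hg
    linarith

section SquareZero
variable {ι R : Type*} [Fintype ι] [DecidableEq ι] [CommRing R] [Algebra ℝ R]

theorem add_pow_of_sq_eq_zero (s a : R) (ha : a * a = 0) (m : ℕ) :
    (s + a) ^ m = s ^ m + m * a * s ^ (m - 1) := by
  induction m with
  | zero => simp
  | succ m ih =>
    rw [pow_succ, ih]
    rcases m with _ | m
    · simp
    · simp only [Nat.add_sub_cancel]
      push_cast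
      linear_combination (m + 1) * s ^ m * ha

theorem add_sum_pow_of_sq_eq_zero (s : R) (y : ι → R) (hy : ∀ i, y i * y i = 0) (A : Finset ι) :
    ∀ m : ℕ, (s + ∑ i ∈ A, y i) ^ m =
      ∑ T ∈ A.powerset, (m.descFactorial T.card : R) * s ^ (m - T.card) * ∏ i ∈ T, y i := by
  induction A using Finset.induction_on with
  | empty => intro m; simp
  | insert j A hj ih =>
    intro m
    rw [Finset.sum_insert hj, add_comm (y j), ← add_assoc, add_pow_of_sq_eq_zero _ _ (hy j), ih, ih,
      Finset.sum_powerset_insert hj, Finset.mul_sum]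
    congr 1
    refine Finset.sum_congr rfl fun T hT => ?_
    have hjT : j ∉ T := fun h => hj (Finset.mem_powerset.1 hT h)
    rw [Finset.card_insert_of_notMem hjT, Finset.prod_insert hjT]
    rcases m with _ | m
    · simp
    · rw [Nat.succ_descFactorial_succ, Nat.add_sub_add_right, Nat.add_sub_add_right, Nat.sub_zero]
      push_cast
      ring

/-- The linear element `w₀ + ∑ wᵢ Xᵢ`. -/
def linElem (X : ι → R) : ℝ × (ι → ℝ) →ₗ[ℝ] R where
  toFun w := w.1 • 1 + ∑ i, w.2 i • X i
  map_add' v w := by simp [add_smul, Finset.sum_add_distrib]; abel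
  map_smul' a w := by simp [mul_smul, Finset.smul_sum]

theorem linElem_apply (X : ι → R) (w : ℝ × (ι → ℝ)) :
    linElem X w = w.1 • 1 + ∑ i, w.2 i • X i := rfl

/-- The bilinear form `(f, g) ↦ Λ (p f g)` on linear elements. -/
def linForm (X : ι → R) (L : R →ₗ[ℝ] ℝ) (p : R) :
    (ℝ × (ι → ℝ)) →ₗ[ℝ] (ℝ × (ι → ℝ)) →ₗ[ℝ] ℝ :=
  LinearMap.mk₂ ℝ (fun f g => L (p * linElem X f * linElem X g))
    (fun f f' g => by simp only [map_add, mul_add, add_mul])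
    (fun a f g => by simp only [map_smul, mul_smul_comm, smul_mul_assoc])
    (fun f g g' => by simp only [map_add, mul_add])
    (fun a f g => by simp only [map_smul, mul_smul_comm])

theorem linForm_apply (X : ι → R) (L : R →ₗ[ℝ] ℝ) (p : R) (f g : ℝ × (ι → ℝ)) :
    linForm X L p f g = L (p * linElem X f * linElem X g) := rfl

theorem linForm_symm (X : ι → R) (L : R →ₗ[ℝ] ℝ) (p : R) (f g : ℝ × (ι → ℝ)) :
    linForm X L p f g = linForm X L p g f := by
  rw [linForm_apply, linForm_apply, mul_right_comm]

theorem IsLorentzian.linForm_add {X : ι → R} {L : R →ₗ[ℝ] ℝ} {q : R} {f g h : ℝ × (ι → ℝ)}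
    (h1 : IsLorentzian (linForm X L (q * linElem X f)))
    (h2 : IsLorentzian (linForm X L (q * linElem X g)))
    (hg : 0 ≤ L (q * linElem X f * linElem X g * linElem X g))
    (hf : 0 ≤ L (q * linElem X g * linElem X f * linElem X f))
    (hne : L (q * linElem X f * linElem X g * linElem X h) ≠ 0) :
    IsLorentzian (linForm X L (q * linElem X (f + g))) := by
  refine ⟨linForm X L (q * linElem X f) g, fun k hk => ?_⟩
  have e : linForm X L (q * linElem X g) f = linForm X L (q * linElem X f) g := by
    ext1 <;> ext <;> simp only [LinearMap.comp_apply, linForm_apply] <;> rw [mul_right_comm q]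
  have a1 := h1.apply_self_nonpos (linForm_symm X L _) (f := k) (g := g) (h := h) hg hne
    (by rw [linForm_symm]; exact hk)
  have a2 := h2.apply_self_nonpos (linForm_symm X L _) (f := k) (g := f) (h := h) hf
    (by rw [e]; exact hne) (by rw [linForm_symm, e]; exact hk)
  rw [linForm_apply] at *
  rw [map_add, mul_add, add_mul, add_mul, map_add]
  linarith

end SquareZero

open Filter Topology in
theorem Polynomial.coeff_two_nonpos {D : Polynomial ℝ} (h0 : D.coeff 0 = 0) (h1 : D.coeff 1 = 0)
    {δ : ℝ} (hδ : 0 < δ) (hD : ∀ s, 0 < s → s < δ → D.eval s ≤ 0) : D.coeff 2 ≤ 0 := by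
  have e1 : D = D.divX.divX * Polynomial.X ^ 2 := by
    have a := Polynomial.divX_mul_X_add D
    have b := Polynomial.divX_mul_X_add D.divX
    rw [h0, Polynomial.C_0, add_zero] at a
    rw [Polynomial.coeff_divX, h1, Polynomial.C_0, add_zero] at b
    rw [pow_two, ← mul_assoc, b, a]
  have e2 : D.coeff 2 = D.divX.divX.eval 0 := by
    rw [← Polynomial.coeff_zero_eq_eval_zero, Polynomial.coeff_divX, Polynomial.coeff_divX]
  rw [e2]
  have c : Tendsto (fun s => D.divX.divX.eval s) (𝓝[>] 0) (𝓝 (D.divX.divX.eval 0)) :=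
    (D.divX.divX.continuous.tendsto 0).mono_left nhdsWithin_le_nhds
  refine le_of_tendsto c ?_
  filter_upwards [Ioo_mem_nhdsGT hδ] with s hs
  have := hD s hs.1 hs.2
  rw [e1, Polynomial.eval_mul, Polynomial.eval_pow, Polynomial.eval_X] at this
  have := hs.1
  by_contra! hcon
  nlinarith [mul_pos hcon (pow_pos hs.1 2)]

section SquareZero
variable {ι R : Type*} [Fintype ι] [DecidableEq ι] [CommRing R] [Algebra ℝ R]
  {X : ι → R} {L : R →ₗ[ℝ] ℝ} {n : ℕ}

theorem map_natCast_mul_real (L : R →ₗ[ℝ] ℝ) (k : ℕ) (r : R) : L (k * r) = k * L r := by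
  rw [← nsmul_eq_mul, map_nsmul, nsmul_eq_mul]

theorem prod_mul_of_sq_eq_zero (hX : ∀ i, X i * X i = 0) (S : Finset ι) (i : ι) :
    (∏ j ∈ S, X j) * X i = if i ∈ S then 0 else ∏ j ∈ insert i S, X j := by
  split_ifs with h
  · rw [← Finset.mul_prod_erase S X h, mul_right_comm, hX, zero_mul]
  · rw [Finset.prod_insert h, mul_comm]

theorem pow_sum_mul_prod_recurrence (hX : ∀ i, X i * X i = 0) (S : Finset ι) (b : ℕ) :
    L ((∑ i, X i) ^ (b + 1) * ∏ j ∈ S, X j) =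
      ∑ i, if i ∈ S then 0 else L ((∑ i, X i) ^ b * ∏ j ∈ insert i S, X j) := by
  rw [pow_succ, mul_assoc, mul_comm (∑ i, X i) (∏ j ∈ S, X j), Finset.mul_sum, Finset.mul_sum,
    map_sum]
  refine Finset.sum_congr rfl fun i _ => ?_
  rw [prod_mul_of_sq_eq_zero hX]
  split_ifs <;> simp

theorem pow_sum_mul_prod_nonneg (hX : ∀ i, X i * X i = 0)
    (hL : ∀ S : Finset ι, 0 ≤ L (∏ j ∈ S, X j)) (b : ℕ) :
    ∀ S : Finset ι, 0 ≤ L ((∑ i, X i) ^ b * ∏ j ∈ S, X j) := by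
  induction b with
  | zero => intro S; simpa using hL S
  | succ b ih =>
    intro S
    rw [pow_sum_mul_prod_recurrence hX]
    refine Finset.sum_nonneg fun i _ => ?_
    split_ifs
    exacts [le_rfl, ih _]

theorem pow_sum_mul_prod_pos (hX : ∀ i, X i * X i = 0)
    (hL : ∀ S : Finset ι, 0 ≤ L (∏ j ∈ S, X j)) (hn : n ≤ Fintype.card ι)
    (hLpos : ∀ S : Finset ι, S.card ≤ n → 0 < L (∏ j ∈ S, X j)) (b : ℕ) :
    ∀ S : Finset ι, S.card + b ≤ n → 0 < L ((∑ i, X i) ^ b * ∏ j ∈ S, X j) := by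
  induction b with
  | zero => intro S hS; simpa using hLpos S (by simpa using hS)
  | succ b ih =>
    intro S hS
    rw [pow_sum_mul_prod_recurrence hX]
    refine Finset.sum_pos' (fun i _ => ?_) ?_
    · split_ifs
      exacts [le_rfl, pow_sum_mul_prod_nonneg hX hL b _]
    · obtain ⟨i, hi⟩ : ∃ i, i ∉ S := by
        by_contra! hcon
        have : S = Finset.univ := Finset.eq_univ_of_forall hcon
        rw [this, Finset.card_univ] at hS
        omega
      refine ⟨i, Finset.mem_univ i, ?_⟩
      rw [if_neg hi]
      exact ih _ (by rw [Finset.card_insert_of_notMem hi]; omega)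

/-- Midpoint log-concavity of `w ↦ Λ (p (lin w) ^ m)` on the positive orthant. -/
def LogConcaveForm (X : ι → R) (L : R →ₗ[ℝ] ℝ) (p : R) (m : ℕ) : Prop :=
  ∀ w w' : ℝ × (ι → ℝ), 0 < w.1 → 0 < w'.1 → 0 ≤ w.2 → 0 ≤ w'.2 →
    L (p * linElem X w ^ m) * L (p * linElem X w' ^ m) ≤
      L (p * linElem X ((1 / 2 : ℝ) • (w + w')) ^ m) ^ 2

open Filter Topology in
theorem LogConcaveForm.prod_mul (hX : ∀ i, X i * X i = 0) (h : LogConcaveForm X L 1 n)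
    {S : Finset ι} (hS : S.card ≤ n) : LogConcaveForm X L (∏ i ∈ S, X i) (n - S.card) := by
  intro w w' hw hw' hw2 hw2'
  set e : ℝ → ℝ × (ι → ℝ) := fun a => (0, fun i => if i ∈ S then a else 0) with he
  have key : ∀ w : ℝ × (ι → ℝ), Tendsto (fun a => L (1 * linElem X (w + e a) ^ n) / a ^ S.card)
      atTop (𝓝 (n.descFactorial S.card * L ((∏ i ∈ S, X i) * linElem X w ^ (n - S.card)))) := by
    intro w
    have := tendsto_multiaffine_div (fun T : Finset ι =>
      n.descFactorial T.card * L ((∏ i ∈ T, X i) * linElem X w ^ (n - T.card))) S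
    refine this.congr fun a => ?_
    congr 1
    have h1 : linElem X (w + e a) = linElem X w + ∑ i, (if i ∈ S then a else 0) • X i := by
      rw [map_add, linElem_apply X (e a)]; simp [he]
    rw [one_mul, h1, add_sum_pow_of_sq_eq_zero _ _ (fun i => by
      rw [smul_mul_smul_comm, hX, smul_zero]), map_sum, Finset.powerset_univ]
    refine Finset.sum_congr rfl fun T _ => ?_
    have h2 : ∏ i ∈ T, (if i ∈ S then a else 0) • X i =
        (∏ i ∈ T, if i ∈ S then a else 0) • ∏ i ∈ T, X i := by
      rw [Finset.prod_smul]
    rw [h2, mul_smul_comm, map_smul, mul_assoc (_ : R), map_natCast_mul_real,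
      mul_comm (linElem X w ^ _), smul_eq_mul]
    ring
  have hmid : ∀ a, (1 / 2 : ℝ) • ((w + e a) + (w' + e a)) = (1 / 2 : ℝ) • (w + w') + e a := by
    intro a; module
  have hle := le_of_tendsto_of_tendsto ((key w).mul (key w'))
    ((key ((1 / 2 : ℝ) • (w + w'))).pow 2) (by
      filter_upwards [eventually_gt_atTop 0] with a ha
      have he0 : 0 ≤ (e a).2 := fun i => by
        simp only [he, Pi.zero_apply]; split_ifs <;> linarith
      have := h (w + e a) (w' + e a) (by simpa [he] using hw) (by simpa [he] using hw')
        (add_nonneg hw2 he0) (add_nonneg hw2' he0)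
      rw [hmid] at this
      rw [div_mul_div_comm, div_pow, ← pow_two]
      gcongr)
  have hpos : (0 : ℝ) < n.descFactorial S.card := by
    exact_mod_cast Nat.descFactorial_pos.2 hS
  rw [mul_mul_mul_comm, mul_pow, ← pow_two] at hle
  exact le_of_mul_le_mul_left hle (by positivity)

theorem LogConcaveForm.isLorentzian {p : R} {m : ℕ} (h : LogConcaveForm X L p m) (hm : 2 ≤ m)
    (hp : 0 < L p) : IsLorentzian (linForm X L p) := by
  refine ⟨linForm X L p (1, 0), fun f hf => ?_⟩
  have h10 : linElem X ((1, 0) : ℝ × (ι → ℝ)) = 1 := by simp [linElem_apply]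
  rw [linForm_apply, h10, mul_one] at hf
  rw [linForm_apply]
  set Q : R → Polynomial ℝ := fun y => ∑ j ∈ Finset.range (m + 1),
    Polynomial.monomial j (m.choose j * L (p * y ^ j)) with hQ
  have Qeval : ∀ y (s : ℝ), (Q y).eval s = L (p * (1 + s • y) ^ m) := by
    intro y s
    rw [add_comm, add_pow, Finset.mul_sum, map_sum, Polynomial.eval_finsetSum]
    refine Finset.sum_congr rfl fun j _ => ?_
    rw [Polynomial.eval_monomial, one_pow, mul_one, smul_pow, mul_comm (_ • _) (_ : R),
      mul_left_comm, map_natCast_mul_real, mul_smul_comm, map_smul, smul_eq_mul]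
    ring
  have Qcoeff : ∀ y j, (Q y).coeff j = m.choose j * L (p * y ^ j) := by
    intro y j
    simp only [hQ, Polynomial.finsetSum_coeff, Polynomial.coeff_monomial]
    rw [Finset.sum_ite_eq']
    split_ifs with hj
    · rfl
    · rw [Nat.choose_eq_zero_of_lt (by simpa using hj)]; simp
  set g : ℝ × (ι → ℝ) := (0, fun _ => ∑ i, |f.2 i|) with hg
  have hfi : ∀ i, |f.2 i| ≤ ∑ i, |f.2 i| := fun i =>
    Finset.single_le_sum (f := fun i => |f.2 i|) (fun i _ => abs_nonneg _) (Finset.mem_univ i)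
  have pos : ∀ (s : ℝ) (k : ℝ × (ι → ℝ)), 0 < s → s < 1 / (1 + |f.1|) → (k = f ∨ k = -f) →
      0 < ((1, 0) + s • (g + k)).1 ∧ 0 ≤ ((1, 0) + s • (g + k)).2 := by
    intro s k hs hs1 hk
    rw [lt_div_iff₀ (by positivity)] at hs1
    constructor
    · rcases hk with hk | hk <;> rw [hk] <;> simp [hg] <;>
        nlinarith [le_abs_self f.1, neg_abs_le f.1, abs_nonneg f.1]
    · intro i
      have a1 := hfi i
      have a2 := le_abs_self (f.2 i)
      have a3 := neg_abs_le (f.2 i)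
      have e : ((1, 0) + s • (g + k) : ℝ × (ι → ℝ)).2 i = s * (∑ i, |f.2 i| + k.2 i) := by
        simp [hg, mul_add]
      rw [e]
      refine mul_nonneg hs.le ?_
      rcases hk with hk | hk <;> rw [hk]
      · linarith
      · rw [Prod.snd_neg, Pi.neg_apply]; linarith
  have lin1 : ∀ (s : ℝ) (k : ℝ × (ι → ℝ)), linElem X ((1, 0) + s • k) = 1 + s • linElem X k := by
    intro s k; rw [map_add, map_smul, h10]
  set y1 := linElem X (g + f) with hy1
  set y2 := linElem X (g - f) with hy2
  set y0 := linElem X g with hy0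
  have hD := Polynomial.coeff_two_nonpos (D := Q y1 * Q y2 - Q y0 * Q y0)
    (δ := 1 / (1 + |f.1|)) ?_ ?_ (by positivity) ?_
  · simp only [Polynomial.coeff_sub, Polynomial.coeff_mul, Finset.Nat.antidiagonal_succ,
      Finset.Nat.antidiagonal_zero, Finset.map_singleton, Finset.sum_cons, Finset.map_cons,
      Finset.sum_singleton, Qcoeff, Function.Embedding.prodMap, Function.Embedding.coeFn_mk,
      Prod.map, Function.Embedding.refl_apply, pow_zero, mul_one, pow_one, Nat.choose_zero_right,
      Nat.choose_one_right, hy1, hy2, map_add, map_sub, mul_add, mul_sub, hf,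
      Nat.succ_eq_add_one, zero_add, add_mul] at hD
    rw [show (1 + 1 : ℕ) = 2 from rfl] at hD
    simp only [pow_two, mul_add, mul_sub, add_mul, sub_mul, map_add, map_sub] at hD
    have hsym : L (p * (linElem X g * linElem X f)) = L (p * (linElem X f * linElem X g)) := by
      rw [mul_comm (linElem X g)]
    have hc : (0 : ℝ) < m.choose 2 := by exact_mod_cast Nat.choose_pos hm
    rw [mul_assoc]
    have : (m.choose 2 : ℝ) * L p * L (p * (linElem X f * linElem X f)) ≤ 0 := by
      simp only [hy0] at hD
      push_cast at hD
      linarith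
    by_contra! hcon
    linarith [mul_pos (mul_pos hc hp) hcon]
  · simp [Polynomial.mul_coeff_zero, Qcoeff]
  · simp only [Polynomial.coeff_sub, Polynomial.mul_coeff_one, Qcoeff, hy1, hy2, hy0, map_add,
      map_sub, pow_zero, pow_one, mul_add, mul_sub, hf]
    ring
  · intro s hs hs1
    rw [Polynomial.eval_sub, Polynomial.eval_mul, Polynomial.eval_mul, Qeval, Qeval, Qeval, hy1,
      hy2, hy0, ← lin1, ← lin1, ← lin1, sub_eq_add_neg g f, ← pow_two]
    have a1 := pos s f hs hs1 (.inl rfl)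
    have a2 := pos s (-f) hs hs1 (.inr rfl)
    have := h _ _ a1.1 a2.1 a1.2 a2.2
    rw [show (1 / 2 : ℝ) • (((1, 0) + s • (g + f)) + ((1, 0) + s • (g + -f))) = (1, 0) + s • g by
      module] at this
    linarith

end SquareZero

section SquareZero
variable {ι R : Type*} [Fintype ι] [DecidableEq ι] [CommRing R] [Algebra ℝ R]
  {X : ι → R} {L : R →ₗ[ℝ] ℝ} {n : ℕ}

theorem linElem_indicator (X : ι → R) (A : Finset ι) :
    linElem X (0, fun i => if i ∈ A then 1 else 0) = ∑ i ∈ A, X i := by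
  simp [linElem_apply, ite_smul]

theorem linElem_one_zero (X : ι → R) : linElem X ((1, 0) : ℝ × (ι → ℝ)) = 1 := by
  simp [linElem_apply]

theorem linForm_zero_isLorentzian : IsLorentzian (linForm X L 0) :=
  ⟨0, fun f _ => by simp [linForm_apply]⟩

theorem pow_sum_mul_prod_mul_mul_nonneg (hX : ∀ i, X i * X i = 0)
    (hL : ∀ S : Finset ι, 0 ≤ L (∏ j ∈ S, X j)) (b : ℕ) (S A B : Finset ι) :
    0 ≤ L ((∑ i, X i) ^ b * (∏ j ∈ S, X j) * (∑ i ∈ A, X i) * ∑ i ∈ B, X i) := by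
  rw [Finset.mul_sum, map_sum]
  refine Finset.sum_nonneg fun i _ => ?_
  rw [mul_right_comm, Finset.mul_sum, map_sum]
  refine Finset.sum_nonneg fun j _ => ?_
  rw [mul_assoc _ _ (X i), prod_mul_of_sq_eq_zero hX]
  split_ifs
  · simp
  · rw [mul_assoc _ _ (X j), prod_mul_of_sq_eq_zero hX]
    split_ifs
    · simp
    · exact pow_sum_mul_prod_nonneg hX hL _ _

theorem isLorentzian_linForm_pow_sum_mul_prod (hX : ∀ i, X i * X i = 0)
    (hL : ∀ S : Finset ι, 0 ≤ L (∏ j ∈ S, X j)) (hn : n ≤ Fintype.card ι)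
    (hLpos : ∀ S : Finset ι, S.card ≤ n → 0 < L (∏ j ∈ S, X j)) (h : LogConcaveForm X L 1 n)
    (b : ℕ) : ∀ S : Finset ι, S.card + b + 2 ≤ n →
      IsLorentzian (linForm X L ((∑ i, X i) ^ b * ∏ j ∈ S, X j)) := by
  induction b with
  | zero =>
    intro S hS
    rw [pow_zero, one_mul]
    exact (h.prod_mul hX (by omega)).isLorentzian (by omega) (hLpos S (by omega))
  | succ b ih =>
    intro S hS
    have inner : ∀ A : Finset ι, Disjoint A S → IsLorentzian (linForm X L
        ((∑ i, X i) ^ b * (∏ j ∈ S, X j) *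
          linElem X (0, fun i => if i ∈ A then 1 else 0))) := by
      intro A
      induction A using Finset.induction_on with
      | empty =>
        intro _
        rw [linElem_indicator, Finset.sum_empty, mul_zero]
        exact linForm_zero_isLorentzian
      | insert m A hm ihA =>
        intro hd
        rw [Finset.disjoint_insert_left] at hd
        have single : (∏ j ∈ S, X j) * X m = ∏ j ∈ insert m S, X j := by
          rw [prod_mul_of_sq_eq_zero hX, if_neg hd.1]
        have hX1 : linElem X (0, fun i => if i ∈ ({m} : Finset ι) then 1 else 0) = X m := by
          rw [linElem_indicator, Finset.sum_singleton]
        have L1 : IsLorentzian (linForm X L ((∑ i, X i) ^ b * (∏ j ∈ S, X j) *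
            linElem X (0, fun i => if i ∈ ({m} : Finset ι) then 1 else 0))) := by
          rw [hX1, mul_assoc, single]
          exact ih _ (by rw [Finset.card_insert_of_notMem hd.1]; omega)
        rcases A.eq_empty_or_nonempty with rfl | hA
        · exact L1
        have hsplit : ((0, fun i => if i ∈ insert m A then 1 else 0) : ℝ × (ι → ℝ)) =
            (0, fun i => if i ∈ A then 1 else 0) +
              (0, fun i => if i ∈ ({m} : Finset ι) then 1 else 0) := by
          ext i
          · simp
          · simp only [Prod.snd_add, Pi.add_apply, Finset.mem_insert, Finset.mem_singleton]
            by_cases h1 : i = m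
            · subst h1; simp [hm]
            · simp [h1]
        rw [hsplit]
        refine IsLorentzian.linForm_add (h := (1, 0)) (ihA hd.2) L1 ?_ ?_ ?_
        · rw [hX1, mul_assoc, hX, mul_zero, map_zero]
        · rw [hX1, linElem_indicator, mul_assoc _ _ (X m), single]
          exact pow_sum_mul_prod_mul_mul_nonneg hX hL b _ A A
        · rw [hX1, linElem_indicator, linElem_one_zero, mul_one, mul_right_comm, mul_assoc _ _ (X m),
            single, Finset.mul_sum, map_sum]
          refine (Finset.sum_pos (fun i hi => ?_) hA).ne'
          have hi' : i ∉ insert m S := by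
            rw [Finset.mem_insert, not_or]
            exact ⟨fun h => hm (h ▸ hi), Finset.disjoint_left.1 hd.2 hi⟩
          rw [mul_assoc, prod_mul_of_sq_eq_zero hX, if_neg hi']
          refine pow_sum_mul_prod_pos hX hL hn hLpos b _ ?_
          rw [Finset.card_insert_of_notMem hi', Finset.card_insert_of_notMem hd.1]
          omega
    have := inner Sᶜ disjoint_compl_left
    rw [linElem_indicator] at this
    convert this using 2
    rw [pow_succ, mul_assoc, mul_assoc]
    congr 1
    rw [← Finset.sum_add_sum_compl S X, add_mul, mul_comm _ (∏ j ∈ S, X j), mul_comm _ (∏ j ∈ S, X j),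
      add_eq_right, Finset.mul_sum]
    refine Finset.sum_eq_zero fun i hi => ?_
    rw [prod_mul_of_sq_eq_zero hX, if_pos hi]

theorem pow_sum_logConcave (hX : ∀ i, X i * X i = 0)
    (hL : ∀ S : Finset ι, 0 ≤ L (∏ j ∈ S, X j)) (hn : n ≤ Fintype.card ι)
    (hLpos : ∀ S : Finset ι, S.card ≤ n → 0 < L (∏ j ∈ S, X j)) (h : LogConcaveForm X L 1 n)
    {b : ℕ} (hb : b + 2 ≤ n) :
    L ((∑ i, X i) ^ b) * L ((∑ i, X i) ^ (b + 2)) ≤ L ((∑ i, X i) ^ (b + 1)) ^ 2 := by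
  have pos : ∀ k ≤ n, 0 < L ((∑ i, X i) ^ k) := fun k hk => by
    simpa using pow_sum_mul_prod_pos hX hL hn hLpos k ∅ (by simpa using hk)
  have hLor := isLorentzian_linForm_pow_sum_mul_prod hX hL hn hLpos h b ∅ (by simpa using hb)
  rw [Finset.prod_empty, mul_one] at hLor
  set z := ∑ i, X i with hz
  set t := L (z ^ (b + 1)) / L (z ^ b) with ht
  have hb0 := pos b (by omega)
  have hlin : linElem X ((-t, fun _ => 1) : ℝ × (ι → ℝ)) = z - t • 1 := by
    simp [linElem_apply, hz]; ring
  have htb : t * L (z ^ b) = L (z ^ (b + 1)) := by rw [ht]; field_simp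
  have := hLor.apply_self_nonpos (linForm_symm X L _) (f := (-t, fun _ => 1)) (g := (1, 0))
    (h := (1, 0)) (by
      rw [linForm_apply, linElem_one_zero, mul_one, mul_one]; exact hb0.le) (by
      rw [linForm_apply, linElem_one_zero, mul_one, mul_one]; exact hb0.ne') (by
      rw [linForm_apply, linElem_one_zero, mul_one, hlin, mul_sub, ← pow_succ, mul_smul_comm,
        map_sub, map_smul, mul_one, smul_eq_mul, htb, sub_self])
  rw [linForm_apply, hlin] at this
  have e : z ^ b * (z - t • 1) * (z - t • 1) =
      z ^ (b + 2) - (2 * t) • z ^ (b + 1) + (t * t) • z ^ b := by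
    simp only [Algebra.smul_def, map_mul, mul_one]
    have : algebraMap ℝ R 2 = 2 := map_ofNat _ 2
    rw [this]
    ring
  rw [e, map_add, map_sub, map_smul, map_smul, smul_eq_mul, smul_eq_mul] at this
  have h2 : L (z ^ (b + 2)) ≤ t * L (z ^ (b + 1)) := by rw [← htb]; rw [← htb] at this; linarith
  calc _ ≤ L (z ^ b) * (t * L (z ^ (b + 1))) := by gcongr
    _ = t * L (z ^ b) * L (z ^ (b + 1)) := by ring
    _ = _ := by rw [htb]; ring

end SquareZero

section SquareZeroAlgebra
variable {ι : Type*} [Fintype ι] [DecidableEq ι]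

/-- The ideal of `ℝ[Xᵢ]` generated by the squares of the variables. -/
noncomputable def squareIdeal (ι : Type*) : Ideal (MvPolynomial ι ℝ) :=
  Ideal.span (Set.range fun i => MvPolynomial.X i * MvPolynomial.X i)

theorem exists_functional_prod_eq (v : Finset ι → ℝ) :
    ∃ L : (MvPolynomial ι ℝ ⧸ squareIdeal ι) →ₗ[ℝ] ℝ, ∀ T : Finset ι,
      L (∏ i ∈ T, Ideal.Quotient.mk (squareIdeal ι) (MvPolynomial.X i)) = v T := by
  set Λ : MvPolynomial ι ℝ →ₗ[ℝ] ℝ := (MvPolynomial.basisMonomials ι ℝ).constr ℝ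
    (fun α => if ∀ i, α i ≤ 1 then v α.support else 0) with hΛ
  have hmon : ∀ α : ι →₀ ℕ, Λ (MvPolynomial.monomial α 1) =
      if ∀ i, α i ≤ 1 then v α.support else 0 := by
    intro α
    rw [← congrFun (MvPolynomial.coe_basisMonomials (R := ℝ) (σ := ι)) α, hΛ,
      Module.Basis.constr_basis]
  have hker : (squareIdeal ι).restrictScalars ℝ ≤ LinearMap.ker Λ := by
    intro p hp
    have : ∀ q, Λ (q * p) = 0 := by
      refine Submodule.span_induction (p := fun p _ => ∀ q, Λ (q * p) = 0) ?_ ?_ ?_ ?_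
        (show p ∈ squareIdeal ι from hp)
      · rintro _ ⟨i, rfl⟩ q
        induction q using MvPolynomial.induction_on' with
        | monomial α a =>
          have : MvPolynomial.monomial α a * (MvPolynomial.X i * MvPolynomial.X i) =
              a • MvPolynomial.monomial (α + Finsupp.single i 1 + Finsupp.single i 1) 1 := by
            rw [← mul_assoc, MvPolynomial.X, MvPolynomial.monomial_mul, MvPolynomial.monomial_mul,
              MvPolynomial.smul_monomial]
            simp
          rw [this, map_smul, hmon, if_neg, smul_zero]
          intro h
          have := h i
          simp at this
        | add p q hp hq => rw [add_mul, map_add, hp, hq, add_zero]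
      · intro q; simp
      · intro x y _ _ hx hy q; rw [mul_add, map_add, hx, hy, add_zero]
      · intro a x _ hx q; rw [smul_eq_mul, ← mul_assoc, hx]
    simpa using this 1
  refine ⟨((squareIdeal ι).restrictScalars ℝ).liftQ Λ hker ∘ₗ
    (Submodule.Quotient.restrictScalarsEquiv ℝ (squareIdeal ι)).symm.toLinearMap, fun T => ?_⟩
  rw [← map_prod]
  change Λ (∏ i ∈ T, MvPolynomial.X i) = v T
  have e : ∏ i ∈ T, (MvPolynomial.X i : MvPolynomial ι ℝ) =
      MvPolynomial.monomial (∑ i ∈ T, Finsupp.single i 1) 1 := by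
    rw [MvPolynomial.monomial_sum_one]; rfl
  have ev : ∀ i, (∑ j ∈ T, Finsupp.single j 1 : ι →₀ ℕ) i = if i ∈ T then 1 else 0 := by
    intro i
    simp [Finsupp.finsetSum_apply, Finsupp.single_apply]
  rw [e, hmon, if_pos]
  · congr 1
    ext i
    rw [Finsupp.mem_support_iff, ev]
    split_ifs <;> simp_all
  · intro i; rw [ev]; split_ifs <;> simp

end SquareZeroAlgebra

section ZonotopeLogConcave
variable {ι : Type*} [Fintype ι] [DecidableEq ι] {n : ℕ}

theorem zonotopeBody_midpoint {E : Type*} [AddCommGroup E] [Module ℝ E] {M : Set E}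
    (hM : Convex ℝ M) (u : ι → E) {a b : ℝ} (ha : 0 < a) (hb : 0 < b) (x y : ι → ℝ) :
    ∀ p ∈ zonotopeBody (a • M) u x, ∀ q ∈ zonotopeBody (b • M) u y,
      (1 / 2 : ℝ) • (p + q) ∈
        zonotopeBody (((1 / 2 : ℝ) * (a + b)) • M) u ((1 / 2 : ℝ) • (x + y)) := by
  rintro _ ⟨_, ⟨p, hp, rfl⟩, s, hs, rfl⟩ _ ⟨_, ⟨q, hq, rfl⟩, t, ht, rfl⟩
  refine ⟨(1 / 2 : ℝ) • (a • p + b • q), ?_, fun i => (1 / 2) * (s i + t i), fun i => ?_, ?_⟩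
  · refine ⟨(a / (a + b)) • p + (b / (a + b)) • q, hM hp hq (by positivity) (by positivity)
      (by field_simp), ?_⟩
    simp only [smul_add, smul_smul]
    congr 2 <;> field_simp
  · have h1 := abs_le.1 (hs i)
    have h2 := abs_le.1 (ht i)
    simp only [Pi.smul_apply, Pi.add_apply, smul_eq_mul]
    rw [abs_le]
    constructor <;> linarith
  · simp only [mul_smul, add_smul, ← Finset.smul_sum, Finset.sum_add_distrib, smul_add]
    abel

/-- The volume of a generic zonotopal tube around a convex body has log-concave normalised
coefficients. -/
theorem exists_logConcave_coeffs {M : Set (EuclideanSpace ℝ (Fin n))} (hM : IsCompact M)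
    (hMc : Convex ℝ M) (hMi : (interior M).Nonempty) (u : ι → EuclideanSpace ℝ (Fin n))
    (hu : ∀ T : Finset ι, T.card = n → LinearIndependent ℝ fun i : T => u i)
    (hn : n ≤ Fintype.card ι) :
    ∃ W : ℕ → ℝ, (∀ k ≤ n, 0 < W k) ∧ (∀ k, k + 2 ≤ n → W k * W (k + 2) ≤ W (k + 1) ^ 2) ∧
      ∀ t : ℝ, 0 ≤ t → (volume (zonotopeBody M u fun _ => t)).toReal =
        ∑ k ∈ Finset.range (n + 1), n.choose k * W k * t ^ k := by
  obtain ⟨c, hc⟩ := exists_volume_zonotopeBody_eq hM hMc u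
  have c0 := zonotope_coeff_nonneg hc
  have cpos : ∀ T : Finset ι, T.card ≤ n → 0 < c T := fun T hT =>
    zonotope_coeff_pos hM hMi hc hu hn hT
  have cz : ∀ T : Finset ι, n < T.card → c T = 0 := fun T hT => zonotope_coeff_eq_zero hM hc hT
  obtain ⟨L, hL⟩ := exists_functional_prod_eq (ι := ι)
    (fun T => (n - T.card).factorial * c T)
  set X : ι → MvPolynomial ι ℝ ⧸ squareIdeal ι :=
    fun i => Ideal.Quotient.mk (squareIdeal ι) (MvPolynomial.X i) with hXdef
  have hX : ∀ i, X i * X i = 0 := by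
    intro i
    rw [hXdef, ← map_mul]
    exact Ideal.Quotient.eq_zero_iff_mem.2 (Ideal.subset_span ⟨i, rfl⟩)
  have hLn : ∀ S : Finset ι, 0 ≤ L (∏ j ∈ S, X j) := fun S => by
    rw [hL]; exact mul_nonneg (by positivity) (c0 S)
  have hLp : ∀ S : Finset ι, S.card ≤ n → 0 < L (∏ j ∈ S, X j) := fun S hS => by
    rw [hL]; exact mul_pos (by positivity) (cpos S hS)
  have F : ∀ w : ℝ × (ι → ℝ), L (linElem X w ^ n) =
      n.factorial * ∑ T, c T * (w.1 ^ (n - T.card) * ∏ i ∈ T, w.2 i) := by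
    intro w
    rw [linElem_apply, add_sum_pow_of_sq_eq_zero _ _ (fun i => by
      rw [smul_mul_smul_comm, hX, smul_zero]), map_sum, Finset.powerset_univ, Finset.mul_sum]
    refine Finset.sum_congr rfl fun T _ => ?_
    rw [smul_pow, one_pow, Finset.prod_smul, mul_assoc, map_natCast_mul_real, smul_mul_smul_comm,
      one_mul, map_smul, hL, smul_eq_mul]
    rcases le_or_gt T.card n with hT | hT
    · have : ((n - T.card).factorial : ℝ) * n.descFactorial T.card = n.factorial := by
        exact_mod_cast Nat.factorial_mul_descFactorial hT
      rw [← this]; ring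
    · rw [cz T hT]; ring
  have FV : ∀ w : ℝ × (ι → ℝ), 0 < w.1 → 0 ≤ w.2 → L (linElem X w ^ n) =
      n.factorial * (volume (zonotopeBody (w.1 • M) u w.2)).toReal := by
    intro w hw hw2
    have e : w.1 • zonotopeBody M u (w.1⁻¹ • w.2) = zonotopeBody (w.1 • M) u w.2 := by
      rw [smul_zonotopeBody u _ hw, smul_smul, mul_inv_cancel₀ hw.ne', one_smul]
    rw [F, ← e, volume_smul_toReal _ hw.le, hc _ (smul_nonneg (by positivity) hw2),
      Finset.mul_sum (a := w.1 ^ n)]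
    congr 1
    refine Finset.sum_congr rfl fun T _ => ?_
    simp only [Pi.smul_apply, smul_eq_mul, Finset.prod_mul_distrib, Finset.prod_const]
    rcases le_or_gt T.card n with hT | hT
    · have h1 : w.1 ^ n * w.1⁻¹ ^ T.card = w.1 ^ (n - T.card) := by
        rw [inv_pow, ← pow_sub₀ _ hw.ne' hT]
      rw [← h1]; ring
    · rw [cz T hT]; ring
  have hLC : LogConcaveForm X L 1 n := by
    intro w w' hw hw' hw2 hw2'
    rw [one_mul, one_mul, one_mul, FV w hw hw2, FV w' hw' hw2', FV]
    · have := volume_mul_volume_le_sq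
        ((hM.smul w.1).zonotopeBody u w.2) ((hM.smul w'.1).zonotopeBody u w'.2)
        ((hM.smul ((1 / 2 : ℝ) * (w.1 + w'.1))).zonotopeBody u ((1 / 2 : ℝ) • (w.2 + w'.2)))
        (zonotopeBody_midpoint hMc u hw hw' _ _)
      have hsm : ((1 / 2 : ℝ) • (w + w')).1 = (1 / 2 : ℝ) * (w.1 + w'.1) := rfl
      have hsm2 : ((1 / 2 : ℝ) • (w + w')).2 = (1 / 2 : ℝ) • (w.2 + w'.2) := rfl
      rw [hsm, hsm2, mul_mul_mul_comm, mul_pow, ← pow_two]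
      gcongr
    · simp; positivity
    · exact smul_nonneg (by norm_num) (add_nonneg hw2 hw2')
  refine ⟨fun k => L ((∑ i, X i) ^ k) / n.factorial, fun k hk => ?_, fun k hk => ?_, fun t ht => ?_⟩
  · have := pow_sum_mul_prod_pos hX hLn hn hLp k ∅ (by simpa using hk)
    rw [Finset.prod_empty, mul_one] at this
    positivity
  · have := pow_sum_logConcave hX hLn hn hLp hLC hk
    rw [div_mul_div_comm, div_pow, ← pow_two]
    gcongr
  · have h1 := FV (1, fun _ => t) one_pos (fun _ => ht)
    simp only [one_smul] at h1
    have h2 : linElem X ((1, fun _ => t) : ℝ × (ι → ℝ)) = t • ∑ i, X i + 1 := by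
      rw [linElem_apply, one_smul, Finset.smul_sum, add_comm]
    rw [h2, add_pow, map_sum] at h1
    have hf : (n.factorial : ℝ) ≠ 0 := by positivity
    rw [← mul_right_inj' hf, ← h1, Finset.mul_sum]
    refine Finset.sum_congr rfl fun k _ => ?_
    rw [one_pow, mul_one, mul_comm (_ ^ _), map_natCast_mul_real, smul_pow, map_smul, smul_eq_mul]
    field_simp

end ZonotopeLogConcave

theorem mul_le_mul_of_logConcave {a b c d : ℝ} (hb : 0 < b) (hc : 0 < c)
    (hd : 0 < d) (h1 : a * c ≤ b ^ 2) (h2 : b * d ≤ c ^ 2) : a * d ≤ b * c := by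
  have h : (a * c) * (b * d) ≤ b ^ 2 * c ^ 2 := by
    calc (a * c) * (b * d) ≤ b ^ 2 * (b * d) := by gcongr
      _ ≤ b ^ 2 * c ^ 2 := by gcongr
  by_contra! hcon
  nlinarith [mul_pos hb hc]

/-- Polynomials of degree at most five with positive log-concave normalised coefficients have no
purely imaginary roots. -/
theorem sum_choose_mul_I_pow_ne_zero {n : ℕ} (hn : n ≤ 5) {W : ℕ → ℝ} (hW : ∀ k ≤ n, 0 < W k)
    (hlc : ∀ k, k + 2 ≤ n → W k * W (k + 2) ≤ W (k + 1) ^ 2) (y : ℝ) :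
    ∑ k ∈ Finset.range (n + 1), ((n.choose k * W k : ℝ) : ℂ) * (y * Complex.I) ^ k ≠ 0 := by
  intro h
  have I3 : Complex.I ^ 3 = -Complex.I := by rw [pow_succ, Complex.I_sq]; ring
  have I4 : Complex.I ^ 4 = 1 := Complex.I_pow_four
  have I5 : Complex.I ^ 5 = Complex.I := by rw [pow_succ, I4, one_mul]
  by_cases hy : y = 0
  · subst hy
    rw [Finset.sum_eq_single 0 (by intro k _ hk; simp [hk]) (by simp)] at h
    have := hW 0 (by omega)
    simp at h
    linarith
  have hY : 0 < y ^ 2 := by positivity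
  have hW0 := hW 0 (by omega)
  interval_cases n
  · simp at h; linarith
  · simp [Finset.sum_range_succ, Complex.ext_iff] at h
    linarith
  · have hW1 := hW 1 (by omega)
    simp [Finset.sum_range_succ, Complex.ext_iff, mul_pow, Nat.choose, ← Complex.ofReal_pow] at h
    rcases h.2 with h | h
    · linarith
    · exact hy h
  · have hW1 := hW 1 (by omega)
    have hW2 := hW 2 (by omega)
    have hW3 := hW 3 (by omega)
    have e1 : W 0 - 3 * W 2 * y ^ 2 = 0 := by
      have := congrArg Complex.re h
      simp [Finset.sum_range_succ, mul_pow, Nat.choose, ← Complex.ofReal_pow, I3] at this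
      linarith
    have e2 : 3 * W 1 - W 3 * y ^ 2 = 0 := by
      have := congrArg Complex.im h
      simp [Finset.sum_range_succ, mul_pow, Nat.choose, ← Complex.ofReal_pow, I3] at this
      refine (mul_right_inj' hy).1 ?_
      linarith
    have := mul_le_mul_of_logConcave hW1 hW2 hW3 (hlc 0 (by omega)) (hlc 1 (by omega))
    nlinarith [mul_pos hW1 hW2]
  · have hW1 := hW 1 (by omega)
    have hW2 := hW 2 (by omega)
    have hW3 := hW 3 (by omega)
    have hW4 := hW 4 (by omega)
    have e1 : W 0 - 6 * W 2 * y ^ 2 + W 4 * (y ^ 2) ^ 2 = 0 := by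
      have := congrArg Complex.re h
      simp [Finset.sum_range_succ, mul_pow, Nat.choose, ← Complex.ofReal_pow, I3, I4] at this
      linarith
    have e2 : W 1 - W 3 * y ^ 2 = 0 := by
      have := congrArg Complex.im h
      simp [Finset.sum_range_succ, mul_pow, Nat.choose, ← Complex.ofReal_pow, I3, I4] at this
      refine (mul_right_inj' (mul_ne_zero four_ne_zero hy)).1 ?_
      linarith
    have a1 := mul_le_mul_of_logConcave hW1 hW2 hW3 (hlc 0 (by omega)) (hlc 1 (by omega))
    have a2 := mul_le_mul_of_logConcave hW2 hW3 hW4 (hlc 1 (by omega)) (hlc 2 (by omega))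
    set Y := y ^ 2
    have e3 : W 1 = W 3 * Y := by linarith
    rw [e3] at a1 a2
    have b1 : W 0 ≤ W 2 * Y := by
      by_contra! hc; nlinarith
    have b2 : W 4 * Y ^ 2 ≤ W 2 * Y := by
      have : W 4 * Y ≤ W 2 := by by_contra! hc; nlinarith
      nlinarith
    nlinarith [mul_pos hW2 hY]
  · have hW1 := hW 1 (by omega)
    have hW2 := hW 2 (by omega)
    have hW3 := hW 3 (by omega)
    have hW4 := hW 4 (by omega)
    have hW5 := hW 5 (by omega)
    have e1 : W 0 - 10 * W 2 * y ^ 2 + 5 * W 4 * (y ^ 2) ^ 2 = 0 := by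
      have := congrArg Complex.re h
      simp [Finset.sum_range_succ, mul_pow, Nat.choose, ← Complex.ofReal_pow, I3, I4, I5] at this
      linarith
    have e2 : 5 * W 1 - 10 * W 3 * y ^ 2 + W 5 * (y ^ 2) ^ 2 = 0 := by
      have := congrArg Complex.im h
      simp [Finset.sum_range_succ, mul_pow, Nat.choose, ← Complex.ofReal_pow, I3, I4, I5] at this
      refine (mul_right_inj' hy).1 ?_
      linarith
    have a1 := mul_le_mul_of_logConcave hW1 hW2 hW3 (hlc 0 (by omega)) (hlc 1 (by omega))
    have a2 := mul_le_mul_of_logConcave hW2 hW3 hW4 (hlc 1 (by omega)) (hlc 2 (by omega))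
    have a3 := mul_le_mul_of_logConcave hW3 hW4 hW5 (hlc 2 (by omega)) (hlc 3 (by omega))
    generalize W 0 = w0, W 1 = w1, W 2 = w2, W 3 = w3, W 4 = w4, W 5 = w5 at *
    generalize y ^ 2 = Y at *
    -- normalise: `E = w4 Y / w2`, `B = w1 / (w3 Y)`
    have hE : w4 * Y < 2 * w2 := by nlinarith
    have hB : w1 < 2 * (w3 * Y) := by linarith [mul_pos hW5 (pow_pos hY 2)]
    have c1 : w0 * w3 = (10 * w2 - 5 * w4 * Y) * (w3 * Y) := by linear_combination w3 * e1
    have c2 : w5 * Y * Y * w2 = (10 * (w3 * Y) - 5 * w1) * w2 := by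
      linear_combination w2 * e2
    have d1 : 10 * w2 * (w3 * Y) ≤ 5 * (w4 * Y) * (w3 * Y) + w1 * w2 := by linarith
    have d2 : 10 * (w3 * Y) * w2 ≤ 5 * w1 * w2 + (w3 * Y) * (w4 * Y) := by nlinarith
    have d3 : w1 * (w4 * Y) ≤ w2 * (w3 * Y) := by nlinarith
    have hw3 : 0 < w3 * Y := by positivity
    have hw4 : 0 < w4 * Y := by positivity
    generalize w3 * Y = d at *
    generalize w4 * Y = e at *
    have f1 : 8 * w2 < 5 * e := by
      by_contra! hc; nlinarith
    have f2 : 8 * d < 5 * w1 := by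
      by_contra! hc; nlinarith
    nlinarith

open Filter in
theorem Polynomial.le_coeff_of_mul_pow_le {P : Polynomial ℝ} {n : ℕ} (hn : 1 ≤ n)
    (hP : P.natDegree ≤ n) {V : ℝ} (h : ∀ t, 0 ≤ t → V * t ^ n ≤ P.eval t) : V ≤ P.coeff n := by
  by_contra! hcon
  set D := P - C V * X ^ n with hD
  have hDn : D.natDegree ≤ n := by
    rw [hD]
    exact (natDegree_sub_le _ _).trans (max_le hP (natDegree_C_mul_X_pow_le _ _))
  have hDc : D.coeff n < 0 := by simp [hD, hcon]
  have hdeg : D.natDegree = n := le_antisymm hDn (le_natDegree_of_ne_zero hDc.ne)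
  have hlc : D.leadingCoeff < 0 := by rw [leadingCoeff, hdeg]; exact hDc
  have ht := D.tendsto_atBot_of_leadingCoeff_nonpos
    (natDegree_pos_iff_degree_pos.1 (by omega)) hlc.le
  obtain ⟨t, ht0, ht1⟩ := ((eventually_ge_atTop 0).and (ht.eventually (eventually_lt_atBot 0))).exists
  have := h t ht0
  simp [hD] at ht1
  linarith

theorem Polynomial.coeff_mul_re_pow_le_norm_aeval {P : Polynomial ℝ} {n : ℕ}
    (hP : P.natDegree ≤ n) (hc : 0 < P.coeff n) (hst : ∀ z : ℂ, aeval z P = 0 → z.re ≤ 0)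
    {w : ℂ} (hw : 0 ≤ w.re) : P.coeff n * w.re ^ n ≤ ‖aeval w P‖ := by
  have hdeg : P.natDegree = n := le_antisymm hP (le_natDegree_of_ne_zero hc.ne')
  have hP0 : P ≠ 0 := by rintro rfl; simp at hc
  have hs := IsAlgClosed.splits (P.map (algebraMap ℝ ℂ))
  have hcard : (P.map (algebraMap ℝ ℂ)).roots.card = n := by
    rw [← hs.natDegree_eq_card_roots, natDegree_map, hdeg]
  have e : aeval w P = (P.coeff n : ℂ) *
      ((P.map (algebraMap ℝ ℂ)).roots.map fun a => w - a).prod := by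
    rw [aeval_def, ← eval_map]
    conv_lhs => rw [hs.eq_prod_roots]
    rw [eval_mul, eval_C, eval_multiset_prod, Multiset.map_map, leadingCoeff_map]
    simp [leadingCoeff, hdeg]
  rw [e, norm_mul, Complex.norm_real, Real.norm_of_nonneg hc.le, ← hcard]
  refine mul_le_mul_of_nonneg_left ?_ (by rw [hcard]; exact hc.le)
  have hr : ∀ a ∈ (P.map (algebraMap ℝ ℂ)).roots, w.re ≤ ‖w - a‖ := by
    intro a ha
    have ha' : aeval a P = 0 := by
      rw [mem_roots (by simpa using hP0), IsRoot, eval_map, ← aeval_def] at ha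
      exact ha
    have := hst a ha'
    have h2 := Complex.re_le_norm (w - a)
    rw [Complex.sub_re] at h2
    linarith
  generalize (P.map (algebraMap ℝ ℂ)).roots = m at hr
  induction m using Multiset.induction_on with
  | empty => simp
  | cons a m ih =>
    rw [Multiset.card_cons, pow_succ, Multiset.map_cons, Multiset.prod_cons, norm_mul, mul_comm]
    have h1 := hr a (Multiset.mem_cons_self a m)
    have h2 := ih fun b hb => hr b (Multiset.mem_cons_of_mem hb)
    gcongr

section
variable {ι : Type*} [Fintype ι] [DecidableEq ι] {n : ℕ}

theorem subset_zonotopeBody {E : Type*} [AddCommGroup E] [Module ℝ E] (M : Set E) (u : ι → E)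
    {x : ι → ℝ} (hx : 0 ≤ x) : M ⊆ zonotopeBody M u x :=
  fun p hp => ⟨p, hp, 0, fun i => by simpa using hx i, by simp⟩

/-- The volume polynomial of a generic zonotopal tube is stable in dimension at most five. -/
theorem exists_stable_zonotope_polynomial (hn1 : 1 ≤ n) (hn5 : n ≤ 5)
    {M : Set (EuclideanSpace ℝ (Fin n))} (hM : IsCompact M)
    (hMc : Convex ℝ M) (hMi : (interior M).Nonempty) {u : ι → EuclideanSpace ℝ (Fin n)}
    (hu : ∀ T : Finset ι, T.card = n → LinearIndependent ℝ fun i : T => u i)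
    (hn : n ≤ Fintype.card ι)
    (hB : closedBall (0 : EuclideanSpace ℝ (Fin n)) 1 ⊆ zonotopeBody {0} u fun _ => 1) :
    ∃ P : Polynomial ℝ, P.natDegree ≤ n ∧
      (∀ t, 0 ≤ t → P.eval t = (volume (zonotopeBody M u fun _ => t)).toReal) ∧
      ∀ w : ℂ, 0 ≤ w.re →
        (volume (closedBall (0 : EuclideanSpace ℝ (Fin n)) 1)).toReal * w.re ^ n ≤
          ‖Polynomial.aeval w P‖ := by
  have build : ∀ M : Set (EuclideanSpace ℝ (Fin n)), IsCompact M → Convex ℝ M →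
      (interior M).Nonempty → ∃ P : Polynomial ℝ, P.natDegree ≤ n ∧
      (∀ t, 0 ≤ t → P.eval t = (volume (zonotopeBody M u fun _ => t)).toReal) ∧
      ∀ y : ℝ, Polynomial.aeval (y * Complex.I) P ≠ 0 := by
    intro M hM hMc hMi
    obtain ⟨W, hW, hlc, hvol⟩ := exists_logConcave_coeffs hM hMc hMi u hu hn
    refine ⟨∑ k ∈ Finset.range (n + 1), Polynomial.C (n.choose k * W k) * Polynomial.X ^ k,
      ?_, fun t ht => ?_, fun y => ?_⟩
    · refine Polynomial.natDegree_sum_le_of_forall_le _ _ fun k hk => ?_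
      exact (Polynomial.natDegree_C_mul_X_pow_le _ _).trans (by simpa [Nat.lt_succ_iff] using hk)
    · rw [hvol t ht]; simp [Polynomial.eval_finsetSum]
    · have := sum_choose_mul_I_pow_ne_zero hn5 hW hlc y
      simpa [map_sum] using this
  obtain ⟨P, hPn, hPe, -⟩ := build M hM hMc hMi
  refine ⟨P, hPn, hPe, fun w hw => ?_⟩
  have hlow : (volume (closedBall (0 : EuclideanSpace ℝ (Fin n)) 1)).toReal ≤ P.coeff n := by
    refine Polynomial.le_coeff_of_mul_pow_le hn1 hPn fun t ht => ?_
    rw [hPe t ht, mul_comm, ← volume_smul_toReal _ ht]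
    refine ENNReal.toReal_mono (hM.zonotopeBody u _).measure_lt_top.ne ?_
    obtain ⟨p, hp⟩ := hMi
    have hp := interior_subset hp
    rw [← measure_vadd volume p (t • closedBall (0 : EuclideanSpace ℝ (Fin n)) 1)]
    refine measure_mono ?_
    rintro _ ⟨_, ⟨b, hb, rfl⟩, rfl⟩
    obtain ⟨q, hq, s, hs, rfl⟩ := hB hb
    rw [Set.mem_singleton_iff] at hq
    subst hq
    refine ⟨p, hp, fun i => t * s i, fun i => ?_, ?_⟩
    · rw [abs_mul, abs_of_nonneg ht]
      have := hs i
      nlinarith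
    · simp [Finset.smul_sum, mul_smul]
  have hpos : 0 < (volume (closedBall (0 : EuclideanSpace ℝ (Fin n)) 1)).toReal :=
    ENNReal.toReal_pos (measure_closedBall_pos _ _ one_pos).ne'
      (isCompact_closedBall _ _).measure_lt_top.ne
  refine le_trans (by gcongr) (Polynomial.coeff_mul_re_pow_le_norm_aeval hPn
    (hpos.trans_le hlow) (fun z hz => ?_) hw)
  by_contra! hzr
  obtain ⟨Q, -, hQe, hQI⟩ := build (zonotopeBody M u fun _ => z.re) (hM.zonotopeBody u _)
    (hMc.zonotopeBody u _) (hMi.mono (interior_mono (subset_zonotopeBody M u fun _ => hzr.le)))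
  have hQP : Q = P.comp (Polynomial.X + Polynomial.C z.re) := by
    refine Polynomial.eq_of_infinite_eval_eq _ _ ((Set.Ici_infinite (0 : ℝ)).mono fun t ht => ?_)
    have ht : 0 ≤ t := ht
    simp only [Set.mem_ofPred_eq, Polynomial.eval_comp, Polynomial.eval_add, Polynomial.eval_X,
      Polynomial.eval_C]
    rw [hQe t ht, hPe _ (by linarith), zonotopeBody_zonotopeBody u (fun _ => hzr.le) (fun _ => ht)]
    congr 3
    funext _
    simp [add_comm]
  apply hQI z.im
  rw [hQP, Polynomial.aeval_comp]
  simp only [map_add, Polynomial.aeval_X, Polynomial.aeval_C, Complex.coe_algebraMap]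
  rw [add_comm, Complex.re_add_im, hz]

end

section
variable {n : ℕ}

theorem setIntegral_abs_inner_eq {v w : EuclideanSpace ℝ (Fin n)} (h : ‖v‖ = ‖w‖) :
    ∫ u in closedBall (0 : EuclideanSpace ℝ (Fin n)) 1, |inner ℝ u v| =
      ∫ u in closedBall (0 : EuclideanSpace ℝ (Fin n)) 1, |inner ℝ u w| := by
  set r := (ℝ ∙ (v - w))ᗮ.reflection with hr
  have hrv : r v = w := Submodule.reflection_sub h
  rw [← r.measurePreserving.setIntegral_preimage_emb r.toHomeomorph.measurableEmbedding
    (fun u => |inner ℝ u w|)]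
  have hpre : r ⁻¹' closedBall 0 1 = closedBall 0 1 := by
    ext x; simp
  rw [hpre]
  refine integral_congr_ae (.of_forall fun u => ?_)
  change |inner ℝ u v| = |inner ℝ (r u) w|
  rw [← hrv, r.inner_map_map]

theorem setIntegral_abs_inner_pos {v : EuclideanSpace ℝ (Fin n)} (hv : v ≠ 0) :
    0 < ∫ u in closedBall (0 : EuclideanSpace ℝ (Fin n)) 1, |inner ℝ u v| := by
  have hc : Continuous fun u : EuclideanSpace ℝ (Fin n) => |inner ℝ u v| := by fun_prop
  rw [setIntegral_pos_iff_support_of_nonneg_ae (.of_forall fun u => abs_nonneg _)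
    (hc.continuousOn.integrableOn_compact (isCompact_closedBall _ _))]
  have ho : IsOpen (Function.support (fun u : EuclideanSpace ℝ (Fin n) => |inner ℝ u v|) ∩
      ball 0 1) := (hc.isOpen_support).inter isOpen_ball
  refine (ho.measure_pos volume ⟨(2 * ‖v‖)⁻¹ • v, ?_, ?_⟩).trans_le
    (measure_mono (Set.inter_subset_inter_right _ ball_subset_closedBall))
  · have : ‖v‖ ≠ 0 := norm_ne_zero_iff.2 hv
    simp [inner_smul_left, hv]
  · have : ‖v‖ ≠ 0 := norm_ne_zero_iff.2 hv
    rw [mem_ball_zero_iff, norm_smul, norm_inv, norm_mul, norm_norm, mul_inv, mul_assoc,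
      inv_mul_cancel₀ this]
    norm_num

theorem exists_sum_abs_inner_approx (hn : 1 ≤ n) {a b : ℝ} (ha : 0 < a) (hab : a < b) :
    ∃ (N : ℕ) (u : Fin N → EuclideanSpace ℝ (Fin n)), ∀ v,
      a * ‖v‖ ≤ ∑ i, |inner ℝ (u i) v| ∧ ∑ i, |inner ℝ (u i) v| ≤ b * ‖v‖ := by
  set S := sphere (0 : EuclideanSpace ℝ (Fin n)) 1
  have : Nonempty (Fin n) := ⟨⟨0, hn⟩⟩
  set f : EuclideanSpace ℝ (Fin n) → C(S, ℝ) := fun u => ⟨fun v => |inner ℝ u (v : _)|, by fun_prop⟩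
    with hf
  have hfc : Continuous f := ContinuousMap.continuous_of_continuous_uncurry _ (by
    simp only [hf, Function.uncurry_def, ContinuousMap.coe_mk]; fun_prop)
  set A := closedBall (0 : EuclideanSpace ℝ (Fin n)) 1
  have hfi : IntegrableOn f A := hfc.continuousOn.integrableOn_compact (isCompact_closedBall _ _)
  have hA0 : volume A ≠ 0 := (measure_closedBall_pos _ _ one_pos).ne'
  have hAt : volume A ≠ ⊤ := (isCompact_closedBall _ _).measure_lt_top.ne
  have : NeZero (volume.restrict A) := ⟨by rwa [Ne, Measure.restrict_eq_zero]⟩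
  have : IsFiniteMeasure (volume.restrict A) := ⟨by simpa using hAt.lt_top⟩
  have hmem := (convex_convexHull ℝ (Set.range f)).closure.average_mem isClosed_closure
    (μ := volume.restrict A) (f := f)
    (.of_forall fun u => subset_closure (subset_convexHull ℝ _ ⟨u, rfl⟩)) hfi
  set e : EuclideanSpace ℝ (Fin n) := EuclideanSpace.single ⟨0, hn⟩ 1
  have he : ‖e‖ = 1 := by simp [e]
  set κ := (volume A).toReal⁻¹ * ∫ u in A, |inner ℝ u e| with hκ
  have hκ0 : 0 < κ := mul_pos (inv_pos.2 (ENNReal.toReal_pos hA0 hAt))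
    (setIntegral_abs_inner_pos (by rintro h; rw [h] at he; simp at he))
  have hval : ∀ v : S, (⨍ u in A, f u) v = κ := by
    intro v
    rw [average_eq, ContinuousMap.smul_apply, hκ, smul_eq_mul]
    congr 1
    · simp [Measure.real]
    · rw [← ContinuousMap.evalCLM_apply ℝ v, ← ContinuousLinearMap.integral_comp_comm _ hfi]
      exact setIntegral_abs_inner_eq (by rw [he]; simp)
  set c := (a + b) / 2 / κ with hc
  have hc0 : 0 < c := div_pos (by linarith) hκ0
  obtain ⟨g, hg, hgd⟩ := Metric.mem_closure_iff.1 hmem ((b - a) / 2 / c) (by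
    have hba : 0 < b - a := by linarith
    exact div_pos (half_pos hba) hc0)
  obtain ⟨ι, _, w, z, hw, -, hz, rfl⟩ := mem_convexHull_iff_exists_fintype.1 hg
  choose y hy using hz
  have unit : ∀ v : S, abs (κ - ∑ i, w i * abs (inner ℝ (y i) (v : EuclideanSpace ℝ (Fin n)))) < (b - a) / 2 / c := by
    intro v
    have h1 := (ContinuousMap.dist_apply_le_dist v).trans_lt hgd
    rw [hval, Real.dist_eq] at h1
    have h2 : (∑ i, w i • z i : C(S, ℝ)) v = ∑ i, w i * |inner ℝ (y i) (v : EuclideanSpace ℝ (Fin n))| := by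
      rw [ContinuousMap.sum_apply]
      refine Finset.sum_congr rfl fun i _ => ?_
      rw [← hy]; rfl
    rwa [h2] at h1
  refine ⟨Fintype.card ι, fun j => (c * w ((Fintype.equivFin ι).symm j)) •
    y ((Fintype.equivFin ι).symm j), fun v => ?_⟩
  have hsum : ∀ v, ∑ j, |inner ℝ ((c * w ((Fintype.equivFin ι).symm j)) •
      y ((Fintype.equivFin ι).symm j)) v| = c * ∑ i, w i * |inner ℝ (y i) v| := by
    intro v
    rw [Finset.mul_sum, Equiv.sum_comp (Fintype.equivFin ι).symm
      (fun i => |inner ℝ ((c * w i) • y i) v|)]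
    refine Finset.sum_congr rfl fun i _ => ?_
    rw [inner_smul_left, abs_mul]
    simp [abs_of_pos hc0, abs_of_nonneg (hw i), mul_assoc]
  rw [hsum]
  rcases eq_or_ne v 0 with rfl | hv
  · simp
  have hv0 : 0 < ‖v‖ := norm_pos_iff.2 hv
  have h1 := unit ⟨‖v‖⁻¹ • v, by simp [S, norm_smul, hv0.ne']⟩
  have h2 : ∑ i, w i * |inner ℝ (y i) (‖v‖⁻¹ • v)| = ‖v‖⁻¹ * ∑ i, w i * |inner ℝ (y i) v| := by
    rw [Finset.mul_sum]
    refine Finset.sum_congr rfl fun i _ => ?_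
    rw [inner_smul_right, abs_mul, abs_of_pos (inv_pos.2 hv0)]; ring
  simp only [h2] at h1
  set s := ∑ i, w i * |inner ℝ (y i) v|
  rw [lt_div_iff₀ hc0, ← abs_of_pos hc0, ← abs_mul, abs_lt] at h1
  have h3 : (κ - ‖v‖⁻¹ * s) * c = (a + b) / 2 - c * s / ‖v‖ := by
    rw [hc]; field_simp
  rw [h3] at h1
  constructor
  · rw [← le_div_iff₀ hv0]; linarith
  · rw [← div_le_iff₀ hv0]; linarith

end

section
variable {n : ℕ}

theorem dense_setOf_linearIndependent_subfamily {N : ℕ} (T : Finset (Fin N)) (hT : T.card = n) :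
    Dense {u : Fin N → EuclideanSpace ℝ (Fin n) | LinearIndependent ℝ fun i : T => u i} := by
  rw [Metric.dense_iff]
  intro u r hr
  have e : T ≃ Fin n := Fintype.equivFinOfCardEq (by simpa using hT)
  set A : Matrix (Fin n) (Fin n) ℝ := Matrix.of fun i j => u (e.symm i) j with hA
  obtain ⟨τ, hτ, hτ'⟩ : ∃ τ ∈ Set.Ioo 0 r, ¬ (-A).charpoly.IsRoot τ := by
    have hfin := Polynomial.finite_setOfPred_isRoot (-A).charpoly_monic.ne_zero
    obtain ⟨τ, h1, h2⟩ := (Set.Ioo_infinite hr).exists_notMem_finite hfin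
    exact ⟨τ, h1, h2⟩
  rw [Polynomial.IsRoot, Matrix.eval_charpoly, sub_neg_eq_add] at hτ'
  refine ⟨fun i => if h : i ∈ T then u i + EuclideanSpace.single (e ⟨i, h⟩) τ else u i, ?_, ?_⟩
  · rw [mem_ball, dist_pi_lt_iff hr]
    intro i
    split_ifs with h
    · simpa [dist_eq_norm, abs_of_pos hτ.1] using hτ.2
    · simpa using hr
  · have h1 := Matrix.linearIndependent_rows_of_det_ne_zero hτ'
    have h2 := (h1.map' (WithLp.linearEquiv 2 ℝ (Fin n → ℝ)).symm.toLinearMap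
      (LinearEquiv.ker _)).comp e e.injective
    have h3 : (fun i : T => (fun i => if h : i ∈ T then u i + EuclideanSpace.single (e ⟨i, h⟩) τ
        else u i) (i : Fin N)) = ((WithLp.linearEquiv 2 ℝ (Fin n → ℝ)).symm.toLinearMap ∘
          fun i => ((Matrix.scalar (Fin n)) τ + A) i) ∘ e := by
      funext i
      ext j
      simp [hA, Matrix.diagonal_apply, add_comm, eq_comm]
    rw [Set.mem_ofPred_eq, h3]
    exact h2

theorem dense_setOf_generic (N : ℕ) :
    Dense {u : Fin N → EuclideanSpace ℝ (Fin n) |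
      ∀ T : Finset (Fin N), T.card = n → LinearIndependent ℝ fun i : T => u i} := by
  have := dense_biInter_of_isOpen (S := {T : Finset (Fin N) | T.card = n})
    (f := fun T => {u : Fin N → EuclideanSpace ℝ (Fin n) | LinearIndependent ℝ fun i : T => u i})
    (fun T _ => (isOpen_setOfPred_linearIndependent (𝕜 := ℝ) (E := EuclideanSpace ℝ (Fin n))
      (ι := T)).preimage (f := fun (u : Fin N → EuclideanSpace ℝ (Fin n)) (i : T) => u i)
        (by fun_prop)) (Set.to_countable _) dense_setOf_linearIndependent_subfamily
  convert this using 1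
  ext u
  simp

/-- The Euclidean ball can be approximated from outside by generic zonotopes. -/
theorem exists_generic_zonotope (hn : 1 ≤ n) {ε : ℝ} (hε : 0 < ε) :
    ∃ (N : ℕ) (u : Fin N → EuclideanSpace ℝ (Fin n)), n ≤ N ∧
      (∀ T : Finset (Fin N), T.card = n → LinearIndependent ℝ fun i : T => u i) ∧
      closedBall 0 1 ⊆ zonotopeBody {0} u (fun _ => 1) ∧
      zonotopeBody {0} u (fun _ => 1) ⊆ closedBall 0 (1 + ε) := by
  obtain ⟨N₀, u₀, hu₀⟩ := exists_sum_abs_inner_approx hn (a := 1 + ε / 3) (b := 1 + 2 * ε / 3)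
    (by positivity) (by linarith)
  set N := N₀ + n with hN
  set u₁ : Fin N → EuclideanSpace ℝ (Fin n) := Fin.append u₀ 0 with hu₁
  have hsum₁ : ∀ v, ∑ i, |inner ℝ (u₁ i) v| = ∑ i, |inner ℝ (u₀ i) v| := by
    intro v
    rw [hu₁, Fin.sum_univ_add]
    simp
  have hNpos : (0 : ℝ) < N := by exact_mod_cast (by omega : 0 < N)
  obtain ⟨u, hug, hud⟩ := (dense_setOf_generic (n := n) N).exists_dist_lt u₁
    (ε := ε / 3 / N) (by positivity)
  have hdiff : ∀ v, abs (∑ i, abs (inner ℝ (u i) v) - ∑ i, abs (inner ℝ (u₁ i) v)) ≤ ε / 3 * ‖v‖ := by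
    intro v
    rw [← Finset.sum_sub_distrib]
    refine (Finset.abs_sum_le_sum_abs _ _).trans ?_
    have : ∀ i ∈ Finset.univ, |(|inner ℝ (u i) v| - |inner ℝ (u₁ i) v|)| ≤ ε / 3 / N * ‖v‖ := by
      intro i _
      refine (abs_abs_sub_abs_le_abs_sub _ _).trans ?_
      rw [← inner_sub_left]
      refine (abs_real_inner_le_norm _ _).trans ?_
      gcongr
      rw [← dist_eq_norm, dist_comm]
      exact (dist_le_pi_dist u₁ u i).trans hud.le
    refine (Finset.sum_le_card_nsmul _ _ _ this).trans (le_of_eq ?_)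
    rw [Finset.card_univ, Fintype.card_fin, nsmul_eq_mul]
    field_simp
  have hlow : ∀ v, ‖v‖ ≤ ∑ i, |inner ℝ (u i) v| := by
    intro v
    have h1 := (hu₀ v).1
    have h2 := hdiff v
    rw [hsum₁, abs_le] at h2
    linarith
  have hup : ∀ v, ∑ i, |inner ℝ (u i) v| ≤ (1 + ε) * ‖v‖ := by
    intro v
    have h1 := (hu₀ v).2
    have h2 := hdiff v
    rw [hsum₁, abs_le] at h2
    linarith
  refine ⟨N, u, by omega, hug, fun b hb => ?_, ?_⟩
  · by_contra hcon
    obtain ⟨f, c, hf1, hf2⟩ := geometric_hahn_banach_closed_point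
      ((convex_singleton (0 : EuclideanSpace ℝ (Fin n))).zonotopeBody u fun _ => 1)
      (isCompact_singleton.zonotopeBody u fun _ => 1).isClosed hcon
    obtain ⟨v, rfl⟩ := (InnerProductSpace.toDual ℝ (EuclideanSpace ℝ (Fin n))).surjective f
    simp only [InnerProductSpace.toDual_apply_apply] at hf1 hf2
    have h1 := hf1 (0 + ∑ i, (SignType.sign (inner ℝ (u i) v) : ℝ) • u i)
      ⟨0, rfl, fun i => (SignType.sign (inner ℝ (u i) v) : ℝ), fun i => by
        rcases lt_trichotomy (inner ℝ (u i) v) 0 with h | h | h <;> simp [h], rfl⟩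
    have h2 : inner ℝ v (0 + ∑ i, (SignType.sign (inner ℝ (u i) v) : ℝ) • u i) =
        ∑ i, |inner ℝ (u i) v| := by
      rw [zero_add, inner_sum]
      refine Finset.sum_congr rfl fun i _ => ?_
      rw [inner_smul_right, real_inner_comm, sign_mul_self]
    rw [h2] at h1
    have h3 := real_inner_le_norm v b
    have h4 : ‖v‖ * ‖b‖ ≤ ‖v‖ * 1 := by
      gcongr
      simpa using hb
    linarith [hlow v]
  · rintro _ ⟨p, rfl, s, hs, rfl⟩
    rw [zero_add, mem_closedBall_zero_iff]
    set z := ∑ i, s i • u i with hz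
    have h1 : ‖z‖ * ‖z‖ ≤ (1 + ε) * ‖z‖ := by
      refine le_trans ?_ (hup z)
      rw [← real_inner_self_eq_norm_mul_norm]
      conv_lhs => rw [hz, sum_inner]
      refine Finset.sum_le_sum fun i _ => ?_
      rw [inner_smul_left]
      refine (le_abs_self _).trans ?_
      rw [abs_mul]
      exact mul_le_of_le_one_left (abs_nonneg _) (by simpa using hs i)
    rcases (norm_nonneg z).eq_or_lt with h | h
    · rw [← h]; positivity
    · exact le_of_mul_le_mul_right h1 h

end

theorem Polynomial.exists_aeval_eq_sum_eval (n : ℕ) (w : ℂ) : ∃ c : ℕ → ℂ,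
    ∀ P : Polynomial ℝ, P.natDegree ≤ n →
      Polynomial.aeval w P = ∑ j ∈ Finset.range (n + 1), ((P.eval (j : ℝ) : ℝ) : ℂ) * c j := by
  have hinj : Set.InjOn (fun j : ℕ => (j : ℝ)) (Finset.range (n + 1)) :=
    Nat.cast_injective.injOn
  refine ⟨fun j => Polynomial.aeval w (Lagrange.basis (F := ℝ) (Finset.range (n + 1)) (fun j : ℕ => (j : ℝ)) j),
    fun P hP => ?_⟩
  conv_lhs => rw [Lagrange.eq_interpolate hinj (f := P) (by
    rw [Finset.card_range]
    exact (Polynomial.degree_le_of_natDegree_le hP).trans_lt (by exact_mod_cast Nat.lt_succ_self n))]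
  simp [Lagrange.interpolate_apply, map_sum]

section
variable {n : ℕ}

theorem add_add_smul_closedBall (M : Set (EuclideanSpace ℝ (Fin n))) {s t : ℝ} (hs : 0 ≤ s)
    (ht : 0 ≤ t) : M + s • closedBall (0 : EuclideanSpace ℝ (Fin n)) 1 + t • closedBall 0 1 =
      M + (s + t) • closedBall 0 1 := by
  rw [(convex_closedBall _ _).add_smul hs ht, add_assoc]

theorem add_smul_subset_zonotopeBody {N : ℕ} (M : Set (EuclideanSpace ℝ (Fin n)))
    {u : Fin N → EuclideanSpace ℝ (Fin n)}
    (hu : closedBall 0 1 ⊆ zonotopeBody {0} u (fun _ => 1)) {t : ℝ} (ht : 0 ≤ t) :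
    M + t • closedBall 0 1 ⊆ zonotopeBody M u fun _ => t := by
  rintro _ ⟨p, hp, _, ⟨b, hb, rfl⟩, rfl⟩
  obtain ⟨q, rfl, s, hs, rfl⟩ := hu hb
  refine ⟨p, hp, fun i => t * s i, fun i => ?_, ?_⟩
  · rw [abs_mul, abs_of_nonneg ht]
    have := hs i
    nlinarith
  · simp [Finset.smul_sum, mul_smul]

theorem zonotopeBody_subset_add_smul {N : ℕ} (M : Set (EuclideanSpace ℝ (Fin n)))
    {u : Fin N → EuclideanSpace ℝ (Fin n)} {r : ℝ} (hr : 0 ≤ r)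
    (hu : zonotopeBody {0} u (fun _ => 1) ⊆ closedBall 0 r) {t : ℝ} (ht : 0 ≤ t) :
    zonotopeBody M u (fun _ => t) ⊆ M + (t * r) • closedBall 0 1 := by
  rintro _ ⟨p, hp, s, hs, rfl⟩
  refine Set.add_mem_add hp ?_
  rcases ht.eq_or_lt with rfl | ht0
  · have : ∀ i, s i = 0 := fun i => by simpa using hs i
    simp only [this, zero_smul, Finset.sum_const_zero, zero_mul]
    exact ⟨0, by simp, by simp⟩
  have h1 : ∑ i, (t⁻¹ * s i) • u i ∈ closedBall (0 : EuclideanSpace ℝ (Fin n)) r :=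
    hu ⟨0, rfl, fun i => t⁻¹ * s i, fun i => by
      rw [abs_mul, abs_of_pos (inv_pos.2 ht0)]
      have := hs i
      rw [inv_mul_le_iff₀ ht0, mul_one]
      exact this, by simp⟩
  rw [mul_smul, _root_.smul_closedBall _ _ zero_le_one]
  refine ⟨_, by simpa [abs_of_nonneg hr] using h1, ?_⟩
  simp [Finset.smul_sum, smul_smul, ht0.ne']

open Filter Topology in
/-- Steiner polynomials are stable in dimension at most five. -/
theorem re_nonpos_of_steiner_root (hn1 : 1 ≤ n) (hn5 : n ≤ 5)
    {M : Set (EuclideanSpace ℝ (Fin n))} (hMn : M.Nonempty) (hM : IsCompact M)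
    (hMc : Convex ℝ M) {Q : Polynomial ℝ} (hQn : Q.natDegree ≤ n)
    (hQ : ∀ t, 0 < t → Q.eval t = (volume (M + t • closedBall 0 1)).toReal)
    {z : ℂ} (hz : Polynomial.aeval z Q = 0) : z.re ≤ 0 := by
  by_contra! hzr
  set s := z.re / 2 with hs
  have hs0 : 0 < s := by positivity
  set B := closedBall (0 : EuclideanSpace ℝ (Fin n)) 1 with hB
  have hBc : IsCompact B := isCompact_closedBall _ _
  set M₁ := M + s • B with hM₁
  have hM₁c : IsCompact M₁ := hM.add (hBc.smul s)
  have hM₁v : Convex ℝ M₁ := hMc.add ((convex_closedBall _ _).smul s)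
  have hM₁i : (interior M₁).Nonempty := by
    obtain ⟨p, hp⟩ := hMn
    refine ⟨p, ?_⟩
    rw [mem_interior_iff_mem_nhds]
    filter_upwards [ball_mem_nhds p hs0] with x hx
    refine ⟨p, hp, x - p, ?_, by simp⟩
    rw [hB, _root_.smul_closedBall _ _ zero_le_one, mem_closedBall, smul_zero, dist_zero_right, mul_one,
      Real.norm_of_nonneg hs0.le, ← dist_eq_norm]
    exact (mem_ball.1 hx).le
  have approx : ∀ k : ℕ, ∃ P : Polynomial ℝ, P.natDegree ≤ n ∧
      (∀ t, 0 ≤ t → Q.eval (s + t) ≤ P.eval t ∧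
        P.eval t ≤ Q.eval (s + t * (1 + 1 / ((k : ℝ) + 1)))) ∧
      (volume B).toReal * s ^ n ≤ ‖Polynomial.aeval (z - s) P‖ := by
    intro k
    have hk : (0 : ℝ) < 1 / ((k : ℝ) + 1) := by positivity
    obtain ⟨N, u, hN, hug, hu1, hu2⟩ := exists_generic_zonotope hn1 hk
    obtain ⟨P, hPn, hPe, hPs⟩ := exists_stable_zonotope_polynomial hn1 hn5 hM₁c hM₁v hM₁i hug
      (by simpa using hN) hu1
    refine ⟨P, hPn, fun t ht => ?_, ?_⟩
    · rw [hPe t ht, hQ _ (by positivity), hQ _ (by positivity),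
        ← add_add_smul_closedBall M hs0.le ht, ← add_add_smul_closedBall M hs0.le (by positivity)]
      exact ⟨ENNReal.toReal_mono (hM₁c.zonotopeBody u _).measure_lt_top.ne
          (measure_mono (add_smul_subset_zonotopeBody _ hu1 ht)),
        ENNReal.toReal_mono (hM₁c.add (hBc.smul _)).measure_lt_top.ne
          (measure_mono (zonotopeBody_subset_add_smul _ (by positivity) hu2 ht))⟩
    · have := hPs (z - s) (by simp; linarith)
      have h2 : (z - s).re = s := by simp; linarith
      rwa [h2] at this
  choose P hPn hPe hPs using approx
  set Q₁ := Q.comp (Polynomial.X + Polynomial.C s) with hQ₁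
  have hQ₁n : Q₁.natDegree ≤ n := by
    rw [hQ₁, Polynomial.natDegree_comp, Polynomial.natDegree_X_add_C, mul_one]
    exact hQn
  have hQ₁z : Polynomial.aeval (z - s) Q₁ = 0 := by
    rw [hQ₁, Polynomial.aeval_comp]
    simp [hz]
  have lim : ∀ t : ℝ, 0 ≤ t → Tendsto (fun k => (P k).eval t) atTop (𝓝 (Q₁.eval t)) := by
    intro t ht
    have e : Q₁.eval t = Q.eval (s + t) := by simp [hQ₁, add_comm]
    rw [e]
    refine tendsto_of_tendsto_of_tendsto_of_le_of_le tendsto_const_nhds ?_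
      (fun k => (hPe k t ht).1) (fun k => (hPe k t ht).2)
    have h1 : Tendsto (fun k : ℕ => s + t * (1 + 1 / ((k : ℝ) + 1))) atTop
        (𝓝 (s + t * (1 + 0))) :=
      ((tendsto_one_div_add_atTop_nhds_zero_nat.const_add 1).const_mul t).const_add s
    rw [add_zero, mul_one] at h1
    exact (Q.continuous.tendsto _).comp h1
  obtain ⟨c, hc⟩ := Polynomial.exists_aeval_eq_sum_eval n (z - s)
  have lim2 : Tendsto (fun k => Polynomial.aeval (z - (s : ℂ)) (P k)) atTop
      (𝓝 (Polynomial.aeval (z - (s : ℂ)) Q₁)) := by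
    rw [hc Q₁ hQ₁n]
    simp_rw [fun k => hc (P k) (hPn k)]
    exact tendsto_finsetSum _ fun j _ =>
      ((Complex.continuous_ofReal.tendsto _).comp (lim j (by positivity))).mul_const _
  have := ge_of_tendsto' lim2.norm hPs
  rw [hQ₁z, norm_zero] at this
  have hpos : 0 < (volume B).toReal :=
    ENNReal.toReal_pos (measure_closedBall_pos _ _ one_pos).ne' hBc.measure_lt_top.ne
  have : 0 < (volume B).toReal * s ^ n := by positivity
  linarith

end

section
variable {n : ℕ}
local notation "𝔼" => EuclideanSpace ℝ (Fin n)
open scoped InnerProductSpace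

/-- A Lipschitz monotone map into `S` which asymptotically selects support points of `S`. -/
structure MonotoneSelection (p : 𝔼 → 𝔼) (S : Set 𝔼) : Prop where
  mem : ∀ x, p x ∈ S
  lip : ∃ L, LipschitzWith L p
  mono : ∀ x y, 0 ≤ ⟪p x - p y, x - y⟫_ℝ
  supp : ∃ C : ℝ, ∀ x, ∀ k ∈ S, ⟪x, k⟫_ℝ - C ≤ ⟪x, p x⟫_ℝ

theorem MonotoneSelection.add {p q : 𝔼 → 𝔼} {S T : Set 𝔼} (hp : MonotoneSelection p S)
    (hq : MonotoneSelection q T) : MonotoneSelection (fun x => p x + q x) (S + T) where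
  mem x := Set.add_mem_add (hp.mem x) (hq.mem x)
  lip := by
    obtain ⟨L, hL⟩ := hp.lip
    obtain ⟨L', hL'⟩ := hq.lip
    exact ⟨_, hL.add hL'⟩
  mono x y := by
    have := add_nonneg (hp.mono x y) (hq.mono x y)
    rw [← inner_add_left] at this
    rwa [add_sub_add_comm]
  supp := by
    obtain ⟨C, hC⟩ := hp.supp
    obtain ⟨D, hD⟩ := hq.supp
    refine ⟨C + D, fun x k hk => ?_⟩
    obtain ⟨a, ha, b, hb, rfl⟩ := hk
    have := hC x a ha
    have := hD x b hb
    simp only [inner_add_right]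
    linarith

theorem MonotoneSelection.smul {p : 𝔼 → 𝔼} {S : Set 𝔼} (hp : MonotoneSelection p S) {r : ℝ}
    (hr : 0 ≤ r) : MonotoneSelection (fun x => r • p x) (r • S) where
  mem x := Set.smul_mem_smul_set (hp.mem x)
  lip := by
    obtain ⟨L, hL⟩ := hp.lip
    exact ⟨_, (lipschitzWith_smul r).comp hL⟩
  mono x y := by
    rw [← smul_sub, real_inner_smul_left]
    exact mul_nonneg hr (hp.mono x y)
  supp := by
    obtain ⟨C, hC⟩ := hp.supp
    refine ⟨r * C, fun x k hk => ?_⟩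
    obtain ⟨a, ha, rfl⟩ := hk
    have := mul_le_mul_of_nonneg_left (hC x a ha) hr
    simp only [real_inner_smul_right]
    linarith

/-- The metric projection onto a convex body. -/
theorem exists_monotoneSelection {K : Set 𝔼} (hKn : K.Nonempty) (hK : IsCompact K)
    (hKc : Convex ℝ K) : ∃ p, MonotoneSelection p K := by
  have h : ∀ x : 𝔼, ∃ v ∈ K, ∀ w ∈ K, ⟪x - v, w - v⟫_ℝ ≤ 0 := by
    intro x
    obtain ⟨v, hv, hv2⟩ := exists_norm_eq_iInf_of_complete_convex hKn hK.isComplete hKc x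
    exact ⟨v, hv, (norm_eq_iInf_iff_real_inner_le_zero hKc hv).1 hv2⟩
  choose p hp hp2 using h
  have firm : ∀ x y, ‖p x - p y‖ ^ 2 ≤ ⟪p x - p y, x - y⟫_ℝ := by
    intro x y
    have h1 := hp2 x (p y) (hp y)
    have h2 := hp2 y (p x) (hp x)
    have : ⟪p x - p y, x - y⟫_ℝ - ⟪p x - p y, p x - p y⟫_ℝ =
        -⟪x - p x, p y - p x⟫_ℝ - ⟪y - p y, p x - p y⟫_ℝ := by
      simp only [inner_sub_left, inner_sub_right]
      rw [real_inner_comm x (p x), real_inner_comm x (p y), real_inner_comm y (p x),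
        real_inner_comm y (p y)]
      ring
    rw [real_inner_self_eq_norm_sq] at this
    linarith
  refine ⟨p, hp, ⟨1, LipschitzWith.of_dist_le_mul fun x y => ?_⟩,
    fun x y => (sq_nonneg _).trans (firm x y), ?_⟩
  · rw [NNReal.coe_one, one_mul, dist_eq_norm, dist_eq_norm]
    have h1 := firm x y
    have h2 := real_inner_le_norm (p x - p y) (x - y)
    by_contra! h3
    have : 0 ≤ ‖x - y‖ := norm_nonneg _
    nlinarith
  · obtain ⟨R, hR⟩ := hK.isBounded.exists_norm_le
    refine ⟨R * R, fun x k hk => ?_⟩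
    have h1 := hp2 x k hk
    have h2 := real_inner_le_norm (p x) k
    have h3 : ‖p x‖ * ‖k‖ ≤ R * R := by
      have := hR _ hk
      have := hR _ (hp x)
      have := norm_nonneg (p x)
      exact mul_le_mul ‹_› ‹_› (norm_nonneg _) (by linarith)
    have h4 : (0 : ℝ) ≤ ⟪p x, p x⟫_ℝ := real_inner_self_nonneg
    rw [inner_sub_left, inner_sub_right, inner_sub_right] at h1
    linarith

/-- The radial map `x ↦ x / (1 + ‖x‖)` onto the open unit ball. -/
noncomputable def radialContraction (x : 𝔼) : 𝔼 := (1 + ‖x‖)⁻¹ • x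

theorem inner_radialContraction_sub_pos {x y : 𝔼} (hxy : x ≠ y) :
    0 < ⟪radialContraction x - radialContraction y, x - y⟫_ℝ := by
  unfold radialContraction
  set a := ‖x‖ with ha
  set c := ‖y‖ with hc
  have ha0 : 0 ≤ a := norm_nonneg _
  have hc0 : 0 ≤ c := norm_nonneg _
  have e : ⟪(1 + a)⁻¹ • x - (1 + c)⁻¹ • y, x - y⟫_ℝ =
      (1 + a)⁻¹ * a ^ 2 + (1 + c)⁻¹ * c ^ 2 - ((1 + a)⁻¹ + (1 + c)⁻¹) * ⟪x, y⟫_ℝ := by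
    simp only [inner_sub_left, inner_sub_right, real_inner_smul_left, real_inner_self_eq_norm_sq,
      real_inner_comm x y]
    rw [ha, hc]
    ring
  rw [e]
  have hf : 0 < (1 + a)⁻¹ := by positivity
  have hg : 0 < (1 + c)⁻¹ := by positivity
  have h1 : ⟪x, y⟫_ℝ ≤ a * c := real_inner_le_norm x y
  have h2 : (1 + a)⁻¹ * a ^ 2 + (1 + c)⁻¹ * c ^ 2 - ((1 + a)⁻¹ + (1 + c)⁻¹) * (a * c) =
      (a - c) ^ 2 * ((1 + a)⁻¹ * (1 + c)⁻¹) := by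
    field_simp
    ring
  by_cases hac : a = c
  · have h3 : ⟪x, y⟫_ℝ < a * c := by
      refine lt_of_le_of_ne h1 fun h => hxy ?_
      have : ‖x - y‖ ^ 2 = 0 := by
        rw [norm_sub_sq_real, h, ← ha, ← hc, hac]
        ring
      exact sub_eq_zero.1 (norm_eq_zero.1 (pow_eq_zero_iff two_ne_zero |>.1 this))
    rw [hac, sub_self, zero_pow two_ne_zero, zero_mul] at h2
    rw [hac] at h3 hf ⊢
    nlinarith
  · have : 0 < (a - c) ^ 2 * ((1 + a)⁻¹ * (1 + c)⁻¹) := by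
      have := sub_ne_zero.2 hac
      positivity
    nlinarith [mul_nonneg (add_pos hf hg).le (sub_nonneg.2 h1)]

theorem monotoneSelection_radialContraction :
    MonotoneSelection (radialContraction (n := n)) (closedBall 0 1) where
  mem x := by
    have := norm_nonneg x
    rw [mem_closedBall_zero_iff, radialContraction, norm_smul, norm_inv,
      Real.norm_of_nonneg (by positivity), inv_mul_le_iff₀ (by positivity)]
    linarith
  lip := by
    refine ⟨2, LipschitzWith.of_dist_le_mul fun x y => ?_⟩
    rw [dist_eq_norm, dist_eq_norm]
    have hx := norm_nonneg x
    have hy := norm_nonneg y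
    have e : radialContraction x - radialContraction y =
        (1 + ‖x‖)⁻¹ • (x - y) + ((1 + ‖x‖)⁻¹ * (1 + ‖y‖)⁻¹ * (‖y‖ - ‖x‖)) • y := by
      have : (1 + ‖x‖)⁻¹ * (1 + ‖y‖)⁻¹ * (‖y‖ - ‖x‖) = (1 + ‖x‖)⁻¹ - (1 + ‖y‖)⁻¹ := by
        field_simp
        ring
      rw [this, radialContraction, radialContraction]
      module
    rw [e]
    have h1 : (1 + ‖x‖)⁻¹ ≤ 1 := inv_le_one_of_one_le₀ (by linarith)
    have h2 : (1 + ‖y‖)⁻¹ * ‖y‖ ≤ 1 := by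
      rw [inv_mul_le_iff₀ (by positivity)]
      linarith
    have h3 : abs (‖y‖ - ‖x‖) ≤ ‖x - y‖ := by
      rw [norm_sub_rev]
      exact abs_norm_sub_norm_le y x
    have hf : 0 ≤ (1 + ‖x‖)⁻¹ := by positivity
    have hg : 0 ≤ (1 + ‖y‖)⁻¹ * ‖y‖ := by positivity
    calc _ ≤ ‖(1 + ‖x‖)⁻¹ • (x - y)‖ + ‖((1 + ‖x‖)⁻¹ * (1 + ‖y‖)⁻¹ * (‖y‖ - ‖x‖)) • y‖ :=
          norm_add_le _ _
      _ = (1 + ‖x‖)⁻¹ * ‖x - y‖ +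
          (1 + ‖x‖)⁻¹ * ((1 + ‖y‖)⁻¹ * ‖y‖) * abs (‖y‖ - ‖x‖) := by
        rw [norm_smul, norm_smul, norm_mul, norm_mul, Real.norm_of_nonneg hf,
          Real.norm_of_nonneg (show 0 ≤ (1 + ‖y‖)⁻¹ by positivity), Real.norm_eq_abs]
        ring
      _ ≤ 1 * ‖x - y‖ + 1 * 1 * ‖x - y‖ := by gcongr
      _ = _ := by
        push_cast
        ring
  mono x y := by
    rcases eq_or_ne x y with rfl | h
    · simp
    · exact (inner_radialContraction_sub_pos h).le
  supp := by
    refine ⟨1, fun x k hk => ?_⟩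
    rw [mem_closedBall_zero_iff] at hk
    have hx := norm_nonneg x
    have h1 : ⟪x, k⟫_ℝ ≤ ‖x‖ := (real_inner_le_norm x k).trans (by nlinarith)
    have h2 : ‖x‖ - 1 ≤ (1 + ‖x‖)⁻¹ * ‖x‖ ^ 2 := by
      rw [← div_eq_inv_mul, le_div_iff₀ (by positivity)]
      nlinarith
    rw [radialContraction, real_inner_smul_right, real_inner_self_eq_norm_sq]
    linarith

theorem LipschitzWith.volume_image_eq_zero {f : 𝔼 → 𝔼} {L : NNReal} (hf : LipschitzWith L f)
    {s : Set 𝔼} (hs : volume s = 0) : volume (f '' s) = 0 := by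
  set μ : Measure 𝔼 := Measure.hausdorffMeasure (Module.finrank ℝ 𝔼) with hμ
  have h1 := Measure.isAddLeftInvariant_eq_smul (volume : Measure 𝔼) μ
  have h2 := Measure.isAddLeftInvariant_eq_smul μ (volume : Measure 𝔼)
  have h3 : μ s = 0 := by rw [h2]; simp [hs]
  have h4 := hf.hausdorffMeasure_image_le (d := Module.finrank ℝ 𝔼) (by positivity) s
  rw [← hμ, h3, mul_zero] at h4
  rw [h1]
  simp [nonpos_iff_eq_zero.1 h4]

/-- Strongly monotone Lipschitz maps are onto. -/
theorem exists_add_smul_eq {p : 𝔼 → 𝔼} {L : NNReal} (hL : LipschitzWith L p)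
    (hp : ∀ x y, 0 ≤ ⟪p x - p y, x - y⟫_ℝ) {ε : ℝ} (hε : 0 < ε) (y : 𝔼) :
    ∃ x, ε • x + p x = y := by
  set A : ℝ := ε + L + 1 with hA
  have hA0 : 0 < A := by positivity
  set r : ℝ := ε / A ^ 2 with hr
  have hr0 : 0 < r := by positivity
  have hεA : ε < A := by
    have : (0 : ℝ) ≤ L := L.2
    linarith
  set T : 𝔼 → 𝔼 := fun x => x - r • (ε • x + p x - y) with hT
  have hq : 0 ≤ 1 - ε ^ 2 / A ^ 2 := by
    rw [sub_nonneg, div_le_one (by positivity)]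
    gcongr
  have key : ∀ a b, ‖T a - T b‖ ^ 2 ≤ (1 - ε ^ 2 / A ^ 2) * ‖a - b‖ ^ 2 := by
    intro a b
    have e : T a - T b = (a - b) - r • (ε • (a - b) + (p a - p b)) := by
      simp only [hT]
      module
    have h1 : ‖p a - p b‖ ≤ L * ‖a - b‖ := by
      simpa [dist_eq_norm] using hL.dist_le_mul a b
    have h2 : ‖ε • (a - b) + (p a - p b)‖ ≤ A * ‖a - b‖ := by
      refine (norm_add_le _ _).trans ?_
      rw [norm_smul, Real.norm_of_nonneg hε.le, hA]
      nlinarith [norm_nonneg (a - b)]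
    have h3 := hp a b
    have h4 : ‖ε • (a - b) + (p a - p b)‖ ^ 2 ≤ A ^ 2 * ‖a - b‖ ^ 2 := by
      rw [← mul_pow]
      gcongr
    rw [e, norm_sub_sq_real, real_inner_smul_right, inner_add_right, real_inner_smul_right,
      real_inner_self_eq_norm_sq, norm_smul, mul_pow, Real.norm_of_nonneg hr0.le,
      real_inner_comm]
    have h5 : r ^ 2 * ‖ε • (a - b) + (p a - p b)‖ ^ 2 ≤ r ^ 2 * (A ^ 2 * ‖a - b‖ ^ 2) := by
      gcongr
    have h6 : r ^ 2 * (A ^ 2 * ‖a - b‖ ^ 2) = ε ^ 2 / A ^ 2 * ‖a - b‖ ^ 2 := by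
      rw [hr]; field_simp
    have h7 : r * ε = ε ^ 2 / A ^ 2 := by rw [hr]; ring
    have h8 := mul_nonneg hr0.le h3
    have h9 : r * (ε * ‖a - b‖ ^ 2) = ε ^ 2 / A ^ 2 * ‖a - b‖ ^ 2 := by rw [← h7]; ring
    nlinarith
  have hC : ContractingWith (Real.toNNReal (Real.sqrt (1 - ε ^ 2 / A ^ 2))) T := by
    refine ⟨?_, LipschitzWith.of_dist_le_mul fun a b => ?_⟩
    · rw [← NNReal.coe_lt_coe, Real.coe_toNNReal _ (Real.sqrt_nonneg _), NNReal.coe_one,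
        Real.sqrt_lt' one_pos]
      have : 0 < ε ^ 2 / A ^ 2 := by positivity
      linarith
    · rw [Real.coe_toNNReal _ (Real.sqrt_nonneg _), dist_eq_norm, dist_eq_norm]
      refine le_of_sq_le_sq ?_ (by positivity)
      rw [mul_pow, Real.sq_sqrt hq]
      exact key a b
  have hfix := hC.fixedPoint_isFixedPt
  set x := ContractingWith.fixedPoint T hC
  refine ⟨x, ?_⟩
  have : x - r • (ε • x + p x - y) = x := hfix
  rw [sub_eq_self, smul_eq_zero, or_iff_right hr0.ne', sub_eq_zero] at this
  exact this

open Filter Topology in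
theorem MonotoneSelection.interior_subset_range {p : 𝔼 → 𝔼} {S : Set 𝔼}
    (hp : MonotoneSelection p S) : interior S ⊆ Set.range p := by
  intro y hy
  obtain ⟨L, hL⟩ := hp.lip
  obtain ⟨C, hC⟩ := hp.supp
  obtain ⟨δ, hδ, hball⟩ := Metric.mem_nhds_iff.1 (mem_interior_iff_mem_nhds.1 hy)
  choose x hx using fun k : ℕ =>
    exists_add_smul_eq hL hp.mono (ε := 1 / ((k : ℝ) + 1)) (by positivity) y
  have bdd : ∀ k, x k ∈ closedBall (0 : 𝔼) (2 * C / δ) := by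
    intro k
    rw [mem_closedBall_zero_iff]
    rcases eq_or_ne (x k) 0 with h0 | h0
    · have h1 := hC (x k) y (hball (mem_ball_self hδ))
      rw [h0, inner_zero_left, inner_zero_left] at h1
      rw [h0, norm_zero]
      have : 0 ≤ C := by linarith
      positivity
    have hn : 0 < ‖x k‖ := norm_pos_iff.2 h0
    have hm : y + (δ / 2 * ‖x k‖⁻¹) • x k ∈ S := by
      refine hball ?_
      rw [mem_ball, dist_eq_norm, add_sub_cancel_left, norm_smul, Real.norm_of_nonneg (by positivity),
        mul_assoc, inv_mul_cancel₀ hn.ne']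
      linarith
    have h1 := hC (x k) _ hm
    have h2 : ⟪x k, y⟫_ℝ = 1 / ((k : ℝ) + 1) * ‖x k‖ ^ 2 + ⟪x k, p (x k)⟫_ℝ := by
      conv_lhs => rw [← hx k]
      rw [inner_add_right, real_inner_smul_right, real_inner_self_eq_norm_sq]
    rw [inner_add_right, real_inner_smul_right, real_inner_self_eq_norm_sq] at h1
    have h3 : 0 ≤ 1 / ((k : ℝ) + 1) * ‖x k‖ ^ 2 := by positivity
    have h4 : δ / 2 * ‖x k‖⁻¹ * ‖x k‖ ^ 2 = δ / 2 * ‖x k‖ := by field_simp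
    rw [le_div_iff₀ hδ]
    linarith
  obtain ⟨a, -, φ, hφ, hlim⟩ := (isCompact_closedBall _ _).tendsto_subseq bdd
  refine ⟨a, ?_⟩
  have h1 : Tendsto (fun k => (1 / (((φ k : ℕ) : ℝ) + 1)) • x (φ k) + p (x (φ k))) atTop
      (𝓝 ((0 : ℝ) • a + p a)) :=
    ((tendsto_one_div_add_atTop_nhds_zero_nat.comp hφ.tendsto_atTop).smul hlim).add
      ((hL.continuous.tendsto a).comp hlim)
  simp_rw [hx] at h1
  rw [zero_smul, zero_add] at h1
  exact (tendsto_nhds_unique h1 tendsto_const_nhds)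

theorem LinearMap.det_nonneg_of_inner_nonneg {A : 𝔼 →L[ℝ] 𝔼} (hA : ∀ h, 0 ≤ ⟪A h, h⟫_ℝ) :
    0 ≤ A.det := by
  by_contra! hneg
  set f : ℝ → ℝ := fun θ => ((1 - θ) • ContinuousLinearMap.id ℝ 𝔼 + θ • A).det with hf
  have hcont : Continuous f :=
    ContinuousLinearMap.continuous_det.comp (by fun_prop)
  have h0 : f 0 = 1 := by
    have : (1 - (0 : ℝ)) • ContinuousLinearMap.id ℝ 𝔼 + (0 : ℝ) • A = ContinuousLinearMap.id ℝ 𝔼 := by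
      ext v : 1
      simp
    simp only [hf, this]
    simp [ContinuousLinearMap.det]
  have h1 : f 1 = A.det := by
    have : (1 - (1 : ℝ)) • ContinuousLinearMap.id ℝ 𝔼 + (1 : ℝ) • A = A := by
      ext v : 1
      simp
    simp only [hf, this]
  obtain ⟨θ, ⟨hθ0, hθ1⟩, hθ⟩ : (0 : ℝ) ∈ f '' Set.Icc 0 1 :=
    intermediate_value_Icc' zero_le_one hcont.continuousOn ⟨by rw [h1]; exact hneg.le, by
      rw [h0]; exact zero_le_one⟩
  have hθ1' : θ < 1 := by
    refine lt_of_le_of_ne hθ1 fun h => ?_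
    rw [h, h1] at hθ
    exact hneg.ne hθ
  have hker : ∃ v, v ≠ 0 ∧ ((1 - θ) • ContinuousLinearMap.id ℝ 𝔼 + θ • A) v = 0 := by
    have := LinearMap.bot_lt_ker_of_det_eq_zero (f := (((1 - θ) • ContinuousLinearMap.id ℝ 𝔼 + θ • A :
      𝔼 →L[ℝ] 𝔼) : 𝔼 →ₗ[ℝ] 𝔼)) hθ
    obtain ⟨v, hv, hv0⟩ := (Submodule.ne_bot_iff _).1 this.ne'
    exact ⟨v, hv0, hv⟩
  obtain ⟨v, hv0, hv⟩ := hker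
  have h2 : ⟪((1 - θ) • ContinuousLinearMap.id ℝ 𝔼 + θ • A) v, v⟫_ℝ =
      (1 - θ) * ‖v‖ ^ 2 + θ * ⟪A v, v⟫_ℝ := by
    simp [inner_add_left, real_inner_smul_left]
  rw [hv, inner_zero_left] at h2
  have h3 : 0 < (1 - θ) * ‖v‖ ^ 2 := by
    have := norm_pos_iff.2 hv0
    have := sub_pos.2 hθ1'
    positivity
  have h4 := mul_nonneg hθ0 (hA v)
  linarith

open Filter Topology in
theorem inner_fderiv_nonneg {p : 𝔼 → 𝔼} (hp : ∀ x y, 0 ≤ ⟪p x - p y, x - y⟫_ℝ) {x : 𝔼}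
    {A : 𝔼 →L[ℝ] 𝔼} (hA : HasFDerivAt p A x) (h : 𝔼) : 0 ≤ ⟪A h, h⟫_ℝ := by
  have h1 := hA.lim_real h
  have h2 : Tendsto (fun c : ℝ => ⟪c • (p (x + c⁻¹ • h) - p x), h⟫_ℝ) atTop (𝓝 ⟪A h, h⟫_ℝ) :=
    h1.inner tendsto_const_nhds
  refine ge_of_tendsto h2 ?_
  filter_upwards [eventually_gt_atTop 0] with c hc
  have h3 := hp (x + c⁻¹ • h) x
  rw [add_sub_cancel_left, real_inner_smul_right] at h3
  have h4 := mul_nonneg (mul_nonneg hc.le hc.le) h3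
  have h5 : c * c * (c⁻¹ * ⟪p (x + c⁻¹ • h) - p x, h⟫_ℝ) = c * ⟪p (x + c⁻¹ • h) - p x, h⟫_ℝ := by
    field_simp
  rw [real_inner_smul_left, ← h5]
  exact h4

/-- The volume of a convex body as the integral of the Jacobian of a monotone selection. -/
theorem MonotoneSelection.volume_eq {p : 𝔼 → 𝔼} {S : Set 𝔼} (hp : MonotoneSelection p S)
    (hinj : Function.Injective p) (hS : Convex ℝ S) {D : Set 𝔼} (hDm : MeasurableSet D)
    (hD : volume Dᶜ = 0) {p' : 𝔼 → 𝔼 →L[ℝ] 𝔼} (hp' : ∀ x ∈ D, HasFDerivAt p (p' x) x) :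
    volume S = ∫⁻ x in D, ENNReal.ofReal (p' x).det := by
  obtain ⟨L, hL⟩ := hp.lip
  have h1 : ∫⁻ x in D, ENNReal.ofReal (p' x).det = volume (p '' D) := by
    rw [← lintegral_abs_det_fderiv_eq_addHaar_image volume hDm
      (fun x hx => (hp' x hx).hasFDerivWithinAt) hinj.injOn]
    refine setLIntegral_congr_fun hDm fun x hx => ?_
    rw [abs_of_nonneg (LinearMap.det_nonneg_of_inner_nonneg (inner_fderiv_nonneg hp.mono (hp' x hx)))]
  rw [h1]
  refine le_antisymm ?_ (measure_mono (Set.image_subset_iff.2 fun x _ => hp.mem x))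
  have h2 : S ⊆ (frontier S ∪ p '' Dᶜ) ∪ p '' D := by
    intro y hy
    by_cases hyi : y ∈ interior S
    · obtain ⟨x, rfl⟩ := hp.interior_subset_range hyi
      by_cases hx : x ∈ D
      · exact Or.inr ⟨x, hx, rfl⟩
      · exact Or.inl (Or.inr ⟨x, hx, rfl⟩)
    · exact Or.inl (Or.inl ⟨subset_closure hy, hyi⟩)
  calc volume S ≤ _ := measure_mono h2
    _ ≤ volume (frontier S ∪ p '' Dᶜ) + volume (p '' D) := measure_union_le _ _
    _ = volume (p '' D) := by
      rw [measure_union_null (hS.addHaar_frontier _) (hL.volume_image_eq_zero hD), zero_add]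

theorem exists_polynomial_eval_eq_det (A B : 𝔼 →L[ℝ] 𝔼) :
    ∃ d : Polynomial ℝ, d.natDegree ≤ n ∧ ∀ τ : ℝ, d.eval τ = (A + τ • B).det := by
  set b := (EuclideanSpace.basisFun (Fin n) ℝ).toBasis with hb
  set MA := LinearMap.toMatrix b b (A : 𝔼 →ₗ[ℝ] 𝔼) with hMA
  set MB := LinearMap.toMatrix b b (B : 𝔼 →ₗ[ℝ] 𝔼) with hMB
  refine ⟨_, (Polynomial.natDegree_det_X_add_C_le MB MA).trans_eq (Fintype.card_fin n),
    fun τ => ?_⟩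
  have h1 : (A + τ • B).det = (MA + τ • MB).det := by
    rw [ContinuousLinearMap.det, ← LinearMap.det_toMatrix b, hMA, hMB, ← map_smul, ← map_add]
    rfl
  rw [h1, ← Polynomial.coe_evalRingHom, RingHom.map_det]
  congr 1
  ext i j
  simp only [RingHom.mapMatrix_apply, Matrix.map_apply, Matrix.add_apply, Matrix.smul_apply,
    smul_eq_mul, Polynomial.coe_evalRingHom, Polynomial.eval_add, Polynomial.eval_mul,
    Polynomial.eval_X, Polynomial.eval_C]
  ring

theorem exists_polynomial_eval_eq_volume {A B : 𝔼 → 𝔼} (hA : ∃ L, LipschitzWith L A)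
    (hB : ∃ L, LipschitzWith L B) {I : Set ℝ} (hI : I.Infinite) {S : ℝ → Set 𝔼}
    (hS : ∀ τ ∈ I, Convex ℝ (S τ)) (hSc : ∀ τ ∈ I, IsCompact (S τ))
    (hsel : ∀ τ ∈ I, MonotoneSelection (fun x => A x + τ • B x) (S τ))
    (hinj : ∀ τ ∈ I, Function.Injective fun x => A x + τ • B x) :
    ∃ F : Polynomial ℝ, F.natDegree ≤ n ∧ ∀ τ ∈ I, F.eval τ = (volume (S τ)).toReal := by
  obtain ⟨LA, hLA⟩ := hA
  obtain ⟨LB, hLB⟩ := hB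
  set D : Set 𝔼 := {x | DifferentiableAt ℝ A x} ∩ {x | DifferentiableAt ℝ B x} with hD
  have hDm : MeasurableSet D :=
    (measurableSet_of_differentiableAt ℝ A).inter (measurableSet_of_differentiableAt ℝ B)
  have hD0 : volume Dᶜ = 0 := by
    have : ∀ᵐ x ∂(volume : Measure 𝔼), x ∈ D := by
      filter_upwards [hLA.ae_differentiableAt, hLB.ae_differentiableAt] with x h1 h2
      exact ⟨h1, h2⟩
    exact this
  set J : ℝ → 𝔼 → ℝ := fun τ x => (fderiv ℝ A x + τ • fderiv ℝ B x).det with hJ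
  have hder : ∀ τ : ℝ, ∀ x ∈ D, HasFDerivAt (fun x : 𝔼 => A x + (τ : ℝ) • B x)
      (fderiv ℝ A x + τ • fderiv ℝ B x) x := fun τ x hx =>
    hx.1.hasFDerivAt.fun_add (hx.2.hasFDerivAt.fun_const_smul τ)
  have hJm : ∀ τ, Measurable (J τ) := fun τ =>
    ContinuousLinearMap.continuous_det.measurable.comp
      ((measurable_fderiv ℝ A).add ((measurable_fderiv ℝ B).const_smul τ))
  have hvol : ∀ τ ∈ I, volume (S τ) = ∫⁻ x in D, ENNReal.ofReal (J τ x) := fun τ hτ =>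
    (hsel τ hτ).volume_eq (hinj τ hτ) (hS τ hτ) hDm hD0 (hder τ)
  have hJ0 : ∀ τ ∈ I, 0 ≤ᵐ[volume.restrict D] J τ := fun τ hτ =>
    (ae_restrict_iff' hDm).2 <| Filter.Eventually.of_forall fun x hx =>
      LinearMap.det_nonneg_of_inner_nonneg (inner_fderiv_nonneg (hsel τ hτ).mono (hder τ x hx))
  have hJi : ∀ τ ∈ I, Integrable (J τ) (volume.restrict D) := fun τ hτ =>
    ⟨(hJm τ).aestronglyMeasurable, by
      rw [hasFiniteIntegral_iff_ofReal (hJ0 τ hτ), ← hvol τ hτ]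
      exact (hSc τ hτ).measure_lt_top⟩
  have hint : ∀ τ ∈ I, (volume (S τ)).toReal = ∫ x in D, J τ x := fun τ hτ => by
    rw [integral_eq_lintegral_of_nonneg_ae (hJ0 τ hτ) (hJm τ).aestronglyMeasurable, hvol τ hτ]
  set t : ℕ → ℝ := fun j => hI.natEmbedding I j with ht
  have htI : ∀ j, t j ∈ I := fun j => (hI.natEmbedding I j).2
  have htinj : Set.InjOn t (Finset.range (n + 1)) :=
    (Subtype.val_injective.comp (hI.natEmbedding I).injective).injOn
  refine ⟨Lagrange.interpolate (Finset.range (n + 1)) t fun j => (volume (S (t j))).toReal,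
    ?_, fun τ hτ => ?_⟩
  · have := Lagrange.degree_interpolate_lt (fun j => (volume (S (t j))).toReal) htinj
    rw [Finset.card_range] at this
    exact Polynomial.natDegree_le_iff_coeff_eq_zero.2 fun N hN =>
      Polynomial.coeff_eq_zero_of_degree_lt (this.trans_le (by exact_mod_cast hN))
  · have hlag : ∀ x, J τ x = ∑ j ∈ Finset.range (n + 1), J (t j) x *
        (Lagrange.basis (Finset.range (n + 1)) t j).eval τ := by
      intro x
      obtain ⟨d, hdn, hd⟩ := exists_polynomial_eval_eq_det (fderiv ℝ A x) (fderiv ℝ B x)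
      have h1 := Lagrange.eq_interpolate htinj (f := d) (by
        rw [Finset.card_range]
        exact (Polynomial.degree_le_of_natDegree_le hdn).trans_lt
          (by exact_mod_cast Nat.lt_succ_self n))
      have h2 := congrArg (Polynomial.eval τ) h1
      rw [Lagrange.interpolate_apply, Polynomial.eval_finsetSum] at h2
      simp only [Polynomial.eval_mul, Polynomial.eval_C, hd] at h2
      exact h2
    rw [hint τ hτ, Lagrange.interpolate_apply, Polynomial.eval_finsetSum]
    simp_rw [hlag]
    rw [integral_finsetSum _ fun j _ => (hJi _ (htI j)).mul_const _]
    refine Finset.sum_congr rfl fun j _ => ?_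
    rw [integral_mul_const, Polynomial.eval_mul, Polynomial.eval_C, hint _ (htI j)]

/-- The volume of an affine family of Minkowski combinations of two convex bodies and a ball is a
polynomial in the parameter. -/
theorem exists_polynomial_eval_eq_volume_add {K M : Set 𝔼} (hKn : K.Nonempty) (hK : IsCompact K)
    (hKc : Convex ℝ K) (hMn : M.Nonempty) (hM : IsCompact M) (hMc : Convex ℝ M)
    (a₀ a₁ b₀ b₁ c₀ c₁ : ℝ) {I : Set ℝ} (hI : I.Infinite) (ha : ∀ τ ∈ I, 0 ≤ a₀ + τ * a₁)
    (hb : ∀ τ ∈ I, 0 ≤ b₀ + τ * b₁) (hc : ∀ τ ∈ I, 0 < c₀ + τ * c₁) :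
    ∃ F : Polynomial ℝ, F.natDegree ≤ n ∧ ∀ τ ∈ I, F.eval τ =
      (volume ((a₀ + τ * a₁) • K + (b₀ + τ * b₁) • M +
        (c₀ + τ * c₁) • closedBall (0 : 𝔼) 1)).toReal := by
  obtain ⟨p, hp⟩ := exists_monotoneSelection hKn hK hKc
  obtain ⟨q, hq⟩ := exists_monotoneSelection hMn hM hMc
  have hr := monotoneSelection_radialContraction (n := n)
  have hlip : ∀ a b c : ℝ, ∃ L, LipschitzWith L fun x : 𝔼 =>
      a • p x + b • q x + c • radialContraction x := by
    intro a b c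
    obtain ⟨L₁, h₁⟩ := hp.lip
    obtain ⟨L₂, h₂⟩ := hq.lip
    obtain ⟨L₃, h₃⟩ := hr.lip
    exact ⟨_, (((lipschitzWith_smul a).comp h₁).add ((lipschitzWith_smul b).comp h₂)).add
      ((lipschitzWith_smul c).comp h₃)⟩
  have e : ∀ (τ : ℝ) (x : 𝔼), (a₀ • p x + b₀ • q x + c₀ • radialContraction x) +
      τ • (a₁ • p x + b₁ • q x + c₁ • radialContraction x) =
      (a₀ + τ * a₁) • p x + (b₀ + τ * b₁) • q x + (c₀ + τ * c₁) • radialContraction x := by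
    intro τ x
    module
  refine exists_polynomial_eval_eq_volume (hlip a₀ b₀ c₀) (hlip a₁ b₁ c₁) hI
    (fun τ _ => ((hKc.smul _).add (hMc.smul _)).add ((convex_closedBall _ _).smul _))
    (fun τ _ => ((hK.smul _).add (hM.smul _)).add ((isCompact_closedBall _ _).smul _))
    (fun τ hτ => ?_) (fun τ hτ x y hxy => ?_)
  · simp_rw [e]
    exact ((hp.smul (ha τ hτ)).add (hq.smul (hb τ hτ))).add (hr.smul (hc τ hτ).le)
  · simp only [e] at hxy
    by_contra hne
    have h1 := mul_nonneg (ha τ hτ) (hp.mono x y)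
    have h2 := mul_nonneg (hb τ hτ) (hq.mono x y)
    have h3 := mul_pos (hc τ hτ) (inner_radialContraction_sub_pos hne)
    have h4 : ⟪((a₀ + τ * a₁) • p x + (b₀ + τ * b₁) • q x + (c₀ + τ * c₁) • radialContraction x) -
        ((a₀ + τ * a₁) • p y + (b₀ + τ * b₁) • q y + (c₀ + τ * c₁) • radialContraction y),
        x - y⟫_ℝ = 0 := by
      rw [hxy, sub_self, inner_zero_left]
    have h5 : ((a₀ + τ * a₁) • p x + (b₀ + τ * b₁) • q x + (c₀ + τ * c₁) • radialContraction x) -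
        ((a₀ + τ * a₁) • p y + (b₀ + τ * b₁) • q y + (c₀ + τ * c₁) • radialContraction y) =
        (a₀ + τ * a₁) • (p x - p y) + (b₀ + τ * b₁) • (q x - q y) +
          (c₀ + τ * c₁) • (radialContraction x - radialContraction y) := by
      module
    rw [h5, inner_add_left, inner_add_left, real_inner_smul_left, real_inner_smul_left,
      real_inner_smul_left] at h4
    linarith

end

theorem Polynomial.eq_of_eval_eq_of_pos {P Q : Polynomial ℝ}
    (h : ∀ t, 0 < t → P.eval t = Q.eval t) : P = Q :=
  Polynomial.eq_of_infinite_eval_eq _ _ ((Set.Ioi_infinite (0 : ℝ)).mono fun t ht => h t ht)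

/-- Homogenised evaluation identities extend from an interval to all nonzero arguments. -/
theorem Polynomial.eval_eq_pow_mul_eval_div {F P : Polynomial ℝ} {n : ℕ} (hP : P.natDegree ≤ n)
    {c : ℝ} (h : ∀ τ ∈ Set.Ioo (0 : ℝ) (1 / 2),
      F.eval τ = (2 * τ) ^ n * P.eval ((1 - τ) * c / (2 * τ))) {τ : ℝ} (hτ : τ ≠ 0) :
    F.eval τ = (2 * τ) ^ n * P.eval ((1 - τ) * c / (2 * τ)) := by
  set R : Polynomial ℝ := ∑ k ∈ Finset.range (n + 1), Polynomial.C (P.coeff k) *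
    (Polynomial.C 2 * Polynomial.X) ^ (n - k) * ((1 - Polynomial.X) * Polynomial.C c) ^ k with hR
  have hRe : ∀ s : ℝ, s ≠ 0 → R.eval s = (2 * s) ^ n * P.eval ((1 - s) * c / (2 * s)) := by
    intro s hs
    rw [Polynomial.eval_eq_sum_range' (Nat.lt_succ_of_le hP), hR, Polynomial.eval_finsetSum,
      Finset.mul_sum]
    refine Finset.sum_congr rfl fun k hk => ?_
    have hk' : k ≤ n := Nat.lt_succ_iff.1 (Finset.mem_range.1 hk)
    simp only [Polynomial.eval_mul, Polynomial.eval_pow, Polynomial.eval_C, Polynomial.eval_X,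
      Polynomial.eval_sub, Polynomial.eval_one]
    have h2 : (2 * s) ^ n = (2 * s) ^ (n - k) * (2 * s) ^ k := by
      rw [← pow_add, Nat.sub_add_cancel hk']
    have h3 : (2 * s) ^ k ≠ 0 := pow_ne_zero _ (mul_ne_zero two_ne_zero hs)
    rw [h2, div_pow]
    field_simp
  have : F = R := Polynomial.eq_of_infinite_eval_eq _ _
    ((Set.Ioo_infinite (show (0 : ℝ) < 1 / 2 by norm_num)).mono fun s hs =>
      (h s hs).trans (hRe s hs.1.ne').symm)
  rw [this, hRe τ hτ]

section
variable {n : ℕ}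
local notation "𝔼" => EuclideanSpace ℝ (Fin n)

theorem exists_steiner_polynomial {M : Set 𝔼} (hMn : M.Nonempty) (hM : IsCompact M)
    (hMc : Convex ℝ M) : ∃ Q : Polynomial ℝ, Q.natDegree ≤ n ∧
      ∀ t, 0 < t → Q.eval t = (volume (M + t • closedBall (0 : 𝔼) 1)).toReal := by
  obtain ⟨F, hF, h⟩ := exists_polynomial_eval_eq_volume_add hMn hM hMc hMn hM hMc 0 0 1 0 0 1
    (I := Set.Ioi 0) (Set.Ioi_infinite 0) (fun _ _ => by simp) (fun _ _ => by simp)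
    (fun τ hτ => by simpa using hτ)
  refine ⟨F, hF, fun t ht => ?_⟩
  rw [h t ht, mul_zero, add_zero, add_zero, mul_one, zero_add, Set.zero_smul_set hMn, one_smul,
    zero_add]

/-- If `M` and `K` add up to a ball, a combination of them is a multiple of a parallel body. -/
theorem volume_combination_eq {K M : Set 𝔼} (hKc : Convex ℝ K) (hMc : Convex ℝ M) {c τ : ℝ}
    (h : M + K = c • closedBall (0 : 𝔼) 1) (hτ : 0 < τ) (hτ1 : τ < 1 / 2) :
    (volume ((1 / 2 + τ) • K + (1 / 2 - τ) • M + (c / 2) • closedBall (0 : 𝔼) 1)).toReal =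
      (2 * τ) ^ n * (volume (K + ((1 - τ) * c / (2 * τ)) • closedBall (0 : 𝔼) 1)).toReal := by
  have e1 : (c / 2) • closedBall (0 : 𝔼) 1 = (1 / 2 : ℝ) • M + (1 / 2 : ℝ) • K := by
    rw [← smul_add, h, smul_smul]
    congr 1
    ring
  have e2 : (1 / 2 + τ) • K + (1 / 2 - τ) • M + (c / 2) • closedBall (0 : 𝔼) 1 =
      (2 * τ) • (K + ((1 - τ) * c / (2 * τ)) • closedBall (0 : 𝔼) 1) := by
    calc _ = ((1 / 2 + τ) • K + (1 / 2 : ℝ) • K) + ((1 / 2 - τ) • M + (1 / 2 : ℝ) • M) := by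
          rw [e1]
          abel
      _ = (2 * τ + (1 - τ)) • K + (1 - τ) • M := by
        rw [← hKc.add_smul (by linarith) (by norm_num), ← hMc.add_smul (by linarith) (by norm_num)]
        congr 2 <;> ring
      _ = (2 * τ) • K + (1 - τ) • (M + K) := by
        rw [hKc.add_smul (by linarith) (by linarith), smul_add]
        abel
      _ = _ := by
        rw [h, smul_add, smul_smul, smul_smul, mul_div_cancel₀ _ (by positivity)]
  rw [e2, volume_smul_toReal _ (by positivity)]

/-- Reciprocity between the Steiner polynomials of complementary summands of a ball. -/
theorem eval_steiner_polynomial_neg_sub {K M : Set 𝔼} (hKn : K.Nonempty) (hK : IsCompact K)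
    (hKc : Convex ℝ K) (hMn : M.Nonempty) (hM : IsCompact M) (hMc : Convex ℝ M) {c : ℝ}
    (hc : 0 < c) (h : M + K = c • closedBall (0 : 𝔼) 1) {P Q : Polynomial ℝ}
    (hPn : P.natDegree ≤ n) (hQn : Q.natDegree ≤ n)
    (hP : ∀ t, 0 < t → P.eval t = (volume (K + t • closedBall (0 : 𝔼) 1)).toReal)
    (hQ : ∀ t, 0 < t → Q.eval t = (volume (M + t • closedBall (0 : 𝔼) 1)).toReal)
    {t : ℝ} (ht : 0 < t) : P.eval t = (-1) ^ n * Q.eval (-t - c) := by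
  obtain ⟨F, -, hF⟩ := exists_polynomial_eval_eq_volume_add hKn hK hKc hMn hM hMc (1 / 2) 1
    (1 / 2) (-1) (c / 2) 0 (I := Set.Ioo (-(1 / 2)) (1 / 2)) (Set.Ioo_infinite (by norm_num))
    (fun τ hτ => by linarith [hτ.1]) (fun τ hτ => by linarith [hτ.2])
    (fun τ hτ => by rw [mul_zero, add_zero]; positivity)
  simp only [mul_one, mul_zero, add_zero, mul_neg, ← sub_eq_add_neg] at hF
  have h1 : ∀ τ ∈ Set.Ioo (0 : ℝ) (1 / 2),
      F.eval τ = (2 * τ) ^ n * P.eval ((1 - τ) * c / (2 * τ)) := by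
    intro τ hτ
    have hτ0 := hτ.1
    have : 0 < 1 - τ := by linarith [hτ.2]
    rw [hF τ ⟨by linarith [hτ.1], hτ.2⟩, volume_combination_eq hKc hMc h hτ.1 hτ.2,
      hP _ (by positivity)]
  have h2 : ∀ τ ∈ Set.Ioo (0 : ℝ) (1 / 2),
      (F.comp (-Polynomial.X)).eval τ = (2 * τ) ^ n * Q.eval ((1 - τ) * c / (2 * τ)) := by
    intro τ hτ
    have hτ0 := hτ.1
    have : 0 < 1 - τ := by linarith [hτ.2]
    rw [hQ _ (by positivity), ← volume_combination_eq hMc hKc (add_comm M K ▸ h) hτ.1 hτ.2,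
      Polynomial.eval_comp, Polynomial.eval_neg, Polynomial.eval_X,
      hF _ ⟨by linarith [hτ.2], by linarith [hτ.1]⟩, sub_neg_eq_add, ← sub_eq_add_neg,
      add_comm ((1 / 2 - τ) • K)]
  set τ : ℝ := c / (2 * t + c) with hτ
  have hτ0 : 0 < τ := by positivity
  have h3 := Polynomial.eval_eq_pow_mul_eval_div hPn h1 hτ0.ne'
  have h4 := Polynomial.eval_eq_pow_mul_eval_div hQn h2 (neg_ne_zero.2 hτ0.ne')
  rw [Polynomial.eval_comp, Polynomial.eval_neg, Polynomial.eval_X, neg_neg, h3] at h4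
  have e1 : (1 - τ) * c / (2 * τ) = t := by
    rw [hτ]
    field_simp
    ring
  have e2 : (1 - -τ) * c / (2 * -τ) = -t - c := by
    rw [hτ]
    field_simp
    ring
  rw [e1, e2, mul_neg, neg_pow, mul_comm ((-1 : ℝ) ^ n), mul_assoc] at h4
  exact mul_left_cancel₀ (by positivity) h4

end

/-- **Corollary (dimensions ≤ 5).** Let `1 ≤ n ≤ 5`, let `K ⊆ ℝⁿ` be a convex body with
nonempty interior, and let `P` be its Steiner polynomial. If `ρB` is a Minkowski summand
of `K` (`ρ > 0`) then every complex root `z` of `P` has `Re z ≤ -ρ`; and if `K` is a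
Minkowski summand of `cB` (`c > 0`) then every complex root `z` of `P` has `Re z ≥ -c`.
In particular the real parts of the roots lie between `-ρ_max` and `-ρ_min`. -/
theorem steiner_roots_bounds_dim_le_five (n : ℕ) (hn1 : 1 ≤ n) (hn5 : n ≤ 5)
    (K : Set (EuclideanSpace ℝ (Fin n)))
    (hKne : K.Nonempty) (hKcomp : IsCompact K) (hKconv : Convex ℝ K)
    (hKint : (interior K).Nonempty)
    (P : Polynomial ℝ) (hPdeg : P.natDegree ≤ n)
    (hP : ∀ t : ℝ, 0 ≤ t →
      P.eval t = (volume (K + t • closedBall (0 : EuclideanSpace ℝ (Fin n)) 1)).toReal) :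
    (∀ ρ : ℝ, 0 < ρ →
      (∃ M : Set (EuclideanSpace ℝ (Fin n)), M.Nonempty ∧ IsCompact M ∧ Convex ℝ M ∧
        M + ρ • closedBall (0 : EuclideanSpace ℝ (Fin n)) 1 = K) →
      ∀ z : ℂ, Polynomial.aeval z P = 0 → z.re ≤ -ρ) ∧
    (∀ c : ℝ, 0 < c →
      (∃ M : Set (EuclideanSpace ℝ (Fin n)), M.Nonempty ∧ IsCompact M ∧ Convex ℝ M ∧
        M + K = c • closedBall (0 : EuclideanSpace ℝ (Fin n)) 1) →
      ∀ z : ℂ, Polynomial.aeval z P = 0 → -c ≤ z.re) := by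
  constructor
  · rintro ρ hρ ⟨M, hMn, hM, hMc, rfl⟩ z hz
    obtain ⟨Q, hQn, hQ⟩ := exists_steiner_polynomial hMn hM hMc
    have hPQ : P = Q.comp (Polynomial.X + Polynomial.C ρ) := by
      refine Polynomial.eq_of_eval_eq_of_pos fun t ht => ?_
      rw [hP t ht.le, add_add_smul_closedBall M hρ.le ht.le, ← hQ _ (by positivity)]
      simp [add_comm]
    have hzQ : Polynomial.aeval (z + ρ) Q = 0 := by
      rw [hPQ, Polynomial.aeval_comp] at hz
      simpa using hz
    have := re_nonpos_of_steiner_root hn1 hn5 hMn hM hMc hQn hQ hzQ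
    rw [Complex.add_re, Complex.ofReal_re] at this
    linarith
  · rintro c hc ⟨M, hMn, hM, hMc, hMK⟩ z hz
    obtain ⟨Q, hQn, hQ⟩ := exists_steiner_polynomial hMn hM hMc
    have hPQ : P = Polynomial.C ((-1) ^ n) * Q.comp (-Polynomial.X - Polynomial.C c) := by
      refine Polynomial.eq_of_eval_eq_of_pos fun t ht => ?_
      rw [eval_steiner_polynomial_neg_sub hKne hKcomp hKconv hMn hM hMc hc hMK hPdeg hQn
        (fun t ht => hP t ht.le) hQ ht]
      simp
    have hzQ : Polynomial.aeval (-z - c) Q = 0 := by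
      rw [hPQ, map_mul, Polynomial.aeval_comp, Polynomial.aeval_C] at hz
      simpa using hz
    have := re_nonpos_of_steiner_root hn1 hn5 hMn hM hMc hQn hQ hzQ
    rw [Complex.sub_re, Complex.neg_re, Complex.ofReal_re] at this
    linarith
end

section
/- Let K ⊆ ℝⁿ be a convex body, let c ≥ 0, suppose cB is a Minkowski summand of K, and let P be a real polynomial of degree at most n with P(t) = vol(K + tB) for all real t ≥ 0. Then for all real t ≥ 0, vol((K ∼ cB) + tB) = P(t − c). In other words, the Steiner polynomial of the inner parallel body K ∼ cB is S_{K ∼ cB}(t) = S_K(t − c). -/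
open MeasureTheory Metric Pointwise

/-- The Minkowski difference `K ∼ L = { v : L + v ⊆ K }`. -/
def minkowskiDiff {n : ℕ} (K L : Set (EuclideanSpace ℝ (Fin n))) :
    Set (EuclideanSpace ℝ (Fin n)) :=
  {v | L + {v} ⊆ K}

section MetricProjection

open Filter Topology Module Polynomial
open scoped InnerProductSpace ENNReal NNReal

variable {E : Type*} [NormedAddCommGroup E] [InnerProductSpace ℝ E]

/-- `p` is the nearest-point projection onto the convex set `M`, expressed through the variational
characterisation of nearest points. -/
structure IsConvexProjection (M : Set E) (p : E → E) : Prop where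
  mem (x : E) : p x ∈ M
  inner_le_zero (x : E) {w : E} (hw : w ∈ M) : ⟪x - p x, w - p x⟫_ℝ ≤ 0

theorem exists_isConvexProjection {M : Set E} (hne : M.Nonempty) (hcomp : IsCompact M)
    (hconv : Convex ℝ M) : ∃ p : E → E, IsConvexProjection M p := by
  choose p hp h using exists_norm_eq_iInf_of_complete_convex hne hcomp.isComplete hconv
  exact ⟨p, hp, fun x w hw ↦ (norm_eq_iInf_iff_real_inner_le_zero hconv (hp x)).1 (h x) w hw⟩

/-- The map moving `x` along the ray from `p x` through `x`, scaling the distance to `p x`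
by the factor `s`. -/
def rayDilation (p : E → E) (s : ℝ) (x : E) : E := p x + s • (x - p x)

theorem smul_closedBall_zero_one {t : ℝ} (ht : 0 ≤ t) :
    t • closedBall (0 : E) 1 = closedBall 0 t := by
  rcases subsingleton_or_nontrivial E with h | h
  · ext x
    have hx : x = 0 := Subsingleton.elim _ _
    subst hx
    simp only [mem_closedBall, dist_self, ht, iff_true]
    exact ⟨0, by simp, by simp⟩
  · rw [_root_.smul_closedBall _ _ zero_le_one, smul_zero, Real.norm_of_nonneg ht, mul_one]

theorem rayDilation_one (p : E → E) (x : E) : rayDilation p 1 x = x := by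
  simp [rayDilation]

namespace IsConvexProjection

variable {M : Set E} {p : E → E} (hp : IsConvexProjection M p)
include hp

theorem eq_of_inner_le_zero {x q : E} (hq : q ∈ M)
    (h : ∀ w ∈ M, ⟪x - q, w - q⟫_ℝ ≤ 0) : p x = q := by
  have h1 := hp.inner_le_zero x hq
  have h2 := h _ (hp.mem x)
  have h3 : ⟪p x - q, p x - q⟫_ℝ = ⟪x - q, p x - q⟫_ℝ + ⟪x - p x, q - p x⟫_ℝ := by
    simp only [inner_sub_left, inner_sub_right]; ring
  have h4 : ⟪p x - q, p x - q⟫_ℝ ≤ 0 := by linarith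
  exact sub_eq_zero.1 (real_inner_self_nonpos.1 h4)

theorem norm_sub_sq_le (x y : E) : ‖p x - p y‖ ^ 2 ≤ ⟪x - y, p x - p y⟫_ℝ := by
  have h1 := hp.inner_le_zero x (hp.mem y)
  have h2 := hp.inner_le_zero y (hp.mem x)
  rw [← real_inner_self_eq_norm_sq]
  simp only [inner_sub_left, inner_sub_right] at *
  linarith

theorem lipschitzWith : LipschitzWith 1 p := by
  refine LipschitzWith.of_dist_le_mul fun x y ↦ ?_
  rw [dist_eq_norm, dist_eq_norm, NNReal.coe_one, one_mul]
  have h1 := (hp.norm_sub_sq_le x y).trans (real_inner_le_norm _ _)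
  by_contra! h
  nlinarith [norm_nonneg (x - y), norm_nonneg (p x - p y)]

theorem norm_sub_le (x : E) {w : E} (hw : w ∈ M) : ‖x - p x‖ ≤ ‖x - w‖ := by
  have h1 := hp.inner_le_zero x hw
  have h2 : ‖x - p x‖ ^ 2 ≤ ⟪x - w, x - p x⟫_ℝ := by
    rw [← real_inner_self_eq_norm_sq]
    have : x - w = (x - p x) - (w - p x) := by abel
    rw [this, inner_sub_left _ (w - p x), real_inner_comm (x - p x) (w - p x)]
    linarith
  have h3 := h2.trans (real_inner_le_norm _ _)
  by_contra! h
  nlinarith [norm_nonneg (x - w), norm_nonneg (x - p x)]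

theorem add_closedBall_eq (t : ℝ) : M + closedBall (0 : E) t = {x | ‖x - p x‖ ≤ t} := by
  ext x
  constructor
  · rintro ⟨m, hm, b, hb, rfl⟩
    refine (hp.norm_sub_le _ hm).trans ?_
    simpa using hb
  · intro hx
    exact ⟨p x, hp.mem x, x - p x, by simpa using hx, by simp⟩

theorem apply_rayDilation {s : ℝ} (hs : 0 ≤ s) (x : E) : p (rayDilation p s x) = p x := by
  refine hp.eq_of_inner_le_zero (hp.mem x) fun w hw ↦ ?_
  rw [rayDilation, add_sub_cancel_left, real_inner_smul_left]
  exact mul_nonpos_of_nonneg_of_nonpos hs (hp.inner_le_zero x hw)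

theorem rayDilation_sub {s : ℝ} (hs : 0 ≤ s) (x : E) :
    rayDilation p s x - p (rayDilation p s x) = s • (x - p x) := by
  rw [hp.apply_rayDilation hs, rayDilation, add_sub_cancel_left]

theorem rayDilation_rayDilation {s r : ℝ} (hs : 0 ≤ s) (x : E) :
    rayDilation p r (rayDilation p s x) = rayDilation p (r * s) x := by
  rw [rayDilation, hp.rayDilation_sub hs, hp.apply_rayDilation hs, rayDilation, smul_smul]

theorem injective_rayDilation {s : ℝ} (hs : 0 < s) : Function.Injective (rayDilation p s) := by
  refine Function.LeftInverse.injective (g := rayDilation p s⁻¹) fun x ↦ ?_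
  rw [hp.rayDilation_rayDilation hs.le, inv_mul_cancel₀ hs.ne', rayDilation_one]

theorem image_rayDilation {s : ℝ} (hs : 0 < s) :
    rayDilation p s '' (M + closedBall 0 1) = M + closedBall 0 s := by
  rw [hp.add_closedBall_eq, hp.add_closedBall_eq]
  ext y
  constructor
  · rintro ⟨x, hx, rfl⟩
    rw [Set.mem_ofPred_eq] at hx ⊢
    rw [hp.rayDilation_sub hs.le, norm_smul, Real.norm_of_nonneg hs.le]
    nlinarith
  · intro hy
    rw [Set.mem_ofPred_eq] at hy
    refine ⟨rayDilation p s⁻¹ y, ?_, ?_⟩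
    · rw [Set.mem_ofPred_eq, hp.rayDilation_sub (inv_nonneg.2 hs.le), norm_smul,
        Real.norm_of_nonneg (inv_nonneg.2 hs.le), inv_mul_le_iff₀ hs, mul_one]
      exact hy
    · rw [hp.rayDilation_rayDilation (inv_nonneg.2 hs.le), mul_inv_cancel₀ hs.ne',
        rayDilation_one]

theorem exists_lipschitzWith_rayDilation (s : ℝ) : ∃ C, LipschitzWith C (rayDilation p s) :=
  ⟨_, hp.lipschitzWith.add ((lipschitzWith_smul s).comp (LipschitzWith.id.sub hp.lipschitzWith))⟩

theorem norm_fderiv_sq_le {x : E} (hx : DifferentiableAt ℝ p x) (v : E) :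
    ‖fderiv ℝ p x v‖ ^ 2 ≤ ⟪v, fderiv ℝ p x v⟫_ℝ := by
  have h := (hx.hasFDerivAt.hasLineDerivAt v).tendsto_slope_zero
  refine le_of_tendsto_of_tendsto (h.norm.pow 2) (tendsto_const_nhds.inner h) ?_
  filter_upwards [self_mem_nhdsWithin] with r hr
  have hr : r ≠ 0 := hr
  have h1 := hp.norm_sub_sq_le (x + r • v) x
  rw [add_sub_cancel_left, real_inner_smul_left] at h1
  rw [norm_smul, mul_pow, real_inner_smul_right, norm_inv, inv_pow, Real.norm_eq_abs, sq_abs]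
  calc (r ^ 2)⁻¹ * ‖p (x + r • v) - p x‖ ^ 2
      ≤ (r ^ 2)⁻¹ * (r * ⟪v, p (x + r • v) - p x⟫_ℝ) := by gcongr
    _ = r⁻¹ * ⟪v, p (x + r • v) - p x⟫_ℝ := by field_simp

theorem det_fderiv_add_smul_ne_zero [FiniteDimensional ℝ E] {x : E}
    (hx : DifferentiableAt ℝ p x) {s : ℝ} (hs : 0 < s) :
    (fderiv ℝ p x + s • (ContinuousLinearMap.id ℝ E - fderiv ℝ p x)).det ≠ 0 := by
  intro h
  obtain ⟨v, hv, hv0⟩ := (Submodule.ne_bot_iff _).1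
    (LinearMap.bot_lt_ker_of_det_eq_zero h).ne'
  set w := fderiv ℝ p x v with hw
  have h1 : w + s • (v - w) = 0 := by simpa [hw] using hv
  have h2 : ‖w‖ ^ 2 ≤ ⟪v, w⟫_ℝ := hp.norm_fderiv_sq_le hx v
  have h3 : ⟪w + s • (v - w), w⟫_ℝ = 0 := by rw [h1, inner_zero_left]
  rw [inner_add_left, real_inner_smul_left, inner_sub_left, real_inner_self_eq_norm_sq] at h3
  have h4 : ‖w‖ ^ 2 = 0 := by nlinarith [sq_nonneg ‖w‖]
  have h5 : w = 0 := by simpa using h4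
  rw [h5, zero_add, sub_zero, smul_eq_zero] at h1
  exact h1.elim hs.ne' hv0

end IsConvexProjection

theorem exists_polynomial_det_add_smul [FiniteDimensional ℝ E] (A B : E →L[ℝ] E) :
    ∃ q : ℝ[X], q.natDegree ≤ finrank ℝ E ∧ ∀ s : ℝ, q.eval s = (A + s • B).det := by
  let b := finBasis ℝ E
  let A' := LinearMap.toMatrix b b A
  let B' := LinearMap.toMatrix b b B
  refine ⟨((X : ℝ[X]) • B'.map C + A'.map C).det, ?_, fun s ↦ ?_⟩
  · simpa using natDegree_det_X_add_C_le B' A'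
  · rw [ContinuousLinearMap.det, ← LinearMap.det_toMatrix b, ← coe_evalRingHom, RingHom.map_det]
    congr 1
    ext i j
    simp only [A', B', RingHom.mapMatrix_apply, Matrix.map_apply, Matrix.add_apply,
      Matrix.smul_apply, coe_evalRingHom, smul_eq_mul, eval_mul, eval_X, eval_C,
      ContinuousLinearMap.toLinearMap_add, ContinuousLinearMap.toLinearMap_smul, map_add, map_smul]
    exact add_comm _ _

theorem IsConvexProjection.det_fderiv_add_smul_pos [FiniteDimensional ℝ E] {M : Set E} {p : E → E}
    (hp : IsConvexProjection M p) {x : E} (hx : DifferentiableAt ℝ p x) {s : ℝ} (hs : 0 < s) :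
    0 < (fderiv ℝ p x + s • (ContinuousLinearMap.id ℝ E - fderiv ℝ p x)).det := by
  obtain ⟨q, -, hq⟩ := exists_polynomial_det_add_smul (fderiv ℝ p x)
    (ContinuousLinearMap.id ℝ E - fderiv ℝ p x)
  have hne : ∀ r : ℝ, 0 < r → q.eval r ≠ 0 := fun r hr ↦ by
    rw [hq]; exact hp.det_fderiv_add_smul_ne_zero hx hr
  have h1 : q.eval 1 = 1 := by
    rw [hq, one_smul, add_sub_cancel]
    exact LinearMap.det_id
  rw [← hq]
  by_contra! h
  obtain ⟨r, hr, hr0⟩ := (convex_Ioi (0 : ℝ)).isPreconnected.intermediate_value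
    (Set.mem_Ioi.2 hs) (Set.mem_Ioi.2 one_pos) q.continuous.continuousOn
    (show (0 : ℝ) ∈ Set.Icc (q.eval s) (q.eval 1) from ⟨h, by simp [h1]⟩)
  exact hne r hr hr0

theorem exists_polynomial_eval_eq_integral {α : Type*} [MeasurableSpace α] {μ : Measure α} {n : ℕ}
    {q : α → ℝ[X]} (hdeg : ∀ x, (q x).natDegree ≤ n)
    (hint : ∀ s : ℝ, 0 < s → Integrable (fun x ↦ (q x).eval s) μ) :
    ∃ Q : ℝ[X], Q.natDegree ≤ n ∧ ∀ s : ℝ, Q.eval s = ∫ x, (q x).eval s ∂μ := by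
  let v : ℕ → ℝ := fun i ↦ i + 1
  have hv : Set.InjOn v (Finset.range (n + 1)) := fun i _ j _ h ↦ by simpa [v] using h
  have hv0 : ∀ i, 0 < v i := fun i ↦ by positivity
  refine ⟨Lagrange.interpolate (Finset.range (n + 1)) v fun i ↦ ∫ x, (q x).eval (v i) ∂μ,
    ?_, fun s ↦ ?_⟩
  · have h := Lagrange.degree_interpolate_lt (fun i ↦ ∫ x, (q x).eval (v i) ∂μ) hv
    rw [Finset.card_range] at h
    exact natDegree_le_of_degree_le (Order.le_of_lt_succ h)
  · have h : ∀ x, (q x).eval s = ∑ i ∈ Finset.range (n + 1),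
        (q x).eval (v i) * (Lagrange.basis (Finset.range (n + 1)) v i).eval s := fun x ↦ by
      have hlt : (q x).degree < (Finset.range (n + 1)).card := by
        rw [Finset.card_range]
        exact degree_le_natDegree.trans_lt (by exact_mod_cast Nat.lt_succ_of_le (hdeg x))
      conv_lhs => rw [Lagrange.eq_interpolate hv hlt]
      simp [Lagrange.interpolate_apply, eval_finsetSum]
    simp_rw [h]
    rw [integral_finsetSum _ fun i _ ↦ (hint _ (hv0 i)).mul_const _]
    simp [Lagrange.interpolate_apply, eval_finsetSum, integral_mul_const]

theorem LipschitzWith.addHaar_image_eq_zero {F : Type*} [NormedAddCommGroup F] [NormedSpace ℝ F]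
    [FiniteDimensional ℝ F] [MeasurableSpace F] [BorelSpace F] (μ : Measure F)
    [μ.IsAddHaarMeasure] {C : ℝ≥0} {f : F → F} (hf : LipschitzWith C f) {s : Set F}
    (hs : μ s = 0) : μ (f '' s) = 0 := by
  have hH : μH[finrank ℝ F] s = 0 := Measure.absolutelyContinuous_isAddHaarMeasure _ μ hs
  have h : μH[finrank ℝ F] (f '' s) = 0 := by
    refine le_antisymm ((hf.hausdorffMeasure_image_le (Nat.cast_nonneg _) s).trans ?_) zero_le
    rw [hH, mul_zero]
  exact Measure.absolutelyContinuous_isAddHaarMeasure μ (μH[finrank ℝ F]) h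

variable [FiniteDimensional ℝ E] [MeasurableSpace E] [BorelSpace E]

/-- **Steiner's formula** for positive radii: the volume of the parallel bodies of a convex body
is a polynomial in the radius. -/
theorem exists_steinerPolynomial_of_pos (μ : Measure E) [μ.IsAddHaarMeasure] {M : Set E}
    (hne : M.Nonempty) (hcomp : IsCompact M) (hconv : Convex ℝ M) :
    ∃ Q : ℝ[X], Q.natDegree ≤ finrank ℝ E ∧
      ∀ t : ℝ, 0 < t → Q.eval t = μ.real (M + closedBall 0 t) := by
  obtain ⟨p, hp⟩ := exists_isConvexProjection hne hcomp hconv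
  have hfin : ∀ t, IsCompact (M + closedBall (0 : E) t) := fun t ↦
    hcomp.add (isCompact_closedBall _ _)
  set D : Set E := (M + closedBall 0 1) ∩ {x | DifferentiableAt ℝ p x} with hD
  have hDmeas : MeasurableSet D :=
    (hfin 1).measurableSet.inter (measurableSet_of_differentiableAt ℝ p)
  choose q hqdeg hq using fun x ↦ exists_polynomial_det_add_smul (fderiv ℝ p x)
    (ContinuousLinearMap.id ℝ E - fderiv ℝ p x)
  have himage : ∀ s : ℝ, 0 < s → rayDilation p s '' D =ᵐ[μ] (M + closedBall 0 s : Set E) := by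
    intro s hs
    obtain ⟨C, hC⟩ := hp.exists_lipschitzWith_rayDilation s
    have hsub : rayDilation p s '' D ⊆ M + closedBall 0 s := by
      rw [← hp.image_rayDilation hs]
      exact Set.image_mono Set.inter_subset_left
    refine hsub.eventuallyLE.antisymm (ae_le_set.2 ?_)
    refine measure_mono_null ?_ (hC.addHaar_image_eq_zero μ
      (ae_iff.1 (hp.lipschitzWith.ae_differentiableAt (μ := μ))))
    rw [← hp.image_rayDilation hs]
    rintro _ ⟨⟨x, hx, rfl⟩, hnot⟩
    exact ⟨x, fun hdiff ↦ hnot ⟨x, ⟨hx, hdiff⟩, rfl⟩, rfl⟩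
  have hderiv : ∀ s : ℝ, ∀ x ∈ D, HasFDerivWithinAt (rayDilation p s)
      (fderiv ℝ p x + s • (ContinuousLinearMap.id ℝ E - fderiv ℝ p x)) D x := fun s x hx ↦
    (hx.2.hasFDerivAt.add
      (((hasFDerivAt_id x).sub hx.2.hasFDerivAt).const_smul s)).hasFDerivWithinAt
  have habs : ∀ s : ℝ, 0 < s → ∀ x ∈ D,
      |(fderiv ℝ p x + s • (ContinuousLinearMap.id ℝ E - fderiv ℝ p x)).det| • (1 : ℝ) =
        (q x).eval s := fun s hs x hx ↦ by
    rw [hq, abs_of_pos (hp.det_fderiv_add_smul_pos hx.2 hs), smul_eq_mul, mul_one]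
  obtain ⟨Q, hQdeg, hQ⟩ := exists_polynomial_eval_eq_integral (μ := μ.restrict D) hqdeg
    fun s hs ↦ by
      have h := (integrableOn_image_iff_integrableOn_abs_det_fderiv_smul μ hDmeas (hderiv s)
        (hp.injective_rayDilation hs).injOn (fun _ ↦ (1 : ℝ))).1 (by
          refine integrableOn_const ?_
          rw [measure_congr (himage s hs)]
          exact (hfin s).measure_lt_top.ne)
      exact h.congr_fun (habs s hs) hDmeas
  refine ⟨Q, hQdeg, fun t ht ↦ ?_⟩
  rw [hQ, ← setIntegral_congr_fun hDmeas (habs t ht),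
    ← integral_image_eq_integral_abs_det_fderiv_smul μ hDmeas (hderiv t)
      (hp.injective_rayDilation ht).injOn (fun _ ↦ (1 : ℝ)),
    setIntegral_congr_set (himage t ht)]
  simp

/-- **Steiner's formula**: the volume of the parallel bodies of a convex body is a polynomial in
the radius. -/
theorem exists_steinerPolynomial (μ : Measure E) [μ.IsAddHaarMeasure] {M : Set E}
    (hne : M.Nonempty) (hcomp : IsCompact M) (hconv : Convex ℝ M) :
    ∃ Q : ℝ[X], Q.natDegree ≤ finrank ℝ E ∧
      ∀ t : ℝ, 0 ≤ t → Q.eval t = μ.real (M + closedBall 0 t) := by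
  obtain ⟨Q, hdeg, hQ⟩ := exists_steinerPolynomial_of_pos μ hne hcomp hconv
  refine ⟨Q, hdeg, fun t ht ↦ ?_⟩
  rcases ht.eq_or_lt with rfl | ht
  · have h1 : Tendsto (fun r ↦ μ.real (cthickening r M)) (𝓝[>] 0) (𝓝 (μ.real M)) :=
      ((ENNReal.tendsto_toReal hcomp.measure_lt_top.ne).comp
        (tendsto_measure_cthickening_of_isCompact hcomp)).mono_left nhdsWithin_le_nhds
    have h2 : Tendsto (fun r ↦ Q.eval r) (𝓝[>] 0) (𝓝 (Q.eval 0)) :=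
      (Q.continuous.tendsto 0).mono_left nhdsWithin_le_nhds
    rw [closedBall_zero, Set.add_singleton]
    simp only [add_zero, Set.image_id']
    refine tendsto_nhds_unique (h2.congr' ?_) h1
    filter_upwards [self_mem_nhdsWithin] with r hr
    rw [hQ r hr, hcomp.add_closedBall_zero (le_of_lt hr)]
  · exact hQ t ht

end MetricProjection

theorem minkowskiDiff_add_closedBall {n : ℕ} {M : Set (EuclideanSpace ℝ (Fin n))}
    (hne : M.Nonempty) (hcomp : IsCompact M) (hconv : Convex ℝ M) {c : ℝ} (hc : 0 ≤ c) :
    minkowskiDiff (M + closedBall 0 c) (closedBall 0 c) = M := by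
  obtain ⟨p, hp⟩ := exists_isConvexProjection hne hcomp hconv
  ext v
  constructor
  · intro hv
    set u := v - p v with hu
    by_cases hu0 : u = 0
    · rw [sub_eq_zero.1 hu0]
      exact hp.mem v
    have hnorm : 0 < ‖u‖ := norm_pos_iff.2 hu0
    have hmem : (c / ‖u‖) • u + v ∈ M + closedBall 0 c := by
      refine hv ⟨(c / ‖u‖) • u, ?_, v, rfl, rfl⟩
      rw [mem_closedBall_zero_iff, norm_smul, norm_div, norm_norm, Real.norm_of_nonneg hc,
        div_mul_cancel₀ _ hnorm.ne']
    obtain ⟨m, hm, b, hb, hmb⟩ := hmem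
    have h1 : inner ℝ u (m + b) = c * ‖u‖ + inner ℝ u v := by
      rw [show m + b = (c / ‖u‖) • u + v from hmb, inner_add_right, real_inner_smul_right,
        real_inner_self_eq_norm_sq]
      field_simp
    have h2 : inner ℝ u b ≤ c * ‖u‖ := by
      have hb : ‖b‖ ≤ c := by simpa using hb
      exact (real_inner_le_norm _ _).trans (by nlinarith)
    have h3 : inner ℝ u (m - p v) ≤ 0 := hp.inner_le_zero v hm
    have h4 : inner ℝ u u = inner ℝ u v - inner ℝ u (p v) := by
      rw [← inner_sub_right]
    rw [inner_add_right] at h1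
    rw [inner_sub_right] at h3
    exact absurd (real_inner_self_nonpos.1 (show inner ℝ u u ≤ (0 : ℝ) by linarith)) hu0
  · rintro hv _ ⟨b, hb, w, rfl, rfl⟩
    exact ⟨w, hv, b, hb, add_comm _ _⟩

/-- If `cB` is a Minkowski summand of the convex body `K` and `P` is the Steiner
polynomial of `K`, then the Steiner polynomial of the inner parallel body `K ∼ cB`
is `t ↦ P(t - c)`. -/
theorem steiner_polynomial_inner_parallel_body (n : ℕ)
    (K : Set (EuclideanSpace ℝ (Fin n)))
    (hKne : K.Nonempty) (hKcomp : IsCompact K) (hKconv : Convex ℝ K)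
    (c : ℝ) (hc : 0 ≤ c)
    (hsummand : ∃ M : Set (EuclideanSpace ℝ (Fin n)), M.Nonempty ∧ IsCompact M ∧
      Convex ℝ M ∧ M + c • closedBall (0 : EuclideanSpace ℝ (Fin n)) 1 = K)
    (P : Polynomial ℝ) (hPdeg : P.natDegree ≤ n)
    (hP : ∀ t : ℝ, 0 ≤ t →
      P.eval t = (volume (K + t • closedBall (0 : EuclideanSpace ℝ (Fin n)) 1)).toReal) :
    ∀ t : ℝ, 0 ≤ t →
      (volume (minkowskiDiff K (c • closedBall (0 : EuclideanSpace ℝ (Fin n)) 1)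
          + t • closedBall (0 : EuclideanSpace ℝ (Fin n)) 1)).toReal
        = P.eval (t - c) := by
  intro t ht
  obtain ⟨M, hne, hcomp, hconv, rfl⟩ := hsummand
  obtain ⟨Q, -, hQ⟩ := exists_steinerPolynomial
    (volume : Measure (EuclideanSpace ℝ (Fin n))) hne hcomp hconv
  have hcompP : Q.comp (Polynomial.X + Polynomial.C c) = P := by
    refine Polynomial.eq_of_infinite_eval_eq _ _ ((Set.Ici_infinite (0 : ℝ)).mono fun r hr ↦ ?_)
    have hr : 0 ≤ r := hr
    rw [Set.mem_ofPred_eq, Polynomial.eval_comp, hP r hr, smul_closedBall_zero_one hc,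
      smul_closedBall_zero_one hr, add_assoc, closedBall_add_closedBall hc hr, zero_add]
    simp only [Polynomial.eval_add, Polynomial.eval_X, Polynomial.eval_C]
    rw [hQ _ (add_nonneg hr hc), add_comm r c, Measure.real]
  rw [smul_closedBall_zero_one hc, smul_closedBall_zero_one ht,
    minkowskiDiff_add_closedBall hne hcomp hconv hc, ← hcompP, Polynomial.eval_comp]
  simp only [Polynomial.eval_add, Polynomial.eval_X, Polynomial.eval_C, sub_add_cancel]
  exact (hQ t ht).symm
end

section
/- Let K ⊆ ℝⁿ be a convex body, let c > 0, and suppose K is a Minkowski summand of cB (there exists a convex body M with M + K = cB). Then for every real t ≥ 0, the set equality (cB ∼ K) + tB = ((c + t)B) ∼ K holds, where ∼ denotes the Minkowski difference. -/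
open MeasureTheory Metric Pointwise

/-- Order cancellation for Minkowski sums: a compact summand can be cancelled from a translate
contained in a sum with a closed convex set. -/
theorem mem_of_add_singleton_subset_add {E : Type*} [NormedAddCommGroup E] [NormedSpace ℝ E]
    {K N : Set E} {v : E} (hKne : K.Nonempty) (hKcomp : IsCompact K)
    (hNconv : Convex ℝ N) (hNclosed : IsClosed N) (h : K + {v} ⊆ N + K) : v ∈ N := by
  by_contra hv
  obtain ⟨f, u, hfv, hfN⟩ := geometric_hahn_banach_point_closed hNconv hNclosed hv
  obtain ⟨k, hk, hmin⟩ := hKcomp.exists_isMinOn hKne f.continuous.continuousOn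
  obtain ⟨m, hm, k', hk', heq⟩ := h (Set.add_mem_add hk (Set.mem_singleton v))
  have hf : f m + f k' = f k + f v := by simpa using congrArg f heq
  linarith [hfN m hm, isMinOn_iff.mp hmin k' hk']

/-- If the convex body `K` is a Minkowski summand of `cB` and `t ≥ 0`, then
`(cB ∼ K) + tB = ((c + t)B) ∼ K`. -/
theorem complement_body_add_ball (n : ℕ) (K : Set (EuclideanSpace ℝ (Fin n)))
    (hKne : K.Nonempty) (hKcomp : IsCompact K) (hKconv : Convex ℝ K)
    (c : ℝ) (hc : 0 < c)
    (hsummand : ∃ M : Set (EuclideanSpace ℝ (Fin n)), M.Nonempty ∧ IsCompact M ∧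
      Convex ℝ M ∧ M + K = c • closedBall (0 : EuclideanSpace ℝ (Fin n)) 1)
    (t : ℝ) (ht : 0 ≤ t) :
    minkowskiDiff (c • closedBall (0 : EuclideanSpace ℝ (Fin n)) 1) K
        + t • closedBall (0 : EuclideanSpace ℝ (Fin n)) 1
      = minkowskiDiff ((c + t) • closedBall (0 : EuclideanSpace ℝ (Fin n)) 1) K := by
  rw [(convex_closedBall (0 : EuclideanSpace ℝ (Fin n)) 1).add_smul hc.le ht]
  apply Set.Subset.antisymm
  · rintro _ ⟨w, hw, b, hb, rfl⟩
    change K + {w + b} ⊆ _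
    rw [← Set.singleton_add_singleton, ← add_assoc]
    exact Set.add_subset_add hw (Set.singleton_subset_iff.mpr hb)
  · obtain ⟨M, -, hMcomp, hMconv, hMK⟩ := hsummand
    intro v hv
    have hB : IsCompact (t • closedBall (0 : EuclideanSpace ℝ (Fin n)) 1) :=
      (isCompact_closedBall _ _).smul t
    have hM : M ⊆ minkowskiDiff (c • closedBall (0 : EuclideanSpace ℝ (Fin n)) 1) K := by
      intro m hm
      change K + {m} ⊆ _
      rw [← hMK, add_comm M K]
      exact Set.add_subset_add_left (Set.singleton_subset_iff.mpr hm)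
    refine Set.add_subset_add_right hM (mem_of_add_singleton_subset_add hKne hKcomp
      (hMconv.add ((convex_closedBall _ _).smul t)) (hMcomp.add hB).isClosed ?_)
    rw [add_right_comm, hMK]
    exact hv
end
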